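/- Let 6/5 < γ < 2 with γ ≠ 4/3, let α = min((2−γ)/(γ−1), 1), let h(s) = (γ/(γ−1)) s^{γ−1}, let k ∈ C²(ℝ) and K(s) = ∫₀^s k(t) dt. Let R > 0 and let ρ₀ be the Lane–Emden solution of radius R: the radial, nonnegative function of class C^{1,α}(ℝ³), positive exactly on the open ball B_R and C² there, satisfying h(ρ₀(x)) − (ρ₀ * 1/|·|)(x) = constant on B_R. Then there exist ω̄ > 0 and ε̄ > 0 such that for all |ω| < ω̄ and |ε| < ε̄ there exist functions ρ = ρ_{ω,ε} and ψ = ψ_{ω,ε} with the following properties: ρ ∈ C^{1,α}(ℝ³) is nonnegative with compact support contained near B̄_R; ψ ∈ C^{3,α}(ℝ³); both ρ and ψ are axisymmetric and even in x₃; ∫_{ℝ³} ρ dx = ∫_{ℝ³} ρ₀ dx (independently of ω, ε); there is a constant λ such that h(ρ(x)) − ½ω²(x₁²+x₂²) − (ρ * 1/|·|)(x) + ε K(ψ(x)) = λ for every x with ρ(x) > 0; ∇·(r⁻²∇ψ)(x) = ε ρ(x) k(ψ(x)) at every x off the x₃-axis; and the mapping (ω, ε) ↦ (ρ, ψ) is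 continuous from (−ω̄, ω̄) × (−ε̄, ε̄) into C¹(B̄_{2R}) × C²₀(ℝ³). -/

import Mathlib

noncomputable section

open MeasureTheory Metric Set Filter

/-- ℝ³ with the Euclidean norm. -/
abbrev E3 := EuclideanSpace ℝ (Fin 3)

/-- Build a vector of ℝ³ from its coordinates. -/
def mk3 (a b c : ℝ) : E3 := (WithLp.equiv 2 (Fin 3 → ℝ)).symm ![a, b, c]

/-- The cylindrical radius r = √(x₁² + x₂²). -/
def cylRad (x : E3) : ℝ := Real.sqrt ((x 0)^2 + (x 1)^2)

/-- The reflection (x₁, x₂, x₃) ↦ (x₁, x₂, −x₃). -/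
def reflect3 (x : E3) : E3 := mk3 (x 0) (x 1) (-(x 2))

/-- Axisymmetric: a function of (r, x₃) only. -/
def Axisym (f : E3 → ℝ) : Prop := ∃ F : ℝ → ℝ → ℝ, ∀ x, f x = F (cylRad x) (x 2)

/-- Even in x₃. -/
def EvenZ (f : E3 → ℝ) : Prop := ∀ x, f (reflect3 x) = f x

/-- f ∈ C^{1,α}(ℝ³): f is C¹ and ∇f is α-Hölder. -/
def HolderC1 (α : ℝ) (f : E3 → ℝ) : Prop :=
  ContDiff ℝ 1 f ∧ ∃ C : ℝ, ∀ x y : E3, ‖fderiv ℝ f x - fderiv ℝ f y‖ ≤ C * ‖x - y‖ ^ α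

/-- f ∈ C^{3,α}(ℝ³): f is C³ and its third derivatives are α-Hölder. -/
def HolderC3 (α : ℝ) (f : E3 → ℝ) : Prop :=
  ContDiff ℝ 3 f ∧ ∃ C : ℝ, ∀ x y : E3,
    ‖iteratedFDeriv ℝ 3 f x - iteratedFDeriv ℝ 3 f y‖ ≤ C * ‖x - y‖ ^ α

/-- The Newtonian (gravitational) potential U = ρ * 1/|·|. -/
def pot (ρ : E3 → ℝ) (x : E3) : ℝ := ∫ y : E3, ρ y / ‖x - y‖

/-- The divergence of a vector field on ℝ³. -/
def div3 (V : E3 → E3) (x : E3) : ℝ :=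
  ∑ i, fderiv ℝ (fun y => V y i) x (EuclideanSpace.single i 1)

/-- The magnetic operator L ψ = ∇ · (r⁻² ∇ψ). -/
def LOp (ψ : E3 → ℝ) (x : E3) : ℝ :=
  div3 (fun y => (((y 0)^2 + (y 1)^2)⁻¹) • gradient ψ y) x

section
open scoped ContDiff Topology
lemma mlr {a b c : ℝ} (h : b ≤ c) (k : 0 ≤ a) : b * a ≤ c * a := mul_le_mul_of_nonneg_right h k
lemma mll {a b c : ℝ} (h : b ≤ c) (k : 0 ≤ a) : a * b ≤ a * c := mul_le_mul_of_nonneg_left h k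

def ee (i : Fin 3) : E3 := EuclideanSpace.single i 1
def pd (v : E3) (f : E3 → ℝ) (x : E3) : ℝ := fderiv ℝ f x v
def dd : List E3 → (E3 → ℝ) → E3 → ℝ
  | [], f => f
  | v :: l, f => dd l (pd v f)

lemma sum_ee (x : E3) : x = ∑ i, x i • ee i := by
  ext j; simp [ee, Finset.sum_apply, Pi.single_apply]

lemma norm_ee (i : Fin 3) : ‖ee i‖ =1 := by simp [ee]

lemma coord_le (x : E3) (i : Fin 3) : |x i| ≤ ‖x‖ := by
  simpa using PiLp.norm_apply_le x i

lemma clm_bd (A : E3 →L[ℝ] ℝ) {B : ℝ} (h : ∀ i, |A (ee i)| ≤ B) : ‖A‖ ≤3 * B := by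
  have hB : 0 ≤ B := (abs_nonneg _).trans (h 0)
  refine A.opNorm_le_bound (by positivity) fun x => ?_
  conv_lhs => rw [sum_ee x, map_sum]
  refine (norm_sum_le _ _).trans ?_
  calc ∑ i, ‖A (x i • ee i)‖ ≤ ∑ _i : Fin 3, B * ‖x‖ := by
        refine Finset.sum_le_sum fun i _ => ?_
        rw [map_smul, norm_smul, mul_comm]
        exact mul_le_mul (h i) (coord_le x i) (norm_nonneg _) hB
    _ =3 * B * ‖x‖ := by simp; ring

lemma clm_sum (A : E3 →L[ℝ] ℝ) :
    A = ∑ i, A (ee i) • (EuclideanSpace.proj i : E3 →L[ℝ] ℝ) := by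
  ext x
  conv_lhs => rw [sum_ee x, map_sum]
  simp [mul_comm]

lemma fd_sum (f : E3 → ℝ) :
    fderiv ℝ f = fun x => ∑ i, pd (ee i) f x • (EuclideanSpace.proj i : E3 →L[ℝ] ℝ) := by
  funext x; exact clm_sum _

lemma cd_succ {f : E3 → ℝ} {n : ℕ} (h : Differentiable ℝ f)
    (h' : ∀ i, ContDiff ℝ n (pd (ee i) f)) : ContDiff ℝ (n +1 : ℕ) f := by
  push_cast
  rw [contDiff_succ_iff_fderiv]
  refine ⟨h, by simp, ?_⟩
  rw [fd_sum]
  exact ContDiff.sum fun i _ => (h' i).smul contDiff_const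

lemma cd_pd {f : E3 → ℝ} {n : ℕ} (h : ContDiff ℝ (n +1 : ℕ) f) (v : E3) :
    ContDiff ℝ n (pd v f) := by
  push_cast at h
  exact (contDiff_succ_iff_fderiv.1 h).2.2.clm_apply contDiff_const

lemma cdi_pd {f : E3 → ℝ} (h : ContDiff ℝ ∞ f) (v : E3) : ContDiff ℝ ∞ (pd v f) :=
  (h.fderiv_right (m := ∞) (by simp)).clm_apply contDiff_const

lemma cdi_dd {f : E3 → ℝ} (h : ContDiff ℝ ∞ f) (l : List E3) : ContDiff ℝ ∞ (dd l f) := by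
  induction l generalizing f with
  | nil => exact h
  | cons v l ih => exact ih (cdi_pd h v)

lemma dd_append (l l' : List E3) (f : E3 → ℝ) : dd (l ++ l') f = dd l' (dd l f) := by
  induction l generalizing f with
  | nil => rfl
  | cons v l ih => exact ih _

lemma pd_lin {f g : E3 → ℝ} (hf : Differentiable ℝ f) (hg : Differentiable ℝ g) (a b : ℝ) (v : E3) :
    pd v (fun x => a * f x + b * g x) = fun x => a * pd v f x + b * pd v g x := by
  funext x
  simp only [pd]
  have : HasFDerivAt (fun x => a * f x + b * g x) _ x :=
    ((hf x).hasFDerivAt.const_mul a).add ((hg x).hasFDerivAt.const_mul b)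
  rw [this.fderiv]
  simp

lemma dd_lin {f g : E3 → ℝ} (a b : ℝ) (l : List E3) (hf : ContDiff ℝ l.length f)
    (hg : ContDiff ℝ l.length g) :
    dd l (fun x => a * f x + b * g x) = fun x => a * dd l f x + b * dd l g x := by
  induction l generalizing f g with
  | nil => rfl
  | cons v l ih =>
    have h0 : ((l.length +1 : ℕ) : WithTop ℕ∞) ≠0 := by simp
    simp only [dd]
    rw [pd_lin (hf.differentiable h0) (hg.differentiable h0), ih (cd_pd hf v) (cd_pd hg v)]

lemma dd_sub {f g : E3 → ℝ} (l : List E3) (hf : ContDiff ℝ l.length f)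
    (hg : ContDiff ℝ l.length g) :
    dd l (fun x => f x - g x) = fun x => dd l f x - dd l g x := by
  have := dd_lin 1 (-1) l hf hg
  simpa [← sub_eq_add_neg] using this

lemma dd_scale {a : E3 → ℝ} (ha : ContDiff ℝ ∞ a) (c t : ℝ) (l : List E3) :
    dd l (fun x => c * a (t • x)) = fun x => c * t ^ l.length * dd l a (t • x) := by
  induction l generalizing a c with
  | nil => simp [dd]
  | cons v l ih =>
    have : pd v (fun x => c * a (t • x)) = fun x => (c * t) * pd v a (t • x) := by
      funext x
      have h1 := (ha.differentiable (by simp) (t • x)).hasFDerivAt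
      have h2 : HasFDerivAt (fun x => c * a (t • x)) _ x :=
        (h1.comp x ((hasFDerivAt_id x).const_smul t)).const_mul c
      simp only [pd]
      rw [h2.fderiv]
      simp [mul_assoc]
    simp only [dd, this, ih (cdi_pd ha v), List.length_cons]
    funext x; ring

def SB (κ : E3 → ℝ) : Prop := ContDiff ℝ ∞ κ ∧ ∀ l, ∃ C, ∀ x, |dd l κ x| ≤ C

lemma SB.pd {κ : E3 → ℝ} (h : SB κ) (v : E3) : SB (pd v κ) :=
  ⟨cdi_pd h.1 v, fun l => h.2 (v :: l)⟩

lemma SB.dd {κ : E3 → ℝ} (h : SB κ) (l : List E3) : SB (dd l κ) :=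
  ⟨cdi_dd h.1 l, fun l' => by rw [← dd_append]; exact h.2 _⟩

lemma SB.lin {a b : E3 → ℝ} (ha : SB a) (hb : SB b) (s t : ℝ) : SB (fun x => s * a x + t * b x) := by
  refine ⟨(contDiff_const.mul ha.1).add (contDiff_const.mul hb.1), fun l => ?_⟩
  obtain ⟨C, hC⟩ := ha.2 l
  obtain ⟨D, hD⟩ := hb.2 l
  refine ⟨|s| * C + |t| * D, fun x => ?_⟩
  rw [dd_lin s t l (ha.1.of_le (by exact_mod_cast le_top)) (hb.1.of_le (by exact_mod_cast le_top))]
  refine (abs_add_le _ _).trans ?_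
  rw [abs_mul, abs_mul]
  gcongr; exacts [hC x, hD x]

lemma SB.scale {a : E3 → ℝ} (ha : SB a) (c t : ℝ) : SB (fun x => c * a (t • x)) := by
  refine ⟨contDiff_const.mul (ha.1.comp (by fun_prop)), fun l => ?_⟩
  obtain ⟨C, hC⟩ := ha.2 l
  refine ⟨|c * t ^ l.length| * C, fun x => ?_⟩
  rw [dd_scale ha.1, abs_mul]
  gcongr; exact hC _

def cv (f κ : E3 → ℝ) (x : E3) : ℝ := ∫ y, f y * κ (x - y)

lemma cv_int {f κ : E3 → ℝ} (hf : Integrable f) (hκ : SB κ) (x : E3) :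
    Integrable (fun y => f y * κ (x - y)) := by
  obtain ⟨C, hC⟩ := hκ.2 []
  refine (hf.norm.mul_const C).mono' ?_ (Eventually.of_forall fun y => ?_)
  · exact hf.1.mul (hκ.1.continuous.comp (by fun_prop)).aestronglyMeasurable
  · rw [norm_mul]; gcongr; exact hC _

lemma SB.fd_bd {κ : E3 → ℝ} (h : SB κ) : ∃ C, ∀ x, ‖fderiv ℝ κ x‖ ≤ C := by
  choose C hC using fun i => h.2 [ee i]
  refine ⟨3 * ∑ i, |C i|, fun x => clm_bd _ fun i => (hC i x).trans ?_⟩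
  exact (le_abs_self _).trans (Finset.single_le_sum (f := fun i => |C i|) (fun _ _ => abs_nonneg _)
    (Finset.mem_univ i))

lemma cv_fd {f κ : E3 → ℝ} (hf : Integrable f) (hκ : SB κ) (x : E3) :
    HasFDerivAt (cv f κ) (∫ y, f y • fderiv ℝ κ (x - y)) x := by
  obtain ⟨C, hC⟩ := hκ.fd_bd
  have hcf : Continuous (fderiv ℝ κ) := hκ.1.continuous_fderiv (by simp)
  refine hasFDerivAt_integral_of_dominated_of_fderiv_le (𝕜 := ℝ) (s := univ)
    (F' := fun x y => f y • fderiv ℝ κ (x - y)) (bound := fun y => ‖f y‖ * C)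
    univ_mem (Eventually.of_forall fun x => (cv_int hf hκ x).1) (cv_int hf hκ x) ?_ ?_
    (hf.norm.mul_const C) ?_
  · exact hf.1.smul (hcf.comp (by fun_prop)).aestronglyMeasurable
  · refine Eventually.of_forall fun y z _ => ?_
    rw [norm_smul]; gcongr; exact hC _
  · refine Eventually.of_forall fun y z _ => ?_
    have h1 := (hκ.1.differentiable (by simp) (z - y)).hasFDerivAt
    have := (h1.comp z ((hasFDerivAt_id z).sub_const y)).const_mul (f y)
    simpa using this

lemma cv_pd {f κ : E3 → ℝ} (hf : Integrable f) (hκ : SB κ) (v : E3) :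
    pd v (cv f κ) = cv f (pd v κ) := by
  funext x
  obtain ⟨C, hC⟩ := hκ.fd_bd
  have hcf : Continuous (fderiv ℝ κ) := hκ.1.continuous_fderiv (by simp)
  simp only [pd, (cv_fd hf hκ x).fderiv]
  rw [ContinuousLinearMap.integral_apply]
  · rfl
  refine (hf.norm.mul_const C).mono' ?_ (Eventually.of_forall fun y => ?_)
  · exact hf.1.smul (hcf.comp (by fun_prop)).aestronglyMeasurable
  · rw [norm_smul]; gcongr; exact hC _

lemma cv_dd {f κ : E3 → ℝ} (hf : Integrable f) (hκ : SB κ) (l : List E3) :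
    dd l (cv f κ) = cv f (dd l κ) := by
  induction l generalizing κ with
  | nil => rfl
  | cons v l ih => simp only [dd]; rw [cv_pd hf hκ, ih (hκ.pd v)]

lemma cv_smooth {f κ : E3 → ℝ} (hf : Integrable f) (hκ : SB κ) : ContDiff ℝ ∞ (cv f κ) := by
  rw [contDiff_infty]
  intro n
  have hd : ∀ κ, SB κ → Differentiable ℝ (cv f κ) := fun κ h x => (cv_fd hf h x).differentiableAt
  induction n generalizing κ with
  | zero => simpa using (hd κ hκ).continuous
  | succ n ih => exact cd_succ (hd κ hκ) fun i => by rw [cv_pd hf hκ]; exact ih (hκ.pd _)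

lemma lim_cd {m : ℕ} {g : ℕ → E3 → ℝ} {g0 : E3 → ℝ} {r : ℝ} (hr0 : 0 ≤ r) (hr : r <1)
    (hg : ∀ j, ContDiff ℝ ∞ (g j))
    (hC : ∀ l : List E3, l.length ≤ m → ∃ C, ∀ j x, |dd l (g (j+1)) x - dd l (g j) x| ≤ C * r ^ j)
    (hlim : ∀ x, Tendsto (fun j => g j x) atTop (𝓝 (g0 x))) :
    ContDiff ℝ m g0 ∧ ∀ l : List E3, l.length ≤ m → ∀ x,
      Tendsto (fun j => dd l (g j) x) atTop (𝓝 (dd l g0 x)) := by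
  have unif : ∀ (a : ℕ → E3 → ℝ) (C : ℝ), (∀ j x, |a (j+1) x - a j x| ≤ C * r ^ j) →
      ∃ b, TendstoUniformly a b atTop := by
    intro a C ha
    have hc : ∀ x, CauchySeq (fun j => a j x) := fun x =>
      cauchySeq_of_le_geometric r C hr fun j => by
        rw [dist_comm, Real.dist_eq]; exact ha j x
    choose b hb using fun x => cauchySeq_tendsto_of_complete (hc x)
    refine ⟨b, Metric.tendstoUniformly_iff.2 fun η hη => ?_⟩
    have h2 : Tendsto (fun j => C * r ^ j / (1 - r)) atTop (𝓝 0) := by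
      simpa using ((tendsto_pow_atTop_nhds_zero_of_lt_one hr0 hr).const_mul C).div_const (1 - r)
    filter_upwards [h2.eventually (gt_mem_nhds hη)] with j hj x
    rw [dist_comm]
    refine (dist_le_of_le_geometric_of_tendsto r C hr (fun j => ?_) (hb x) j).trans_lt hj
    rw [dist_comm, Real.dist_eq]; exact ha j x
  induction m generalizing g g0 with
  | zero =>
    obtain ⟨C, h⟩ := hC [] (by simp)
    obtain ⟨b, hb⟩ := unif _ C h
    have : g0 = b := funext fun x => tendsto_nhds_unique (hlim x) (hb.tendsto_at x)
    refine ⟨by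
      rw [this]; exact contDiff_zero.2 (hb.continuous (Frequently.of_forall fun j => (hg j).continuous)), ?_⟩
    intro l hl x
    rw [List.length_eq_zero_iff.1 (Nat.le_zero.1 hl)]
    exact hlim x
  | succ m ih =>
    have hb : ∀ v : E3, ∃ b, TendstoUniformly (fun j => pd v (g j)) b atTop := fun v => by
      obtain ⟨C, h⟩ := hC [v] (by simp)
      exact unif _ C h
    choose b hb using hb
    have hfd : ∀ x, HasFDerivAt g0
        (∑ i, b (ee i) x • (EuclideanSpace.proj i : E3 →L[ℝ] ℝ)) x := by
      intro x
      refine hasFDerivAt_of_tendstoUniformly (f' := fun j => fderiv ℝ (g j)) (l := atTop)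
        (g' := fun x => ∑ i, b (ee i) x • (EuclideanSpace.proj i : E3 →L[ℝ] ℝ)) ?_
        (fun j x => ((hg j).differentiable (by simp) x).hasFDerivAt) (hlim) x
      rw [Metric.tendstoUniformly_iff]
      intro η hη
      have : ∀ᶠ j in atTop, ∀ i, ∀ x, dist (b (ee i) x) (pd (ee i) (g j) x) < η /4 :=
        eventually_all.2 fun i => Metric.tendstoUniformly_iff.1 (hb (ee i)) _ (by positivity)
      filter_upwards [this] with j hj x
      rw [dist_eq_norm]
      refine (clm_bd (B := η /4) _ fun i => ?_).trans_lt (by linarith)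
      have := (hj i x).le
      rw [Real.dist_eq] at this
      fin_cases i <;> simpa [Fin.sum_univ_three, ee, pd] using this
    have hpd : ∀ v x, Tendsto (fun j => pd v (g j) x) atTop (𝓝 (pd v g0 x)) := by
      intro v x
      have h1 : ∀ f : E3 → ℝ, pd v f x = ∑ i, v i * pd (ee i) f x := by
        intro f; simp only [pd]; conv_lhs => rw [sum_ee v, map_sum]
        simp
      have h2 : ∀ i, pd (ee i) g0 x = b (ee i) x := by
        intro i; simp only [pd, (hfd x).fderiv]
        fin_cases i <;> simp [Fin.sum_univ_three, ee]
      simp only [h1, h2]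
      exact tendsto_finsetSum _ fun i _ => ((hb (ee i)).tendsto_at x).const_mul _
    have key := fun v => ih (g := fun j => pd v (g j)) (g0 := pd v g0) (fun j => cdi_pd (hg j) v)
      (fun l hl => hC (v :: l) (by simpa using hl)) (hpd v)
    refine ⟨cd_succ (fun x => (hfd x).differentiableAt) fun i => (key _).1, ?_⟩
    intro l hl x
    cases l with
    | nil => exact hlim x
    | cons v l => exact (key v).2 l (by simpa using hl) x

lemma iter_bd {m : ℕ} : ∃ D : ℝ, 0 ≤ D ∧ ∀ (f : E3 → ℝ) (B : ℝ) (x : E3), ContDiff ℝ m f →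
    (∀ l : List E3, l.length = m → (∀ v ∈ l, ∃ i, v = ee i) → |dd l f x| ≤ B) →
      ‖iteratedFDeriv ℝ m f x‖ ≤ D * B := by
  induction m with
  | zero =>
    refine ⟨1, zero_le_one, fun f B x hf h => ?_⟩
    rw [norm_iteratedFDeriv_zero, one_mul]; exact h [] rfl (by simp)
  | succ m ih =>
    obtain ⟨D, hD, ih⟩ := ih
    let p : Fin 3 → E3 →L[ℝ] ℝ := fun i => EuclideanSpace.proj i
    refine ⟨∑ i, ‖p i‖ * D, Finset.sum_nonneg fun i _ => by positivity, fun f B x hf h => ?_⟩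
    rw [← norm_iteratedFDeriv_fderiv, fd_sum, Finset.sum_mul]
    have hc : ∀ i, ContDiff ℝ m (pd (ee i) f) := fun i => cd_pd hf _
    let q : Fin 3 → ℝ →L[ℝ] (E3 →L[ℝ] ℝ) := fun i => (ContinuousLinearMap.id ℝ ℝ).smulRight (p i)
    have e : (fun x => ∑ i, pd (ee i) f x • (EuclideanSpace.proj i : E3 →L[ℝ] ℝ))
        = fun x => ∑ i, ((q i) ∘ (pd (ee i) f)) x := by funext x; simp [q, p]
    rw [e, iteratedFDeriv_sum (fun i _ => ((q i).contDiff.comp (hc i)))]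
    rw [Finset.sum_apply]
    refine (norm_sum_le _ _).trans (Finset.sum_le_sum fun i _ => ?_)
    have h1 := (q i).norm_iteratedFDeriv_comp_left (hc i).contDiffAt (n := m) (x := x) le_rfl
    refine h1.trans ?_
    have h2 : ‖q i‖ ≤ ‖p i‖ := by
      refine ContinuousLinearMap.opNorm_le_bound _ (norm_nonneg _) fun t => ?_
      simp [q, norm_smul, mul_comm]
    rw [mul_assoc]
    refine mul_le_mul h2 (ih _ B x (hc i) fun l hl hv => ?_) (norm_nonneg _) (norm_nonneg _)
    exact h (ee i :: l) (by simpa using hl) (by simpa using hv)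

structure Den (A L : ℝ) (f : E3 → ℝ) : Prop where
  meas : Measurable f
  bd : ∀ x, |f x| ≤ L
  supp : ∀ x, A < ‖x‖ → f x =0

lemma Den.nn {A L f} (h : Den A L f) : 0 ≤ L := (abs_nonneg _).trans (h.bd 0)

lemma Den.le_ind {A L f} (h : Den A L f) (x : E3) :
    |f x| ≤ (closedBall (0:E3) A).indicator (fun _ => L) x := by
  by_cases hx : ‖x‖ ≤ A
  · rw [indicator_of_mem (by simpa using hx)]; exact h.bd x
  · rw [h.supp x (not_le.1 hx)]; simp [indicator_nonneg (fun _ _ => h.nn)]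

lemma ball_int (A L : ℝ) (z : E3) : Integrable ((closedBall z A).indicator (fun _ => L)) :=
  (integrable_indicator_iff measurableSet_closedBall).2
    (integrableOn_const (by exact measure_closedBall_lt_top.ne))

lemma Den.int {A L f} (h : Den A L f) : Integrable f :=
  (ball_int A L 0).mono' h.meas.aestronglyMeasurable (Eventually.of_forall h.le_ind)

lemma Den.int_bd {A L f} (h : Den A L f) :
    ∫ y, |f y| ≤ L * (volume : Measure E3).real (closedBall 0 A) := by
  refine (integral_mono h.int.norm (ball_int A L 0) h.le_ind).trans ?_
  rw [integral_indicator measurableSet_closedBall]; simp [mul_comm]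

lemma inv_int (A : ℝ) :
    Integrable (fun z : E3 => (closedBall (0:E3) A).indicator (fun z => 1 +1 / ‖z‖) z) := by
  have h := (integrable_fun_norm_addHaar (volume : Measure E3)
    (f := (Iic A).indicator fun y => 1 +1 / y)).2 ?_
  · refine h.congr (Eventually.of_forall fun z => ?_)
    by_cases hz : ‖z‖ ≤ A <;> simp [indicator, hz]
  · have : IntegrableOn (fun y : ℝ => y ^2 + y) (Ioc 0 A) :=
      ((by fun_prop : Continuous fun y : ℝ => y ^2 + y).integrableOn_Icc).mono_set Ioc_subset_Icc_self
    have h2 : IntegrableOn ((Iic A).indicator (fun y : ℝ => y ^2 + y)) (Ioi 0) := by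
      rw [IntegrableOn, integrable_indicator_iff measurableSet_Iic, IntegrableOn,
        Measure.restrict_restrict measurableSet_Iic, inter_comm, Ioi_inter_Iic]
      exact this
    refine h2.congr_fun (fun y (hy : 0 < y) => ?_) measurableSet_Ioi
    by_cases hA : y ≤ A <;> simp [indicator, hA]
    field_simp

structure Ker (d : ℕ) (N far : E3 → ℝ) : Prop where
  sb : SB far
  eq : ∀ x, 1 ≤ ‖x‖ → far x = N x
  hom : ∀ t : ℝ, 0 < t → ∀ x, N (t • x) * t ^ d = N x
  le : ∀ x, |far x| ≤ |N x|
  bd : ∀ x, |N x| ≤1 +1 / ‖x‖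
  meas : Measurable N
  d1 : d ≤1

lemma sing_int {A L f} (hf : Den A L f) (x : E3) :
    Integrable (fun y => |f y| * (1 +1 / ‖x - y‖)) := by
  have h := ((inv_int (A + ‖x‖)).comp_sub_left x).const_mul L
  refine h.mono' (Measurable.aestronglyMeasurable ?_) (Eventually.of_forall fun y => ?_)
  · have := hf.meas; fun_prop
  · have h0 : 0 ≤1 +1 / ‖x - y‖ := by positivity
    simp only [norm_mul, norm_abs_eq_norm, Real.norm_eq_abs, abs_of_nonneg h0]
    by_cases hy : ‖y‖ ≤ A
    · rw [indicator_of_mem]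
      · gcongr; exact hf.bd y
      · simp only [mem_closedBall, dist_zero_right]
        linarith [norm_sub_le x y]
    · rw [hf.supp y (not_le.1 hy)]
      have := hf.nn
      simp only [abs_zero, zero_mul]
      exact mul_nonneg this (indicator_nonneg (fun z _ => by positivity) _)

lemma Ker.int {d N far} (_hK : Ker d N far) {A L f} (hf : Den A L f) {g : E3 → ℝ} (hg : Measurable g)
    (hgb : ∀ z, |g z| ≤1 +1 / ‖z‖) (x : E3) : Integrable (fun y => f y * g (x - y)) := by
  refine (sing_int hf x).mono' ?_ (Eventually.of_forall fun y => ?_)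
  · exact (hf.meas.mul (hg.comp (by fun_prop))).aestronglyMeasurable
  · rw [norm_mul]; exact mll (hgb _) (abs_nonneg _)

def farM (d : ℕ) (far : E3 → ℝ) (M : ℕ) (x : E3) : ℝ := 2 ^ (d * M) * far ((2:ℝ) ^ M • x)

def zet (d : ℕ) (far : E3 → ℝ) (x : E3) : ℝ := 2 ^ d * far ((2:ℝ) • x) + (-1) * far x

lemma farM_succ (d far M) : farM d far (M +1) = fun x => 1 * farM d far M x +
    1 * (2 ^ (d * M) * zet d far ((2:ℝ) ^ M • x)) := by
  funext x; simp only [farM, zet, smul_smul]; ring_nf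

lemma Ker.sbM {d N far} (hK : Ker d N far) (M : ℕ) : SB (farM d far M) := hK.sb.scale _ _

lemma Ker.sbz {d N far} (hK : Ker d N far) : SB (zet d far) := by
  have := (hK.sb.scale (2 ^ d) 2).lin hK.sb 1 (-1)
  have e : zet d far = fun x => 1 * (2 ^ d * far ((2:ℝ) • x)) + (-1) * far x := by
    funext x; simp [zet]
  rwa [e]

lemma Ker.zz {d N far} (hK : Ker d N far) (x : E3) (hx : 1 ≤ ‖x‖) : zet d far x =0 := by
  have h2 : (1:ℝ) ≤ ‖(2:ℝ) • x‖ := by rw [norm_smul]; norm_num; linarith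
  rw [zet, hK.eq x hx, hK.eq _ h2]
  have := hK.hom 2 (by norm_num) x
  linarith

lemma Ker.farM_bd {d N far} (hK : Ker d N far) (M : ℕ) (z : E3) :
    |farM d far M z| ≤1 +1 / ‖z‖ := by
  have h := hK.hom (2 ^ M) (by positivity) z
  rw [farM, abs_mul, abs_of_pos (by positivity : (0:ℝ) <2 ^ (d * M))]
  refine le_trans ?_ (hK.bd z)
  rw [← h, abs_mul, abs_of_pos (by positivity : (0:ℝ) < (2 ^ M) ^ d), mul_comm, ← pow_mul, mul_comm d M]
  exact mlr (hK.le _) (by positivity)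

lemma Ker.lim {d N far} (hK : Ker d N far) {A L f} (hf : Den A L f) (x : E3) :
    Tendsto (fun M => cv f (farM d far M) x) atTop (𝓝 (cv f N x)) := by
  refine tendsto_integral_of_dominated_convergence (fun y => |f y| * (1 +1 / ‖x - y‖))
    (fun M => ?_) (sing_int hf x) (fun M => Eventually.of_forall fun y => ?_) ?_
  · exact (cv_int hf.int (hK.sbM M) x).1
  · rw [norm_mul]; exact mll (hK.farM_bd M _) (abs_nonneg _)
  · have : ∀ᵐ y ∂(volume : Measure E3), y ≠ x := by simp [ae_iff, measure_singleton]
    filter_upwards [this] with y hy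
    have hz : 0 < ‖x - y‖ := norm_pos_iff.2 (sub_ne_zero.2 hy.symm)
    refine Tendsto.const_mul _ (tendsto_const_nhds.congr' ?_)
    have ht : Tendsto (fun M : ℕ => (2:ℝ) ^ M * ‖x - y‖) atTop atTop :=
      (tendsto_pow_atTop_atTop_of_one_lt one_lt_two).atTop_mul_const hz
    filter_upwards [ht.eventually_ge_atTop 1] with M hM
    rw [farM, hK.eq _ (by rw [norm_smul]; simpa using hM), ← hK.hom (2 ^ M) (by positivity) (x - y)]
    rw [← pow_mul, mul_comm M d, mul_comm]

def CS (η : E3 → ℝ) : Prop := ContDiff ℝ ∞ η ∧ ∀ x, 1 < ‖x‖ → η x =0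

lemma CS.cs {η} (h : CS η) : HasCompactSupport η :=
  HasCompactSupport.of_support_subset_isCompact (isCompact_closedBall (0:E3) 1) fun x hx => by
    by_contra hc; exact hx (h.2 x (by simpa using hc))

lemma CS.pd {η} (h : CS η) (v : E3) : CS (pd v η) := by
  refine ⟨cdi_pd h.1 v, fun x hx => ?_⟩
  have : η =ᶠ[𝓝 x] fun _ => (0:ℝ) := by
    filter_upwards [(isOpen_lt continuous_const continuous_norm).mem_nhds hx] with y hy using h.2 y hy
  simp [_root_.pd, this.fderiv_eq]

lemma CS.dd {η} (h : CS η) (l : List E3) : CS (dd l η) := by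
  induction l generalizing η with
  | nil => exact h
  | cons v l ih => exact ih (h.pd v)

lemma CS.intg {η} (h : CS η) {P : E3 → ℝ} (hP : Continuous P) : Integrable (fun w => P w * η w) :=
  (hP.mul h.1.continuous).integrable_of_hasCompactSupport h.cs.mul_left

lemma CS.ibp {η} (h : CS η) {P : E3 → ℝ} (hP : ContDiff ℝ 1 P) (v : E3) :
    ∫ w, P w * _root_.pd v η w = -∫ w, _root_.pd v P w * η w :=
  integral_mul_fderiv_eq_neg_fderiv_mul_of_integrable
    (h.intg ((hP.continuous_fderiv (by simp)).clm_apply continuous_const))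
    ((h.pd v).intg hP.continuous) (h.intg hP.continuous)
    (fun x _ => hP.differentiable (by simp) x) (fun x _ => h.1.differentiable (by simp) x)

lemma CS.mom0 {η} (h : CS η) (l : List E3) (hl : 1 ≤ l.length) (a : ℝ) :
    ∫ w, a * _root_.dd l η w =0 := by
  obtain ⟨l, v, rfl⟩ := List.eq_nil_or_concat l |>.resolve_left (by rintro rfl; simp at hl)
  have := (h.dd l).ibp (P := fun _ => a) contDiff_const v
  simpa [dd_append, _root_.dd, _root_.pd] using this

lemma CS.mom1 {η} (h : CS η) (l : List E3) (hl : 2 ≤ l.length) (a : ℝ) (φ : E3 →L[ℝ] ℝ) :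
    ∫ w, (a + φ w) * _root_.dd l η w =0 := by
  obtain ⟨l, v, rfl⟩ := List.eq_nil_or_concat l |>.resolve_left (by rintro rfl; simp at hl)
  have := (h.dd l).ibp (P := fun w => a + φ w) (by fun_prop) v
  simp only [List.concat_eq_append, dd_append, _root_.dd]
  rw [this]
  simp only [_root_.pd, fderiv_const_add, ContinuousLinearMap.fderiv]
  rw [h.mom0 l (by simpa using hl)]; simp

lemma Ker.cs {d N far} (hK : Ker d N far) : CS (zet d far) := ⟨hK.sbz.1, fun x hx => hK.zz x hx.le⟩

lemma cv_scale {f η : E3 → ℝ} {t : ℝ} (ht : 0 < t) (x : E3) :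
    cv f (fun z => η (t • z)) x = (t ^3)⁻¹ * ∫ w, f (x - t⁻¹ • w) * η w := by
  have h1 : cv f (fun z => η (t • z)) x = ∫ z, f (x - z) * η (t • z) := by
    rw [cv, ← integral_sub_left_eq_self (fun z => f (x - z) * η (t • z)) volume x]
    simp
  have h2 := Measure.integral_comp_smul (volume : Measure E3)
    (fun w => f (x - t⁻¹ • w) * η w) t
  simp only [smul_smul, inv_mul_cancel₀ ht.ne', one_smul] at h2
  rw [h1, h2]
  simp [abs_of_pos ht]

lemma Ker.step {d N far} (hK : Ker d N far) {f : E3 → ℝ} (hf : Integrable f) (l : List E3) (j : ℕ) (x : E3) :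
    dd l (cv f (farM d far (j+1))) x - dd l (cv f (farM d far j)) x =
      2 ^ ((d + l.length) * j) /8 ^ j * ∫ w, f (x - ((2:ℝ) ^ j)⁻¹ • w) * dd l (zet d far) w := by
  have hz : SB (fun x => (2:ℝ) ^ (d * j) * zet d far ((2:ℝ) ^ j • x)) := hK.sbz.scale _ _
  rw [cv_dd hf (hK.sbM _), cv_dd hf (hK.sbM _), farM_succ, dd_lin 1 1 l
    ((hK.sbM j).1.of_le (by exact_mod_cast le_top)) (hz.1.of_le (by exact_mod_cast le_top)),
    dd_scale hK.sbz.1]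
  have h1 := cv_int hf ((hK.sbM j).dd l) x
  have h2 := cv_int hf ((hK.sbz.dd l).scale (2 ^ (d * j) * (2 ^ j) ^ l.length) (2 ^ j)) x
  have h3 := cv_scale (f := f) (η := dd l (zet d far)) (by positivity : (0:ℝ) <2 ^ j) x
  have h4 : ((2:ℝ) ^ j) ^3 =8 ^ j := by rw [← pow_mul, mul_comm, pow_mul]; norm_num
  have h5 : cv f (fun z => 2 ^ (d * j) * (2 ^ j) ^ l.length * dd l (zet d far) ((2:ℝ) ^ j • z)) x
      =2 ^ (d * j) * (2 ^ j) ^ l.length * cv f (fun z => dd l (zet d far) ((2:ℝ) ^ j • z)) x := by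
    simp only [cv, ← integral_const_mul]; congr 1; ext; ring
  have h6 : cv f (fun z => 1 * dd l (farM d far j) z +1 * (2 ^ (d * j) * (2 ^ j) ^ l.length *
      dd l (zet d far) ((2:ℝ) ^ j • z))) x = cv f (dd l (farM d far j)) x +
      cv f (fun z => 2 ^ (d * j) * (2 ^ j) ^ l.length * dd l (zet d far) ((2:ℝ) ^ j • z)) x := by
    simp only [cv]
    rw [← integral_add h1 h2]; congr 1; ext; ring
  rw [h6, h5, h3, h4, add_mul, pow_add, ← pow_mul, mul_comm j l.length]
  ring

lemma osc_bd {f η P : E3 → ℝ} (hη : CS η) (hf : Measurable f) {L : ℝ} (hL : ∀ x, |f x| ≤ L)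
    (hP : Continuous P) (h0 : ∫ w, P w * η w =0) {x : E3} {t E : ℝ}
    (hE : ∀ w, ‖w‖ ≤1 → |f (x - t • w) - P w| ≤ E) :
    |∫ w, f (x - t • w) * η w| ≤ E * ∫ w, |η w| := by
  have hi : Integrable η := by simpa using hη.intg (P := fun _ => 1) continuous_const
  have h1 : Integrable (fun w => f (x - t • w) * η w) :=
    hi.bdd_mul (c := L) (hf.comp (by fun_prop)).aestronglyMeasurable
      (Eventually.of_forall fun w => hL _)
  have h2 : ∫ w, f (x - t • w) * η w = ∫ w, (f (x - t • w) - P w) * η w := by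
    simp only [sub_mul]; rw [integral_sub h1 (hη.intg hP), h0, sub_zero]
  rw [h2, ← integral_const_mul]
  refine abs_integral_le_integral_abs.trans (integral_mono ?_ (hi.norm.const_mul E) fun w => ?_)
  · simp only [sub_mul]; exact (h1.sub (hη.intg hP)).norm
  · simp only [abs_mul]
    by_cases hw : ‖w‖ ≤1
    · exact mlr (hE w hw) (abs_nonneg _)
    · simp [hη.2 w (not_le.1 hw)]

lemma Ker.main {d N far} (hK : Ker d N far) (A r : ℝ) (hr0 : 0 < r) (hr1 : r <1) (l : List E3) :
    ∃ C, 0 ≤ C ∧ ∀ (f : E3 → ℝ) (L : ℝ) (E : ℕ → ℝ), Den A L f →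
      (∀ j, 2 ^ ((d + l.length) * j) /8 ^ j * E j ≤ L * r ^ j) →
      (∀ j x, ∃ P : E3 → ℝ, Continuous P ∧ (∫ w, P w * dd l (zet d far) w =0) ∧
        ∀ w, ‖w‖ ≤1 → |f (x - ((2:ℝ) ^ j)⁻¹ • w) - P w| ≤ E j) →
      (∀ j x, |dd l (cv f (farM d far (j+1))) x - dd l (cv f (farM d far j)) x| ≤ C * L * r ^ j) ∧
      ∀ j x, |dd l (cv f (farM d far j)) x| ≤ C * L := by
  obtain ⟨B, hB⟩ := hK.sb.2 l
  have hB0 : 0 ≤ B := (abs_nonneg _).trans (hB 0)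
  set I := ∫ w, |dd l (zet d far) w| with hI
  have hI0 : 0 ≤ I := integral_nonneg fun _ => abs_nonneg _
  set V := (volume : Measure E3).real (closedBall 0 A)
  have h1r : 0 <1 - r := by linarith
  refine ⟨I + B * V + I / (1 - r), by positivity, fun f L E hf hE hP => ?_⟩
  have hL := hf.nn
  have hst : ∀ j x, |dd l (cv f (farM d far (j+1))) x - dd l (cv f (farM d far j)) x| ≤ I * L * r ^ j := by
    intro j x
    obtain ⟨P, hPc, hP0, hPE⟩ := hP j x
    rw [hK.step hf.int, abs_mul, abs_of_nonneg (by positivity)]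
    have := osc_bd (hK.cs.dd l) hf.meas hf.bd hPc hP0 hPE
    calc _ ≤2 ^ ((d + l.length) * j) /8 ^ j * (E j * I) := by gcongr
      _ = (2 ^ ((d + l.length) * j) /8 ^ j * E j) * I := by ring
      _ ≤ (L * r ^ j) * I := mlr (hE j) hI0
      _ = _ := by ring
  refine ⟨fun j x => (hst j x).trans ?_, fun j x => ?_⟩
  · gcongr
    have : 0 ≤ B * V + I / (1 - r) := by positivity
    linarith
  · have h0 : |dd l (cv f (farM d far 0)) x| ≤ B * V * L := by
      have : farM d far 0 = far := by funext z; simp [farM]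
      rw [this, cv_dd hf.int hK.sb]
      calc |cv f (dd l far) x| ≤ ∫ y, |f y| * B := by
            refine abs_integral_le_integral_abs.trans (integral_mono (cv_int hf.int (hK.sb.dd l) x).norm
              (hf.int.norm.mul_const B) fun y => ?_)
            simp only [abs_mul]; exact mll (hB _) (abs_nonneg _)
        _ ≤ B * V * L := by
            rw [integral_mul_const]
            calc _ ≤ (L * V) * B := mlr hf.int_bd hB0
              _ = _ := by ring
    have h1 : ∀ j, |dd l (cv f (farM d far j)) x| ≤ B * V * L + I * L * ((1 - r ^ j) / (1 - r)) := by
      intro j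
      induction j with
      | zero => simpa using h0
      | succ j ih =>
        have e : (1 - r ^ (j+1)) / (1 - r) = (1 - r ^ j) / (1 - r) + r ^ j := by field_simp; ring
        rw [e]
        have := (abs_sub_abs_le_abs_sub _ _).trans (hst j x)
        linarith
    refine (h1 j).trans ?_
    have h2 : (1 - r ^ j) / (1 - r) ≤1 / (1 - r) := by
      gcongr; linarith [pow_pos hr0 j]
    have := mll h2 (mul_nonneg hI0 hL)
    have e : I * L * (1 / (1 - r)) = I / (1 - r) * L := by ring
    have : 0 ≤ I * L := by positivity
    nlinarith

lemma Ker.concl {d N far} (hK : Ker d N far) {A L f} (hf : Den A L f) {r : ℝ} (hr0 : 0 < r) (hr1 : r <1)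
    (m : ℕ) (h : ∀ l : List E3, l.length ≤ m → ∃ C, ∀ j x,
      |dd l (cv f (farM d far (j+1))) x - dd l (cv f (farM d far j)) x| ≤ C * r ^ j) :
    ContDiff ℝ m (cv f N) ∧ ∀ l : List E3, l.length ≤ m → ∀ x,
      Tendsto (fun j => dd l (cv f (farM d far j)) x) atTop (𝓝 (dd l (cv f N) x)) :=
  lim_cd hr0.le hr1 (fun j => cv_smooth hf.int (hK.sbM j)) h (hK.lim hf)

lemma two_pow_bd {d m q : ℕ} (h : d + m ≤ q) (j : ℕ) : (2:ℝ) ^ ((d + m) * j) /8 ^ j ≤ (2 ^ q /8) ^ j := by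
  rw [pow_mul, ← div_pow]
  gcongr; norm_num

structure Den1 (A L : ℝ) (f : E3 → ℝ) : Prop extends Den A L f where
  lip : ∀ x y, |f x - f y| ≤ L * ‖x - y‖

structure Den2 (A L a : ℝ) (f : E3 → ℝ) : Prop extends Den1 A L f where
  c1 : ContDiff ℝ 1 f
  hol : ∀ x y, ‖fderiv ℝ f x - fderiv ℝ f y‖ ≤ L * ‖x - y‖ ^ a

lemma Ker.r1 {d N far} (hK : Ker d N far) (A : ℝ) {r : ℝ} (hr0 : 1 /2 ≤ r) (hr1 : r <1) (l : List E3)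
    (hl : l.length ≤1) : ∃ C, 0 ≤ C ∧ ∀ f L, Den A L f →
      (∀ j x, |dd l (cv f (farM d far (j+1))) x - dd l (cv f (farM d far j)) x| ≤ C * L * r ^ j) ∧
      ∀ j x, |dd l (cv f (farM d far j)) x| ≤ C * L := by
  obtain ⟨C, hC, h⟩ := hK.main A r (by linarith) hr1 l
  refine ⟨C, hC, fun f L hf => h f L (fun _ => L) hf (fun j => ?_) fun j x =>
    ⟨fun _ => 0, continuous_const, by simp, fun w _ => by simpa using hf.bd _⟩⟩
  rw [mul_comm]
  refine mll ((two_pow_bd (q := 2) (by have := hK.d1; omega) j).trans ?_) hf.nn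
  norm_num at hr0 ⊢
  gcongr

lemma Ker.r2 {d N far} (hK : Ker d N far) (A : ℝ) {r : ℝ} (hr0 : 1 /2 ≤ r) (hr1 : r <1) (l : List E3)
    (hl : l.length ≤2) : ∃ C, 0 ≤ C ∧ ∀ f L, Den1 A L f →
      (∀ j x, |dd l (cv f (farM d far (j+1))) x - dd l (cv f (farM d far j)) x| ≤ C * L * r ^ j) ∧
      ∀ j x, |dd l (cv f (farM d far j)) x| ≤ C * L := by
  rcases Nat.lt_or_ge l.length 2 with h2 | h2
  · obtain ⟨C, hC, h⟩ := hK.r1 A hr0 hr1 l (by omega)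
    exact ⟨C, hC, fun f L hf => h f L hf.toDen⟩
  obtain ⟨C, hC, h⟩ := hK.main A r (by linarith) hr1 l
  refine ⟨C, hC, fun f L hf => h f L (fun j => L * (1 /2) ^ j) hf.toDen (fun j => ?_) fun j x =>
    ⟨fun _ => f x, continuous_const, hK.cs.mom0 l (by omega) _, fun w hw => ?_⟩⟩
  · have h1 := two_pow_bd (q := 3) (d := d) (m := l.length) (by have := hK.d1; omega) j
    norm_num at h1
    have := hf.nn
    calc _ ≤1 * (L * (1 /2) ^ j) := by gcongr
      _ ≤ _ := by rw [one_mul]; gcongr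
  · refine (hf.lip _ _).trans (mll ?_ hf.nn)
    rw [sub_sub_cancel_left, norm_neg, norm_smul]
    simp only [norm_inv, norm_pow, Real.norm_ofNat, one_div, inv_pow]
    exact mul_le_of_le_one_right (by positivity) hw

lemma half_pow {a : ℝ} (j : ℕ) : (((2:ℝ) ^ j)⁻¹) ^ a = ((1 /2 : ℝ) ^ a) ^ j := by
  rw [← inv_pow, ← one_div, Real.rpow_pow_comm (by norm_num)]

lemma taylor1 {A L a f} (ha : 0 < a) (hf : Den2 A L a f) (x w : E3) {t : ℝ} (ht : 0 ≤ t) (hw : ‖w‖ ≤1) :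
    |f (x - t • w) - (f x + (-t • fderiv ℝ f x) w)| ≤ L * t ^ a * t := by
  have hL := hf.nn
  have h := (convex_closedBall x t).norm_image_sub_le_of_norm_fderiv_le' (𝕜 := ℝ) (f := f)
    (φ := fderiv ℝ f x) (C := L * t ^ a)
    (fun z _ => hf.c1.differentiable (by simp) z) (fun z hz => ?_) (x := x) (y := x - t • w)
    (mem_closedBall_self ht) ?_
  · have e : f (x - t • w) - (f x + (-t • fderiv ℝ f x) w)
        = f (x - t • w) - f x - fderiv ℝ f x (x - t • w - x) := by simp; ring
    rw [e]
    refine h.trans ?_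
    gcongr
    rw [sub_sub_cancel_left, norm_neg, norm_smul, Real.norm_of_nonneg ht]
    exact mul_le_of_le_one_right ht hw
  · refine (hf.hol _ _).trans ?_
    gcongr
    simpa [dist_eq_norm] using hz
  · rw [mem_closedBall, dist_eq_norm, sub_sub_cancel_left, norm_neg, norm_smul, Real.norm_of_nonneg ht]
    exact mul_le_of_le_one_right ht hw

lemma Ker.osc3 {d N far} (hK : Ker d N far) {A L a f} (ha : 0 < a) (hf : Den2 A L a f) (l : List E3)
    (h2 : 2 ≤ l.length) (j : ℕ) (x : E3) :
    ∃ P : E3 → ℝ, Continuous P ∧ (∫ w, P w * dd l (zet d far) w =0) ∧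
        ∀ w, ‖w‖ ≤1 → |f (x - ((2:ℝ) ^ j)⁻¹ • w) - P w| ≤ L * ((1 /2 : ℝ) ^ a) ^ j * (1 /2) ^ j := by
  refine ⟨fun w => f x + (-((2:ℝ) ^ j)⁻¹ • fderiv ℝ f x) w, by fun_prop,
    hK.cs.mom1 l h2 _ _, fun w hw => ?_⟩
  have := taylor1 ha hf x w (t := ((2:ℝ) ^ j)⁻¹) (by positivity) hw
  rw [half_pow] at this
  simpa using this

lemma half_rpow_lt {a : ℝ} (ha : 0 < a) : (1 /2 : ℝ) ^ a <1 :=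
  Real.rpow_lt_one (by norm_num) (by norm_num) ha

lemma half_rpow_ge {a : ℝ} (ha : a ≤1) : 1 /2 ≤ (1 /2 : ℝ) ^ a := by
  simpa using Real.rpow_le_rpow_of_exponent_ge (x := 1 /2) (by norm_num) (by norm_num) ha

lemma Ker.r3 {d N far} (hK : Ker d N far) (A : ℝ) {a : ℝ} (ha0 : 0 < a) (ha1 : a ≤1) (l : List E3)
    (hl : l.length ≤3) : ∃ C, 0 ≤ C ∧ ∀ f L, Den2 A L a f →
      (∀ j x, |dd l (cv f (farM d far (j+1))) x - dd l (cv f (farM d far j)) x|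
        ≤ C * L * ((1 /2 : ℝ) ^ a) ^ j) ∧
      ∀ j x, |dd l (cv f (farM d far j)) x| ≤ C * L := by
  rcases Nat.lt_or_ge l.length 3 with h2 | h2
  · obtain ⟨C, hC, h⟩ := hK.r2 A (half_rpow_ge ha1) (half_rpow_lt ha0) l (by omega)
    exact ⟨C, hC, fun f L hf => h f L hf.toDen1⟩
  obtain ⟨C, hC, h⟩ := hK.main A _ (by positivity) (half_rpow_lt ha0) l
  refine ⟨C, hC, fun f L hf => h f L (fun j => L * ((1 /2 : ℝ) ^ a) ^ j * (1 /2) ^ j) hf.toDen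
    (fun j => ?_) (hK.osc3 ha0 hf l (by omega))⟩
  have h1 := two_pow_bd (q := 4) (d := d) (m := l.length) (by have := hK.d1; omega) j
  norm_num at h1
  have := hf.nn
  calc _ ≤2 ^ j * (L * ((1 /2 : ℝ) ^ a) ^ j * (1 /2) ^ j) := by gcongr
    _ = L * ((1 /2 : ℝ) ^ a) ^ j * (2 * (1 /2)) ^ j := by rw [mul_pow]; ring
    _ ≤ _ := by norm_num

lemma Ker.R1 {d N far} (hK : Ker d N far) {A L f} (hf : Den A L f) : ContDiff ℝ 1 (cv f N) ∧
    ∀ l : List E3, l.length ≤1 → ∀ x,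
      Tendsto (fun j => dd l (cv f (farM d far j)) x) atTop (𝓝 (dd l (cv f N) x)) := by
  exact_mod_cast hK.concl hf (r := 1 /2) (by norm_num) (by norm_num) 1 fun l hl => by
    obtain ⟨C, -, h⟩ := hK.r1 A (r := 1 /2) le_rfl (by norm_num) l hl
    exact ⟨_, (h f L hf).1⟩

lemma Ker.R2 {d N far} (hK : Ker d N far) {A L f} (hf : Den1 A L f) : ContDiff ℝ 2 (cv f N) ∧
    ∀ l : List E3, l.length ≤2 → ∀ x,
      Tendsto (fun j => dd l (cv f (farM d far j)) x) atTop (𝓝 (dd l (cv f N) x)) := by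
  exact_mod_cast hK.concl hf.toDen (r := 1 /2) (by norm_num) (by norm_num) 2 fun l hl => by
    obtain ⟨C, -, h⟩ := hK.r2 A (r := 1 /2) le_rfl (by norm_num) l hl
    exact ⟨_, (h f L hf).1⟩

lemma Ker.R3 {d N far} (hK : Ker d N far) {A L a f} (ha0 : 0 < a) (ha1 : a ≤1) (hf : Den2 A L a f) :
    ContDiff ℝ 3 (cv f N) ∧ ∀ l : List E3, l.length ≤3 → ∀ x,
      Tendsto (fun j => dd l (cv f (farM d far j)) x) atTop (𝓝 (dd l (cv f N) x)) := by
  exact_mod_cast hK.concl hf.toDen (by positivity) (half_rpow_lt ha0) 3 fun l hl => by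
    obtain ⟨C, -, h⟩ := hK.r3 A ha0 ha1 l hl
    exact ⟨_, (h f L hf).1⟩

lemma Ker.R1b {d N far} (hK : Ker d N far) (A : ℝ) (l : List E3) (hl : l.length ≤1) :
    ∃ C, 0 ≤ C ∧ ∀ f L, Den A L f → ∀ x, |dd l (cv f N) x| ≤ C * L := by
  obtain ⟨C, hC, h⟩ := hK.r1 A (r := 1 /2) le_rfl (by norm_num) l hl
  exact ⟨C, hC, fun f L hf x => le_of_tendsto ((hK.R1 hf).2 l hl x).abs
    (Eventually.of_forall fun j => (h f L hf).2 j x)⟩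

lemma Ker.R2b {d N far} (hK : Ker d N far) (A : ℝ) (l : List E3) (hl : l.length ≤2) :
    ∃ C, 0 ≤ C ∧ ∀ f L, Den1 A L f → ∀ x, |dd l (cv f N) x| ≤ C * L := by
  obtain ⟨C, hC, h⟩ := hK.r2 A (r := 1 /2) le_rfl (by norm_num) l hl
  exact ⟨C, hC, fun f L hf x => le_of_tendsto ((hK.R2 hf).2 l hl x).abs
    (Eventually.of_forall fun j => (h f L hf).2 j x)⟩

lemma lip_pd {g : E3 → ℝ} (hg : Differentiable ℝ g) {B : ℝ} (h : ∀ i x, |pd (ee i) g x| ≤ B) (x y : E3) :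
    |g x - g y| ≤3 * B * ‖x - y‖ :=
  convex_univ.norm_image_sub_le_of_norm_fderiv_le (𝕜 := ℝ) (fun z _ => hg z)
    (fun z _ => clm_bd _ fun i => h i z) (mem_univ _) (mem_univ _)

lemma dd_snoc (l : List E3) (v : E3) (f : E3 → ℝ) : pd v (dd l f) = dd (l ++ [v]) f := by
  rw [dd_append]; rfl

lemma Ker.hold {d N far} (hK : Ker d N far) {A L a f} (ha0 : 0 < a) (ha1 : a <1) (hf : Den2 A L a f)
    (l : List E3) (hl : l.length =3) :
    ∃ C, ∀ x y, |dd l (cv f N) x - dd l (cv f N) y| ≤ C * ‖x - y‖ ^ a := by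
  set r := (1 /2 : ℝ) ^ a with hr
  have hr0 : 0 < r := by positivity
  have hr1 : r <1 := half_rpow_lt ha0
  set b := 2 * r with hb
  have hb1 : 1 < b := by
    have : (1 /2 : ℝ) ^ (1:ℝ) < r := Real.rpow_lt_rpow_of_exponent_gt (by norm_num) (by norm_num) ha1
    norm_num at this; linarith
  obtain ⟨C1, hC1, h1⟩ := hK.r3 A ha0 ha1.le l hl.le
  replace h1 := h1 f L hf
  have hL := hf.nn
  have h4 : ∃ D, 0 ≤ D ∧ ∀ i J x, |pd (ee i) (dd l (cv f (farM d far J))) x| ≤ D * b ^ J := by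
    have : ∀ i, ∃ D, 0 ≤ D ∧ ∀ J x, |pd (ee i) (dd l (cv f (farM d far J))) x| ≤ D * b ^ J := by
      intro i
      simp only [dd_snoc]
      set l' := l ++ [ee i]
      have hl' : l'.length =4 := by simp [l', hl]
      set I := ∫ w, |dd l' (zet d far) w|
      have hI : 0 ≤ I := integral_nonneg fun _ => abs_nonneg _
      have hst : ∀ j x, |dd l' (cv f (farM d far (j+1))) x - dd l' (cv f (farM d far j)) x|
          ≤ I * L * b ^ j := by
        intro j x
        obtain ⟨P, hPc, hP0, hPE⟩ := hK.osc3 ha0 hf l' (by omega) j x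
        rw [hK.step hf.int, abs_mul, abs_of_nonneg (by positivity)]
        have := osc_bd (hK.cs.dd l') hf.meas hf.bd hPc hP0 hPE
        have h5 := two_pow_bd (q := 5) (d := d) (m := l'.length) (by have := hK.d1; omega) j
        norm_num at h5
        calc _ ≤4 ^ j * ((L * r ^ j * (1 /2) ^ j) * I) := by gcongr
          _ = I * L * (4 * (1 /2) * r) ^ j := by rw [mul_pow, mul_pow]; ring
          _ = _ := by norm_num [hb]
      obtain ⟨B, hB⟩ : ∃ B, ∀ x, |dd l' (cv f (farM d far 0)) x| ≤ B := by
        obtain ⟨B, hB⟩ := ((hK.sbM 0).dd l').2 []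
        refine ⟨(∫ y, |f y|) * B, fun x => ?_⟩
        rw [cv_dd hf.int (hK.sbM 0), ← integral_mul_const]
        refine abs_integral_le_integral_abs.trans (integral_mono (cv_int hf.int ((hK.sbM 0).dd l') x).norm
              (hf.int.norm.mul_const B) fun y => ?_)
        simp only [abs_mul]; exact mll (hB _) (abs_nonneg _)
      have hB0 := (abs_nonneg _).trans (hB 0)
      have hb1' : 0 < b - 1 := by linarith
      refine ⟨B + I * L / (b - 1), by positivity, fun J x => ?_⟩
      induction J with
      | zero => simpa using (hB x).trans (le_add_of_nonneg_right (by positivity))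
      | succ J ih =>
        have := (abs_sub_abs_le_abs_sub _ _).trans (hst J x)
        have e : (B + I * L / (b - 1)) * b ^ (J+1)
          = (B + I * L / (b - 1)) * b ^ J + (B * (b - 1)) * b ^ J + I * L * b ^ J := by
          field_simp; ring
        have : 0 ≤ (B * (b - 1)) * b ^ J := by positivity
        linarith
    choose D hD h using this
    refine ⟨∑ i, D i, Finset.sum_nonneg fun i _ => hD i, fun i J x => (h i J x).trans ?_⟩
    gcongr
    exact Finset.single_le_sum (f := D) (fun i _ => hD i) (Finset.mem_univ i)
  obtain ⟨D, hD, h4⟩ := h4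
  have h1r : 0 <1 - r := by linarith
  have htail : ∀ J x, |dd l (cv f (farM d far J)) x - dd l (cv f N) x| ≤ C1 * L * r ^ J / (1 - r) := by
    intro J x
    have := dist_le_of_le_geometric_of_tendsto r (C1 * L) hr1 (fun j => ?_)
      ((hK.R3 ha0 ha1.le hf).2 l hl.le x) J
    · rwa [Real.dist_eq] at this
    · rw [dist_comm, Real.dist_eq]; exact h1.1 j x
  have hbd : ∀ x, |dd l (cv f N) x| ≤ C1 * L := fun x =>
    le_of_tendsto ((hK.R3 ha0 ha1.le hf).2 l hl.le x).abs (Eventually.of_forall fun j => h1.2 j x)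
  refine ⟨2 * (C1 * L) +3 * D +4 * (C1 * L / (1 - r)), fun x y => ?_⟩
  have hQ : 0 ≤ C1 * L / (1 - r) := by positivity
  have hC1L : 0 ≤ C1 * L := by positivity
  set t := ‖x - y‖ with ht
  have ht0 : 0 ≤ t := norm_nonneg _
  rcases ht0.eq_or_lt with h0 | h0
  · have : x = y := by rw [← sub_eq_zero, ← norm_eq_zero, ← ht, ← h0]
    rw [this]; simp; positivity
  rcases lt_or_ge 1 t with h1' | h1'
  · have : 1 ≤ t ^ a := Real.one_le_rpow h1'.le ha0.le
    have h3 := abs_sub (dd l (cv f N) x) (dd l (cv f N) y)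
    have := hbd x; have := hbd y
    nlinarith
  · obtain ⟨J, hJ1, hJ2⟩ := exists_nat_pow_near_of_lt_one h0 h1' (by norm_num : (0:ℝ) <1 /2) (by norm_num)
    have e1 : r ^ J ≤2 * t ^ a := by
      have h6 : (1 /2 : ℝ) ^ J ≤2 * t := by rw [pow_succ] at hJ1; linarith
      rw [hr, Real.rpow_pow_comm (by norm_num)]
      refine (Real.rpow_le_rpow (by positivity) h6 ha0.le).trans ?_
      rw [Real.mul_rpow (by norm_num) ht0]
      gcongr
      simpa using Real.rpow_le_rpow_of_exponent_le (x := 2) (by norm_num) ha1.le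
    have e2 : t * b ^ J ≤ t ^ a := by
      have h7 : t ^ (1 - a) ≤ ((1 /2 : ℝ) ^ (1 - a)) ^ J := by
        rw [Real.rpow_pow_comm (by norm_num)]
        exact Real.rpow_le_rpow ht0 hJ2 (by linarith)
      have h8 : b * (1 /2 : ℝ) ^ (1 - a) =1 := by
        rw [hb, hr, mul_assoc, ← Real.rpow_add (by norm_num)]; norm_num
      have h9 : t = t ^ a * t ^ (1 - a) := by rw [← Real.rpow_add h0]; simp
      calc t * b ^ J = t ^ a * (t ^ (1 - a) * b ^ J) := by rw [← mul_assoc, ← h9]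
        _ ≤ t ^ a * (((1 /2 : ℝ) ^ (1 - a)) ^ J * b ^ J) := by gcongr
        _ = t ^ a := by rw [← mul_pow, mul_comm _ b, h8]; simp
    have e3 := lip_pd ((cdi_dd (cv_smooth hf.int (hK.sbM J)) l).differentiable (by simp))
      (fun i z => h4 i J z) x y
    have e4 := htail J x
    have e5 := htail J y
    have e6 : C1 * L * r ^ J / (1 - r) ≤2 * (C1 * L / (1 - r)) * t ^ a := by
      calc C1 * L * r ^ J / (1 - r) = C1 * L / (1 - r) * r ^ J := by ring
        _ ≤ C1 * L / (1 - r) * (2 * t ^ a) := by gcongr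
        _ = _ := by ring
    have e7 : 3 * (D * b ^ J) * t ≤3 * D * t ^ a := by
      calc _ =3 * D * (t * b ^ J) := by ring
        _ ≤ _ := by gcongr
    have : 0 ≤ C1 * L * t ^ a := by positivity
    rw [abs_le] at *
    constructor <;> nlinarith

lemma pd_congr {f g : E3 → ℝ} {x : E3} (h : f =ᶠ[𝓝 x] g) (v : E3) : pd v f =ᶠ[𝓝 x] pd v g :=
  (h.fderiv (𝕜 := ℝ)).mono fun y hy => by simp [pd, hy]

lemma dd_congr {f g : E3 → ℝ} {x : E3} (h : f =ᶠ[𝓝 x] g) (l : List E3) : dd l f =ᶠ[𝓝 x] dd l g := by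
  induction l generalizing f g with
  | nil => exact h
  | cons v l ih => exact ih (pd_congr h v)

def chi : ContDiffBump (0 : E3) := ⟨1 /2, 1, by norm_num, by norm_num⟩

def cutf (N : E3 → ℝ) (x : E3) : ℝ := (1 - chi x) * N x

lemma cutf_ker {d : ℕ} {N : E3 → ℝ} (hs : ∀ x, x ≠0 → ContDiffAt ℝ ∞ N x)
    (hom : ∀ t : ℝ, 0 < t → ∀ x, N (t • x) * t ^ d = N x)
    (bd : ∀ x, |N x| ≤1 +1 / ‖x‖) (meas : Measurable N) (d1 : d ≤1) : Ker d N (cutf N) := by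
  have eq : ∀ x, 1 ≤ ‖x‖ → cutf N x = N x := fun x hx => by
    simp [cutf, chi.zero_of_le_dist (x := x) (by simpa [chi] using hx)]
  have hsm : ContDiff ℝ ∞ (cutf N) := by
    rw [contDiff_iff_contDiffAt]
    intro x
    by_cases hx : x =0
    · subst hx
      refine (contDiffAt_const (c := (0:ℝ))).congr_of_eventuallyEq ?_
      filter_upwards [chi.eventuallyEq_one] with y hy
      simp [cutf, hy]
    · exact (contDiffAt_const.sub chi.contDiff.contDiffAt).mul (hs x hx)
  refine ⟨⟨hsm, fun l => ?_⟩, eq, hom, fun x => ?_, bd, meas, d1⟩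
  · obtain ⟨C, hC⟩ := (isCompact_closedBall (0:E3) 2).exists_bound_of_continuousOn
      (cdi_dd hsm l).continuous.continuousOn
    refine ⟨C, fun x => ?_⟩
    by_cases hx : ‖x‖ ≤2
    · exact hC x (by simpa using hx)
    push Not at hx
    set s := ‖x‖ /2 with hs'
    have hs1 : 1 ≤ s := by rw [hs']; linarith
    set z := s⁻¹ • x with hz
    have hzx : s • z = x := by rw [hz, smul_smul, mul_inv_cancel₀ (by linarith), one_smul]
    have hzn : ‖z‖ =2 := by
      rw [hz, norm_smul, norm_inv, Real.norm_of_nonneg (by linarith), hs']; field_simp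
    have hev : cutf N =ᶠ[𝓝 z] fun y => s ^ d * cutf N (s • y) := by
      filter_upwards [(isOpen_lt continuous_const continuous_norm).mem_nhds
        (show (1:ℝ) < ‖z‖ by rw [hzn]; norm_num)] with y hy
      have hy' : 1 ≤ ‖s • y‖ := by
        rw [norm_smul, Real.norm_of_nonneg (by linarith)]
        have : (1:ℝ) < ‖y‖ := hy
        nlinarith
      rw [eq y (le_of_lt hy), eq _ hy', ← hom s (by linarith) y, mul_comm]
    have h1 := (dd_congr hev l).eq_of_nhds
    rw [dd_scale hsm] at h1
    simp only [hzx] at h1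
    have h2 : |dd l (cutf N) z| ≤ C := hC z (by simp [hzn])
    rw [h1, abs_mul] at h2
    refine le_trans ?_ h2
    refine le_mul_of_one_le_left (abs_nonneg _) ?_
    rw [abs_of_nonneg (by positivity)]
    exact one_le_mul_of_one_le_of_one_le (one_le_pow₀ hs1) (one_le_pow₀ hs1)
  · rw [cutf, abs_mul, abs_of_nonneg (by linarith [chi.le_one (x := x)])]
    exact mul_le_of_le_one_left (abs_nonneg _) (by linarith [chi.nonneg (x := x)])

def N0 (x : E3) : ℝ := 1 / ‖x‖
def N1 (i : Fin 3) (x : E3) : ℝ := x i / ‖x‖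

lemma kN0 : Ker 1 N0 (cutf N0) := by
  refine cutf_ker (fun x hx => ?_) (fun t ht x => ?_) (fun x => ?_) (by unfold N0; fun_prop) le_rfl
  · exact contDiffAt_const.div (contDiffAt_norm ℝ hx) (norm_ne_zero_iff.2 hx)
  · simp only [N0, norm_smul, Real.norm_of_nonneg ht.le]
    field_simp
  · rw [N0, abs_of_nonneg (by positivity)]; linarith

lemma kN1 (i : Fin 3) : Ker 0 (N1 i) (cutf (N1 i)) := by
  refine cutf_ker (fun x hx => ?_) (fun t ht x => ?_) (fun x => ?_) (by unfold N1; fun_prop) (by simp)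
  · exact ContDiffAt.div (by fun_prop) (contDiffAt_norm ℝ hx) (norm_ne_zero_iff.2 hx)
  · simp only [N1, norm_smul, Real.norm_of_nonneg ht.le, PiLp.smul_apply, smul_eq_mul]
    field_simp
  · rw [N1, abs_div, abs_norm]
    have := div_le_one_of_le₀ (coord_le x i) (norm_nonneg x)
    have : 0 ≤1 / ‖x‖ := by positivity
    linarith

lemma cv_N0 (f : E3 → ℝ) : cv f N0 = pot f := by
  funext x; simp [cv, pot, N0, div_eq_mul_inv]

def lap (f : E3 → ℝ) (x : E3) : ℝ := ∑ i, dd [ee i, ee i] f x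

lemma hnorm {x : E3} (hx : x ≠0) : HasFDerivAt (fun y : E3 => ‖y‖) (‖x‖⁻¹ • innerSL ℝ x) x := by
  have h := ((hasStrictFDerivAt_norm_sq x).hasFDerivAt).sqrt (by positivity)
  simp only [Real.sqrt_sq (norm_nonneg _)] at h
  refine h.congr_fderiv ?_
  ext v
  have : ‖x‖ ≠0 := norm_ne_zero_iff.2 hx
  simp [two_smul]
  field_simp
  ring

lemma inner_ee (x : E3) (i : Fin 3) : inner ℝ x (ee i) = x i := by
  rw [ee, EuclideanSpace.inner_single_right]; simp

lemma pd_ee_coord (i j : Fin 3) (x : E3) : fderiv ℝ (fun y : E3 => y i) x (ee j) = if i = j then 1 else 0 := by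
  have : (fun y : E3 => y i) = (EuclideanSpace.proj i : E3 →L[ℝ] ℝ) := by ext; simp
  rw [this, ContinuousLinearMap.fderiv]
  by_cases h : i = j
  · simp [ee, h]
  · simp [ee, h]

lemma pd_N0 {x : E3} (hx : x ≠0) (i : Fin 3) : pd (ee i) N0 x = - x i * (‖x‖⁻¹) ^3 := by
  have hn : ‖x‖ ≠0 := norm_ne_zero_iff.2 hx
  have h : HasFDerivAt (fun y : E3 => ‖y‖⁻¹) _ x := (hasDerivAt_inv hn).comp_hasFDerivAt x (hnorm hx)
  have e : N0 = fun y : E3 => ‖y‖⁻¹ := by funext y; simp [N0]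
  simp only [pd, e, h.fderiv]
  simp [inner_ee]
  field_simp

lemma lap_N0 {x : E3} (hx : x ≠0) : lap N0 x =0 := by
  have hn : ‖x‖ ≠0 := norm_ne_zero_iff.2 hx
  have h1 : ∀ i, dd [ee i, ee i] N0 x = - (‖x‖⁻¹) ^3 +3 * (x i) ^2 * (‖x‖⁻¹) ^5 := by
    intro i
    have hev : pd (ee i) N0 =ᶠ[𝓝 x] fun y => - y i * (‖y‖⁻¹) ^3 := by
      filter_upwards [isOpen_ne.mem_nhds hx] with y hy using pd_N0 hy i
    have h2 := (hasDerivAt_inv hn).comp_hasFDerivAt x (hnorm hx)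
    have h3 : HasFDerivAt (fun y : E3 => - y i) _ x := (EuclideanSpace.proj i : E3 →L[ℝ] ℝ).hasFDerivAt.neg
    have h4 : HasFDerivAt (fun y : E3 => - y i * (‖y‖⁻¹) ^3) _ x := h3.mul (h2.pow 3)
    simp only [dd]
    rw [pd, hev.fderiv_eq, h4.fderiv]
    simp [inner_ee]
    simp [ee]
    field_simp
    ring
  have h5 : ‖x‖ ^2 = (x 0) ^2 + (x 1) ^2 + (x 2) ^2 := by
    simp [EuclideanSpace.norm_sq_eq, Fin.sum_univ_three]
  simp only [lap, h1, Fin.sum_univ_three]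
  field_simp
  linear_combination (-3 : ℝ) * h5

lemma lap_far {x : E3} (hx : 1 < ‖x‖) : lap (cutf N0) x =0 := by
  have hx0 : x ≠0 := by rintro rfl; simp at hx; linarith
  rw [← lap_N0 hx0]
  refine Finset.sum_congr rfl fun i _ => Filter.EventuallyEq.eq_of_nhds (dd_congr ?_ _)
  filter_upwards [(isOpen_lt continuous_const continuous_norm).mem_nhds hx] with y hy
    using kN0.eq y (le_of_lt hy)

def c0 : ℝ := ∫ w, lap (cutf N0) w

lemma lap_smooth {f : E3 → ℝ} (h : ContDiff ℝ ∞ f) : ContDiff ℝ ∞ (lap f) :=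
  ContDiff.sum fun i _ => cdi_dd h _

lemma lapf_cs : CS (lap (cutf N0)) := ⟨lap_smooth kN0.sb.1, fun x hx => lap_far hx⟩

lemma poisson {A L f} (hf : Den1 A L f) (x : E3) : lap (pot f) x = c0 * f x := by
  rw [← cv_N0]
  have h1 : Tendsto (fun j => lap (cv f (farM 1 (cutf N0) j)) x) atTop (𝓝 (lap (cv f N0) x)) :=
    tendsto_finsetSum _ fun i _ => (kN0.R2 hf).2 _ (by simp) x
  have hfc : Continuous f := by
    rw [Metric.continuous_iff]
    intro y η hη
    refine ⟨η / (L +1), by have := hf.nn; positivity, fun z hz => ?_⟩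
    rw [dist_eq_norm, lt_div_iff₀ (by linarith [hf.nn])] at hz
    rw [Real.dist_eq]
    nlinarith [hf.lip z y, norm_nonneg (z - y)]
  have h2 : ∀ j, lap (cv f (farM 1 (cutf N0) j)) x
      = ∫ w, f (x - ((2:ℝ) ^ j)⁻¹ • w) * lap (cutf N0) w := by
    intro j
    simp only [lap, cv_dd hf.int (kN0.sbM j)]
    have e : ∀ i, cv f (dd [ee i, ee i] (farM 1 (cutf N0) j)) x
        = ∫ w, f (x - ((2:ℝ) ^ j)⁻¹ • w) * dd [ee i, ee i] (cutf N0) w := by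
      intro i
      have : dd [ee i, ee i] (farM 1 (cutf N0) j) =
          fun z => ((2:ℝ) ^ j) ^3 * dd [ee i, ee i] (cutf N0) ((2:ℝ) ^ j • z) := by
        unfold farM; rw [dd_scale kN0.sb.1]; funext z; simp; left; ring
      have h3 := cv_scale (f := f) (η := dd [ee i, ee i] (cutf N0)) (by positivity : (0:ℝ) <2 ^ j) x
      rw [this]
      have e2 : cv f (fun z => ((2:ℝ) ^ j) ^3 * dd [ee i, ee i] (cutf N0) ((2:ℝ) ^ j • z)) x
        = ((2:ℝ) ^ j) ^3 * cv f (fun z => dd [ee i, ee i] (cutf N0) ((2:ℝ) ^ j • z)) x := by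
        simp only [cv, ← integral_const_mul]; congr 1; ext; ring
      rw [e2, h3]; field_simp
    simp only [e, Finset.mul_sum]
    rw [integral_finsetSum]
    intro i _
    obtain ⟨C, hC⟩ := kN0.sb.2 [ee i, ee i]
    refine Integrable.mul_bdd (c := C) ?_ ((cdi_dd kN0.sb.1 _).continuous).aestronglyMeasurable
      (Eventually.of_forall hC)
    have := (hf.int.comp_sub_left x).comp_smul (inv_ne_zero (by positivity : (2:ℝ) ^ j ≠0))
    exact this
  simp only [h2] at h1
  refine tendsto_nhds_unique h1 ?_
  have e : c0 * f x = ∫ w, f x * lap (cutf N0) w := by rw [c0, integral_const_mul, mul_comm]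
  rw [e]
  have hli : Integrable (lap (cutf N0)) := by
    simpa using lapf_cs.intg (P := fun _ => 1) continuous_const
  refine tendsto_integral_of_dominated_convergence (fun w => L * |lap (cutf N0) w|) (fun j => ?_)
    (hli.norm.const_mul L) (fun j => Eventually.of_forall fun w => ?_) (Eventually.of_forall fun w => ?_)
  · exact ((hfc.comp (by fun_prop)).mul lapf_cs.1.continuous).aestronglyMeasurable
  · rw [norm_mul]; exact mlr (hf.bd _) (norm_nonneg _)
  · refine Tendsto.mul_const _ ((hfc.tendsto x).comp ?_)
    have : Tendsto (fun j : ℕ => ((2:ℝ) ^ j)⁻¹) atTop (𝓝 0) := by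
      simpa using tendsto_pow_atTop_nhds_zero_of_lt_one (r := (2:ℝ)⁻¹) (by norm_num) (by norm_num)
    simpa using (this.smul_const w).const_sub x

lemma pd_comm {K : E3 → ℝ} (hK : ContDiff ℝ ∞ K) (a b : E3) : pd a (pd b K) = pd b (pd a K) := by
  funext x
  have h := (hK.contDiffAt (x := x)).isSymmSndFDerivAt
    (by simp; exact WithTop.coe_le_coe.2 (le_top : (2:ℕ∞) ≤ ⊤))
  have e : ∀ u v : E3, pd u (pd v K) x = fderiv ℝ (fderiv ℝ K) x u v := fun u v => by
    have h1 : HasFDerivAt (pd v K) _ x :=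
      (((hK.fderiv_right (m := 1) (by norm_cast)).differentiable (by simp) x).hasFDerivAt).clm_apply
        (hasFDerivAt_const v x)
    simp only [pd] at h1 ⊢
    rw [h1.fderiv]; simp
  rw [e, e]; exact h a b

lemma dq {om F : E3 → ℝ} {C : NNReal} (hom : LipschitzWith C om) (hF : CS F) (u : E3) {l : ℝ}
    (hl : ∀ w (t : ℝ), |om (w + t • u) - om w| ≤ l * |t|) :
    |∫ w, om w * pd u F w| ≤ l * ∫ w, |F w| := by
  have hl0 : 0 ≤ l := by simpa using (abs_nonneg _).trans (hl 0 1)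
  obtain ⟨D, hD⟩ := ContDiff.lipschitzWith_of_hasCompactSupport hF.cs hF.1 (by simp)
  have h := LipschitzWith.integral_lineDeriv_mul_eq (μ := volume) hom hD hF.cs u
  have h2 : ∫ w, om w * pd u F w = - ∫ x, lineDeriv ℝ om x u * F x := by
    rw [h, ← integral_neg]; congr 1; ext x
    rw [(hF.1.differentiable (by simp) x).lineDeriv_eq_fderiv]; simp [pd, mul_comm]
  have hb : ∀ x, |lineDeriv ℝ om x u| ≤ l := fun x => by
    have := norm_deriv_le_of_lip' (f := fun t : ℝ => om (x + t • u)) (x₀ := 0) hl0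
      (Eventually.of_forall fun t => by simpa using hl x t)
    simpa [lineDeriv] using this
  rw [h2, abs_neg, ← integral_const_mul]
  have hi : Integrable F := by simpa using hF.intg (P := fun _ => 1) continuous_const
  rw [← Real.norm_eq_abs]
  refine norm_integral_le_of_norm_le (hi.norm.const_mul l) (Eventually.of_forall fun x => ?_)
  rw [norm_mul]; exact mlr (hb x) (norm_nonneg _)

lemma pd_lin_dir (F : E3 → ℝ) (n u : E3) (s : ℝ) (x : E3) : pd (u - s • n) F x = pd u F x - s * pd n F x := by
  simp [pd]

lemma ridge_dir {om F : E3 → ℝ} {C : NNReal} (hom : LipschitzWith C om) (hF : CS F) {n : E3} (hn : ‖n‖ =1)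
    (hr : ∀ w u, inner ℝ n u =0 → om (w + u) = om w) (u : E3) :
    ∫ w, om w * pd u F w = inner ℝ n u * ∫ w, om w * pd n F w := by
  have h0 := dq hom hF (u - (inner ℝ n u : ℝ) • n) (l := 0) fun w t => by
    rw [hr, sub_self]; · simp
    rw [inner_smul_right, inner_sub_right, inner_smul_right, real_inner_self_eq_norm_sq, hn]; ring
  simp only [pd_lin_dir, mul_sub] at h0
  rw [integral_sub ((hF.pd u).intg hom.continuous) (by
    simpa [mul_left_comm] using ((hF.pd n).intg hom.continuous).const_mul (inner ℝ n u))] at h0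
  have e : ∫ w, om w * (inner ℝ n u * pd n F w) = inner ℝ n u * ∫ w, om w * pd n F w := by
    rw [← integral_const_mul]; congr 1; ext; ring
  rw [e, zero_mul] at h0
  linarith [abs_nonpos_iff.1 h0]

lemma ridge3 {om K : E3 → ℝ} {C : NNReal} (hom : LipschitzWith C om) (hK : CS K) {n : E3} (hn : ‖n‖ =1)
    (hr : ∀ w u, inner ℝ n u =0 → om (w + u) = om w) (a b c : E3) :
    ∫ w, om w * dd [a, b, c] K w =
      inner ℝ n a * inner ℝ n b * inner ℝ n c * ∫ w, om w * dd [n, n, n] K w := by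
  simp only [dd]
  rw [ridge_dir hom ((hK.pd a).pd b) hn hr, pd_comm (cdi_pd hK.1 a), ridge_dir hom ((hK.pd a).pd n) hn hr,
    pd_comm hK.1 n a, pd_comm (cdi_pd hK.1 n) n a,
    ridge_dir hom ((hK.pd n).pd n) hn hr]
  ring

def Good (C : ℝ) (M : E3 → ℝ) : Prop := Continuous M ∧ ∀ K, CS K → ∀ i j k m,
  |∫ w, M w * dd [ee i, ee j, ee k, ee m] K w| ≤ C * ((∫ w, |lap K w|) + ∑ i, ∫ w, |pd (ee i) K w|)

lemma lap_cs {K} (hK : CS K) : CS (lap K) :=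
  ⟨lap_smooth hK.1, fun x hx => by simp [lap, (hK.dd _).2 x hx]⟩

lemma inner_abs {n : E3} (hn : ‖n‖ =1) (i : Fin 3) : |(inner ℝ n (ee i) : ℝ)| ≤1 := by
  simpa [hn, norm_ee] using abs_real_inner_le_norm n (ee i)

lemma Good.wave {φ : ℝ → ℝ} (hφ : ContDiff ℝ 1 φ) {l : ℝ} (hl : ∀ s t, |deriv φ s - deriv φ t| ≤ l * |s - t|)
    (c : ℝ) (v : E3) : Good (l * ‖v‖ ^2) (fun w => φ (c + inner ℝ v w)) := by
  have hl0 : 0 ≤ l := by simpa using (abs_nonneg _).trans (hl 1 0)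
  refine ⟨by fun_prop, fun K hK i j k m => ?_⟩
  obtain ⟨n, hn, hv⟩ : ∃ n : E3, ‖n‖ =1 ∧ v = ‖v‖ • n := by
    by_cases h : v =0
    · exact ⟨ee 0, norm_ee 0, by simp [h]⟩
    · have : ‖v‖ ≠0 := by simpa using h
      exact ⟨‖v‖⁻¹ • v, by simp [norm_smul, this], by rw [smul_smul, mul_inv_cancel₀ this, one_smul]⟩
  set s := ‖v‖ with hs
  have hs0 : 0 ≤ s := norm_nonneg _
  set om : E3 → ℝ := fun w => deriv φ (c + inner ℝ v w) with hom
  have hin : ∀ w u : E3, |om (w + u) - om w| ≤ l * s * |(inner ℝ n u : ℝ)| := fun w u => by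
    refine (hl _ _).trans (le_of_eq ?_)
    rw [inner_add_right, show c + (inner ℝ v w + inner ℝ v u) - (c + inner ℝ v w) = (inner ℝ v u : ℝ) by ring,
      hv, real_inner_smul_left, abs_mul, abs_of_nonneg hs0]; ring
  have hL : LipschitzWith (Real.toNNReal (l * s)) om := LipschitzWith.of_dist_le_mul fun x y => by
    rw [Real.coe_toNNReal _ (by positivity), Real.dist_eq, dist_eq_norm]
    have := hin y (x - y)
    rw [add_sub_cancel] at this
    refine this.trans (mll ?_ (by positivity))
    simpa [hn] using abs_real_inner_le_norm n (x - y)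
  have hr : ∀ w u, inner ℝ n u =0 → om (w + u) = om w := fun w u h => by
    have := hin w u
    rw [h, abs_zero, mul_zero] at this
    linarith [abs_nonpos_iff.1 this]
  have hM : ContDiff ℝ 1 (fun w : E3 => φ (c + inner ℝ v w)) :=
    hφ.comp (contDiff_const.add (innerSL ℝ v).contDiff)
  have hpd : ∀ w, pd (ee m) (fun w : E3 => φ (c + inner ℝ v w)) w = om w * inner ℝ v (ee m) := fun w => by
    have h1 : HasDerivAt φ (deriv φ (c + inner ℝ v w)) (c + inner ℝ v w) :=
      (hφ.differentiable (by simp) _).hasDerivAt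
    have h2 : HasFDerivAt (fun w : E3 => c + inner ℝ v w) (innerSL ℝ v) w := by
      simpa using ((innerSL ℝ v).hasFDerivAt (x := w)).const_add c
    have := h1.comp_hasFDerivAt w h2
    exact (congrArg (fun A : E3 →L[ℝ] ℝ => A (ee m)) this.fderiv).trans (by simp [hom])
  have e1 : ∫ w, φ (c + inner ℝ v w) * dd [ee i, ee j, ee k, ee m] K w
      = -(inner ℝ v (ee m) * ∫ w, om w * dd [ee i, ee j, ee k] K w) := by
    have := (hK.dd [ee i, ee j, ee k]).ibp hM (ee m)
    simp only [hpd] at this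
    rw [← integral_const_mul]
    refine this.trans ?_
    congr 2; ext; ring
  have e2 : ∫ w, om w * pd n (lap K) w = ∫ w, om w * dd [n, n, n] K w := by
    have : ∀ w, pd n (lap K) w = ∑ i, dd [ee i, ee i, n] K w := fun w => by
      have h : HasFDerivAt (lap K) (∑ i, fderiv ℝ (dd [ee i, ee i] K) w) w :=
        HasFDerivAt.fun_sum fun i _ => ((cdi_dd hK.1 _).differentiable (by simp) w).hasFDerivAt
      rw [pd, h.fderiv]; simp [dd, pd]
    simp only [this, Finset.mul_sum]
    rw [integral_finsetSum _ fun i _ => (hK.dd _).intg hL.continuous]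
    rw [Finset.sum_congr rfl fun i _ => ridge3 hL hK hn hr (ee i) (ee i) n, real_inner_self_eq_norm_sq, hn]
    rw [← Finset.sum_mul]
    have h3 : ∑ i, inner ℝ n (ee i) * inner ℝ n (ee i) * (1:ℝ) ^2 =1 := by
      have : ‖n‖ ^2 =1 := by rw [hn]; norm_num
      rw [EuclideanSpace.norm_sq_eq] at this
      simpa [ee, EuclideanSpace.inner_single_right, sq] using this
    rw [h3, one_mul]
  have e3 : |∫ w, om w * pd n (lap K) w| ≤ l * s * ∫ w, |lap K w| := by
    refine dq hL (lap_cs hK) n fun w t => (hin w _).trans (le_of_eq ?_)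
    rw [inner_smul_right, real_inner_self_eq_norm_sq, hn]; simp
  have hI : 0 ≤ ∫ w, |lap K w| := integral_nonneg fun _ => abs_nonneg _
  have hS : 0 ≤ ∑ i, ∫ w, |pd (ee i) K w| :=
    Finset.sum_nonneg fun _ _ => integral_nonneg fun _ => abs_nonneg _
  rw [e1, ridge3 hL hK hn hr, ← e2, abs_neg, abs_mul, abs_mul, abs_mul, abs_mul]
  have h4 : |(inner ℝ v (ee m) : ℝ)| ≤ s := by simpa [norm_ee] using abs_real_inner_le_norm v (ee m)
  have h5 := inner_abs hn
  calc _ ≤ s * (1 *1 *1 * (l * s * ∫ w, |lap K w|)) := by gcongr <;> apply h5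
    _ = l * s ^2 * ∫ w, |lap K w| := by ring
    _ ≤ _ := mll (by linarith) (by positivity)

lemma Good.c3 {M : E3 → ℝ} (hM : ContDiff ℝ 3 M) {B : ℝ} (hB : ∀ i j k x, |dd [ee i, ee j, ee k] M x| ≤ B) :
    Good B M := by
  refine ⟨hM.continuous, fun K hK i j k m => ?_⟩
  have hB0 : 0 ≤ B := (abs_nonneg _).trans (hB 0 0 0 0)
  have h2 : ContDiff ℝ 2 (pd (ee m) M) := cd_pd (n := 2) (by exact_mod_cast hM) _
  have h1 : ContDiff ℝ 1 (pd (ee k) (pd (ee m) M)) := cd_pd (n := 1) (by exact_mod_cast h2) _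
  have e : ∫ w, M w * dd [ee i, ee j, ee k, ee m] K w =
      -∫ w, dd [ee m, ee k, ee j] M w * pd (ee i) K w := by
    have a1 := (hK.dd [ee i, ee j, ee k]).ibp (hM.of_le (by norm_num)) (ee m)
    have a2 := (hK.dd [ee i, ee j]).ibp (h2.of_le (by norm_num)) (ee k)
    have a3 := (hK.pd (ee i)).ibp h1 (ee j)
    simp only [dd] at a1 a2 a3 ⊢
    rw [a1, a2, a3]; ring
  rw [e, abs_neg]
  have hi : ∀ i, Integrable (pd (ee i) K) := fun i => by
    simpa using (hK.pd (ee i)).intg (P := fun _ => 1) continuous_const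
  have hn : ∀ i, 0 ≤ ∫ w, |pd (ee i) K w| := fun i => integral_nonneg fun _ => abs_nonneg _
  have hI : 0 ≤ ∫ w, |lap K w| := integral_nonneg fun _ => abs_nonneg _
  calc _ ≤ ∫ w, B * |pd (ee i) K w| := by
        rw [← Real.norm_eq_abs]
        refine norm_integral_le_of_norm_le ((hi i).norm.const_mul B) (Eventually.of_forall fun x => ?_)
        rw [norm_mul]; exact mlr (hB _ _ _ _) (norm_nonneg _)
    _ = B * ∫ w, |pd (ee i) K w| := integral_const_mul _ _
    _ ≤ _ := by
        refine mll ?_ hB0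
        have := Finset.single_le_sum (f := fun i => ∫ w, |pd (ee i) K w|) (fun i _ => hn i) (Finset.mem_univ i)
        linarith

lemma Good.lin {M M' : E3 → ℝ} {C C' : ℝ} (h : Good C M) (h' : Good C' M') (a b : ℝ) :
    Good (|a| * C + |b| * C') (fun w => a * M w + b * M' w) := by
  refine ⟨by have := h.1; have := h'.1; fun_prop, fun K hK i j k m => ?_⟩
  have e : ∫ w, (a * M w + b * M' w) * dd [ee i, ee j, ee k, ee m] K w
    = a * (∫ w, M w * dd [ee i, ee j, ee k, ee m] K w) + b * ∫ w, M' w * dd [ee i, ee j, ee k, ee m] K w := by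
    rw [← integral_const_mul, ← integral_const_mul, ← integral_add
      (((hK.dd _).intg h.1).const_mul a) (((hK.dd _).intg h'.1).const_mul b)]
    congr 1; ext; ring
  rw [e]
  refine (abs_add_le _ _).trans ?_
  rw [abs_mul, abs_mul, add_mul, mul_assoc, mul_assoc]
  gcongr
  · exact h.2 K hK i j k m
  · exact h'.2 K hK i j k m

lemma Good.mono {M : E3 → ℝ} {C C' : ℝ} (h : Good C M) (hC : C ≤ C') : Good C' M :=
  ⟨h.1, fun K hK i j k m => (h.2 K hK i j k m).trans (mlr hC
    (add_nonneg (integral_nonneg fun _ => abs_nonneg _)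
      (Finset.sum_nonneg fun _ _ => integral_nonneg fun _ => abs_nonneg _)))⟩

def TW (f : E3 → ℝ) : Prop := ∃ C, 0 ≤ C ∧ ∀ x, |f x| ≤ C ∧ ∃ p : E3 →L[ℝ] ℝ, (∀ w, |p w| ≤ C * ‖w‖) ∧
  (∀ w, ‖w‖ ≤1 → |f (x - w) - (f x + p w)| ≤ C * ‖w‖ ^2) ∧
  ∃ M, Good C M ∧ ∀ w, ‖w‖ ≤1 → |f (x - w) - M w| ≤ C * ‖w‖ ^3

lemma quad_c3 (a : ℝ) (p q : E3 →L[ℝ] ℝ) (u v w x : E3) : dd [u, v, w] (fun y => a + p y * q y) x =0 := by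
  have e1 : pd u (fun y => a + p y * q y) = fun y => (p u • q + q u • p) y := by
    funext y
    have : HasFDerivAt (fun y => a + p y * q y) (p y • q + q y • p) y :=
      (p.hasFDerivAt.mul q.hasFDerivAt).const_add a
    simp only [pd, this.fderiv, _root_.add_apply, _root_.smul_apply, smul_eq_mul]; ring
  simp only [dd, e1]
  have e2 : pd v (fun y => (p u • q + q u • p) y) = fun _ => (p u • q + q u • p) v := by
    funext y; simp only [pd]; rw [ContinuousLinearMap.fderiv]
  rw [e2]; simp [pd]

lemma TW.mul {f g : E3 → ℝ} (hf : TW f) (hg : TW g) : TW (fun x => f x * g x) := by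
  obtain ⟨C, hC, hf⟩ := hf
  obtain ⟨D, hD, hg⟩ := hg
  refine ⟨6 * (C * D), by positivity, fun x => ?_⟩
  obtain ⟨f0, p, hp, fp, M, hM, fM⟩ := hf x
  obtain ⟨g0, q, hq, gq, N, hN, gN⟩ := hg x
  have hCD : 0 ≤ C * D := by positivity
  refine ⟨?_, f x • q + g x • p, fun w => ?_, fun w hw => ?_,
    fun w => 1 * (f x * N w + g x * M w) +1 * (-(f x * g x) + p w * q w), ?_, fun w hw => ?_⟩
  · rw [abs_mul]; nlinarith [mul_le_mul f0 g0 (abs_nonneg _) hC]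
  · have h1 : |f x * q w| ≤ C * (D * ‖w‖) := by rw [abs_mul]; exact mul_le_mul f0 (hq w) (abs_nonneg _) hC
    have h2 : |g x * p w| ≤ D * (C * ‖w‖) := by rw [abs_mul]; exact mul_le_mul g0 (hp w) (abs_nonneg _) hD
    have := abs_add_le (f x * q w) (g x * p w)
    simp only [_root_.add_apply, _root_.smul_apply, smul_eq_mul]
    nlinarith [mul_nonneg hCD (norm_nonneg w)]
  · have h1 : |f x * (g (x-w) - (g x + q w))| ≤ C * (D * ‖w‖ ^2) := by
      rw [abs_mul]; exact mul_le_mul f0 (gq w hw) (abs_nonneg _) hC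
    have h2 : |g x * (f (x-w) - (f x + p w))| ≤ D * (C * ‖w‖ ^2) := by
      rw [abs_mul]; exact mul_le_mul g0 (fp w hw) (abs_nonneg _) hD
    have t0 := norm_nonneg w
    have tt : ‖w‖ ^2 ≤ ‖w‖ := by nlinarith
    have a1 : |f (x-w) - f x| ≤2 * C * ‖w‖ := by
      have := abs_add_le (f (x-w) - (f x + p w)) (p w)
      rw [show f (x-w) - (f x + p w) + p w = f (x-w) - f x by ring] at this
      nlinarith [fp w hw, hp w]
    have a2 : |g (x-w) - g x| ≤2 * D * ‖w‖ := by
      have := abs_add_le (g (x-w) - (g x + q w)) (q w)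
      rw [show g (x-w) - (g x + q w) + q w = g (x-w) - g x by ring] at this
      nlinarith [gq w hw, hq w]
    have h3 : |(f (x-w) - f x) * (g (x-w) - g x)| ≤ (2 * C * ‖w‖) * (2 * D * ‖w‖) := by
      rw [abs_mul]; exact mul_le_mul a1 a2 (abs_nonneg _) (by positivity)
    have e : f (x-w) * g (x-w) - (f x * g x + (f x • q + g x • p) w) =
      f x * (g (x-w) - (g x + q w)) + g x * (f (x-w) - (f x + p w)) + (f (x-w) - f x) * (g (x-w) - g x) := by
      simp only [_root_.add_apply, _root_.smul_apply, smul_eq_mul]; ring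
    rw [e]
    refine (abs_add_le _ _).trans ((add_le_add_left (abs_add_le _ _) _).trans ?_)
    linarith
  · refine ((hN.lin hM (f x) (g x)).lin (Good.c3 (B := 0) (M := fun w => -(f x * g x) + p w * q w) ?_ ?_) 1 1).mono ?_
    · fun_prop
    · intro i j k y; rw [quad_c3]; simp
    · simp only [abs_one, one_mul, mul_zero, add_zero]
      nlinarith [mlr f0 hD, mlr g0 hC]
  · have h1 : |f x * (g (x-w) - N w)| ≤ C * (D * ‖w‖ ^3) := by
      rw [abs_mul]; exact mul_le_mul f0 (gN w hw) (abs_nonneg _) hC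
    have h2 : |g x * (f (x-w) - M w)| ≤ D * (C * ‖w‖ ^3) := by
      rw [abs_mul]; exact mul_le_mul g0 (fM w hw) (abs_nonneg _) hD
    have t0 := norm_nonneg w
    have tt : ‖w‖ ^2 ≤ ‖w‖ := by nlinarith
    have a2 : |g (x-w) - g x| ≤2 * D * ‖w‖ := by
      have := abs_add_le (g (x-w) - (g x + q w)) (q w)
      rw [show g (x-w) - (g x + q w) + q w = g (x-w) - g x by ring] at this
      nlinarith [gq w hw, hq w]
    have h3 : |(f (x-w) - (f x + p w)) * (g (x-w) - g x)| ≤ (C * ‖w‖ ^2) * (2 * D * ‖w‖) := by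
      rw [abs_mul]; exact mul_le_mul (fp w hw) a2 (abs_nonneg _) (by positivity)
    have h4 : |p w * (g (x-w) - (g x + q w))| ≤ (C * ‖w‖) * (D * ‖w‖ ^2) := by
      rw [abs_mul]; exact mul_le_mul (hp w) (gq w hw) (abs_nonneg _) (by positivity)
    have e : f (x-w) * g (x-w) - (1 * (f x * N w + g x * M w) +1 * (-(f x * g x) + p w * q w)) =
      f x * (g (x-w) - N w) + g x * (f (x-w) - M w) + (f (x-w) - (f x + p w)) * (g (x-w) - g x)
        + p w * (g (x-w) - (g x + q w)) := by ring
    rw [e]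
    refine (abs_add_le _ _).trans ((add_le_add_left ((abs_add_le _ _).trans
      (add_le_add_left (abs_add_le _ _) _)) _).trans ?_)
    nlinarith [mul_nonneg hCD (pow_nonneg t0 3)]

lemma phi_tay {φ : ℝ → ℝ} (hφ : ContDiff ℝ 1 φ) {l : ℝ} (hl : ∀ s t, |deriv φ s - deriv φ t| ≤ l * |s - t|)
    (a b c : ℝ) : |φ b - φ a - deriv φ c * (b - a)| ≤ l * (|b - c| + |a - c|) * |b - a| := by
  have hl0 : 0 ≤ l := by simpa using (abs_nonneg _).trans (hl 1 0)
  have := (convex_uIcc a b).norm_image_sub_le_of_norm_hasDerivWithin_le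
    (f := fun t => φ t - deriv φ c * t) (f' := fun t => deriv φ t - deriv φ c) (C := l * (|b - c| + |a - c|))
    (fun t _ => (((hφ.differentiable (by simp) t).hasDerivAt).sub
      (by simpa using (hasDerivAt_id t).const_mul (deriv φ c))).hasDerivWithinAt)
    (fun t ht => (hl t c).trans (mll ?_ hl0)) left_mem_uIcc right_mem_uIcc
  · simp only [Real.norm_eq_abs] at this
    rwa [show φ b - deriv φ c * b - (φ a - deriv φ c * a) = φ b - φ a - deriv φ c * (b - a) by ring] at this
  · rcases mem_uIcc.1 ht with h | h <;> 
    cases abs_cases (t - c) <;> cases abs_cases (b - c) <;> cases abs_cases (a - c) <;> linarith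

lemma cs_bdd {f : E3 → ℝ} (hf : Continuous f) {A : ℝ} (hA : ∀ x, A < ‖x‖ → f x =0) : ∃ B, 0 ≤ B ∧ ∀ x, |f x| ≤ B := by
  obtain ⟨B, hB⟩ := (isCompact_closedBall (0:E3) A).exists_bound_of_continuousOn hf.continuousOn
  refine ⟨max B 0, le_max_right _ _, fun x => ?_⟩
  by_cases hx : ‖x‖ ≤ A
  · exact (hB x (by simpa using hx)).trans (le_max_left _ _)
  · simp [hA x (not_le.1 hx)]

lemma pd_supp {f : E3 → ℝ} {A : ℝ} (hA : ∀ x, A < ‖x‖ → f x =0) (v x : E3) (hx : A < ‖x‖) : pd v f x =0 := by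
  have : f =ᶠ[𝓝 x] fun _ => (0:ℝ) := by
    filter_upwards [(isOpen_lt continuous_const continuous_norm).mem_nhds hx] with y hy using hA y hy
  simp [pd, this.fderiv_eq]

lemma cd_dd {f : E3 → ℝ} {n : ℕ} (l : List E3) (h : ContDiff ℝ (l.length + n : ℕ) f) : ContDiff ℝ n (dd l f) := by
  induction l generalizing f with
  | nil => simpa [dd] using h
  | cons v l ih => exact ih (cd_pd (by convert h using 2; simp; ring) v)

lemma dd_supp {f : E3 → ℝ} {A : ℝ} (hA : ∀ x, A < ‖x‖ → f x =0) (l : List E3) (x : E3) (hx : A < ‖x‖) :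
    dd l f x =0 := by
  induction l generalizing f with
  | nil => exact hA x hx
  | cons v l ih => exact ih (fun y hy => pd_supp hA v y hy)

lemma TW.comp {φ : ℝ → ℝ} (hφ : ContDiff ℝ 1 φ) {l : ℝ} (hl : ∀ s t, |deriv φ s - deriv φ t| ≤ l * |s - t|)
    {A L : ℝ} {u : E3 → ℝ} (hu : Den2 A L 1 u) (h3 : ContDiff ℝ 3 u) : TW (fun x => φ (u x)) := by
  have hl0 : 0 ≤ l := by simpa using (abs_nonneg _).trans (hl 1 0)
  have hL := hu.nn
  obtain ⟨B, hB0, hB⟩ : ∃ B, 0 ≤ B ∧ ∀ i j k x, |dd [ee i, ee j, ee k] u x| ≤ B := by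
    choose b b0 hb using fun i j k => cs_bdd (f := dd [ee i, ee j, ee k] u)
      (cd_dd (n := 0) _ (by simpa using h3)).continuous (dd_supp hu.supp _)
    refine ⟨∑ i, ∑ j, ∑ k, b i j k, Finset.sum_nonneg fun i _ => Finset.sum_nonneg fun j _ =>
      Finset.sum_nonneg fun k _ => b0 i j k, fun i j k x => (hb i j k x).trans ?_⟩
    exact (Finset.single_le_sum (f := fun k => b i j k) (fun k _ => b0 i j k) (Finset.mem_univ k)).trans
      ((Finset.single_le_sum (f := fun j => ∑ k, b i j k)
        (fun j _ => Finset.sum_nonneg fun k _ => b0 i j k) (Finset.mem_univ j)).trans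
      (Finset.single_le_sum (f := fun i => ∑ j, ∑ k, b i j k)
        (fun i _ => Finset.sum_nonneg fun j _ => Finset.sum_nonneg fun k _ => b0 i j k) (Finset.mem_univ i)))
  obtain ⟨P, hP0, hP⟩ : ∃ P, 0 ≤ P ∧ ∀ x, |φ (u x)| ≤ P ∧ |deriv φ (u x)| ≤ P := by
    obtain ⟨b, hb⟩ := (isCompact_closedBall (0:ℝ) L).exists_bound_of_continuousOn hφ.continuous.continuousOn
    refine ⟨max b (|deriv φ 0| + l * L), le_max_of_le_right (by positivity), fun x =>
      ⟨(hb _ (by simpa using hu.bd x)).trans (le_max_left _ _), ?_⟩⟩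
    have h1 := hl (u x) 0
    have h2 := abs_add_le (deriv φ (u x) - deriv φ 0) (deriv φ 0)
    rw [sub_add_cancel] at h2
    rw [sub_zero] at h1
    exact le_max_of_le_right (by nlinarith [hu.bd x])
  have ht : ∀ x w, ‖w‖ ≤1 → |u (x - w) - (u x + -fderiv ℝ u x w)| ≤ L * ‖w‖ ^2 := fun x w hw => by
    by_cases h : w =0
    · simp [h]
    · have hw0 : ‖w‖ ≠0 := by simpa using h
      have := taylor1 one_pos hu x (‖w‖⁻¹ • w) (norm_nonneg w) (by simp [norm_smul, hw0])
      rw [smul_smul, mul_inv_cancel₀ hw0, one_smul] at this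
      simp only [_root_.smul_apply, map_smul, smul_eq_mul, Real.rpow_one] at this
      rw [← mul_assoc, mul_neg, inv_mul_cancel₀ hw0] at this
      convert this using 1
      · congr 2; ring
      · ring
  have hd : ∀ x w, |fderiv ℝ u x w| ≤ L * ‖w‖ := fun x w => by
    have : ‖fderiv ℝ u x‖ ≤ L := norm_fderiv_le_of_lip' ℝ hL (Eventually.of_forall fun y => by
      simpa using hu.lip y x)
    exact ((fderiv ℝ u x).le_opNorm w).trans (mlr this (norm_nonneg _))
  refine ⟨P + P * L + (l * L ^2 + P * L) + (l * L ^2 + P * B) +2 * l * L ^2, by positivity, fun x => ?_⟩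
  have g0 : 0 ≤ P * L := by positivity
  have g1 : 0 ≤ l * L ^2 := by positivity
  have g2 : 0 ≤ P * B := by positivity
  set C := P + P * L + (l * L ^2 + P * L) + (l * L ^2 + P * B) +2 * l * L ^2 with hC
  have hlip : ∀ w, |u (x - w) - u x| ≤ L * ‖w‖ := fun w => by simpa using hu.lip (x - w) x
  obtain ⟨v, hv⟩ : ∃ v : E3, ∀ w, (inner ℝ v w : ℝ) = - fderiv ℝ u x w :=
    ⟨(InnerProductSpace.toDual ℝ E3).symm (-fderiv ℝ u x), fun w => by
      rw [InnerProductSpace.toDual_symm_apply]; rfl⟩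
  have hvn : ‖v‖ ≤ L := by
    have h1 := hd x v
    rw [← abs_neg, ← hv v, real_inner_self_eq_norm_sq, abs_of_nonneg (by positivity)] at h1
    by_contra hc; nlinarith [norm_nonneg v]
  refine ⟨(hP x).1.trans (by linarith), deriv φ (u x) • (-fderiv ℝ u x), fun w => ?_, fun w hw => ?_,
    fun w => 1 * φ (u x + inner ℝ v w) +1 * (deriv φ (u x) * u (x - w) +1 * (-(deriv φ (u x) * (u x + inner ℝ v w)))),
      ?_, fun w hw => ?_⟩
  · simp only [_root_.smul_apply, _root_.neg_apply, smul_eq_mul, abs_mul, abs_neg]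
    calc _ ≤ P * (L * ‖w‖) := mul_le_mul (hP x).2 (hd x w) (abs_nonneg _) hP0
      _ = (P * L) * ‖w‖ := by ring
      _ ≤ _ := mlr (by linarith) (norm_nonneg _)
  · have h1 := phi_tay hφ hl (u x) (u (x - w)) (u x)
    have h2 : |deriv φ (u x) * (u (x - w) - (u x + -fderiv ℝ u x w))| ≤ P * (L * ‖w‖ ^2) := by
      rw [abs_mul]; exact mul_le_mul (hP x).2 (ht x w hw) (abs_nonneg _) hP0
    have e : φ (u (x - w)) - (φ (u x) + (deriv φ (u x) • (-fderiv ℝ u x)) w) =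
      (φ (u (x - w)) - φ (u x) - deriv φ (u x) * (u (x - w) - u x)) +
        deriv φ (u x) * (u (x - w) - (u x + -fderiv ℝ u x w)) := by
      simp only [_root_.smul_apply, _root_.neg_apply, smul_eq_mul]; ring
    rw [e]
    refine (abs_add_le _ _).trans ?_
    rw [sub_self, abs_zero, add_zero] at h1
    have h3 := mul_le_mul (hlip w) (hlip w) (abs_nonneg _) (by positivity)
    calc _ ≤ l * ((L * ‖w‖) * (L * ‖w‖)) + P * (L * ‖w‖ ^2) := by nlinarith
      _ = (l * L ^2 + P * L) * ‖w‖ ^2 := by ring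
      _ ≤ _ := mlr (by linarith) (by positivity)
  · have hs : ContDiff ℝ 3 (fun w => u (x - w)) := h3.comp (contDiff_const.sub contDiff_id)
    have hdd : ∀ i j k y, dd [ee i, ee j, ee k] (fun w => u (x - w)) y = - dd [ee i, ee j, ee k] u (x - y) := by
      intro i j k y
      have e : ∀ (g : E3 → ℝ) (c : ℝ) (v : E3), Differentiable ℝ g →
          pd v (fun w => c * g (x - w)) = fun w => (-c) * pd v g (x - w) := by
        intro g c v hg; funext w
        have h1 : HasFDerivAt (fun w : E3 => x - w) (-ContinuousLinearMap.id ℝ E3) w := (hasFDerivAt_id w).const_sub x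
        have h := (((hg (x - w)).hasFDerivAt).comp w h1).const_mul c
        exact (congrArg (fun A : E3 →L[ℝ] ℝ => A v) h.fderiv).trans (by simp [pd])
      have e0 : (fun w => u (x - w)) = fun w => 1 * u (x - w) := by simp
      simp only [dd]
      have d2 : ContDiff ℝ 2 (pd (ee i) u) := cd_pd (n := 2) (by exact_mod_cast h3) _
      have d1 : ContDiff ℝ 1 (pd (ee j) (pd (ee i) u)) := cd_pd (n := 1) (by exact_mod_cast d2) _
      rw [e0, e _ _ _ (h3.differentiable (by simp)), e _ _ _ (d2.differentiable (by simp)),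
        e _ _ _ (d1.differentiable (by simp))]; norm_num
    have a1 : Good B (fun w => u (x - w)) := Good.c3 hs fun i j k y => by
      rw [hdd, abs_neg]; exact hB _ _ _ _
    have a2 : Good 0 (fun w : E3 => -(deriv φ (u x) * (u x + inner ℝ v w))) := by
      have := Good.c3 (B := 0) (M := fun w : E3 => -(deriv φ (u x) * u x) + (innerSL ℝ v) w * (0 : E3 →L[ℝ] ℝ) w)
        (by fun_prop) (fun i j k y => by rw [quad_c3]; simp)
      refine ⟨by fun_prop, fun K hK i j k m => ?_⟩
      have h := hK.mom1 [ee i, ee j, ee k, ee m] (by simp) (-(deriv φ (u x) * u x)) ((-deriv φ (u x)) • innerSL ℝ v)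
      have e : ∀ w : E3, -(deriv φ (u x) * (u x + inner ℝ v w)) =
        -(deriv φ (u x) * u x) + ((-deriv φ (u x)) • innerSL ℝ v) w := fun w => by simp; ring
      simp only [e, h]; simp
    refine ((Good.wave hφ hl (u x) v).lin (a1.lin a2 (deriv φ (u x)) 1) 1 1).mono ?_
    have hv2 : ‖v‖ ^2 ≤ L ^2 := by gcongr
    simp only [abs_one, one_mul, mul_zero, add_zero]
    nlinarith [mll hv2 hl0, mlr (hP x).2 hB0, mul_nonneg hl0 (sq_nonneg L)]
  · have h1 := phi_tay hφ hl (u x + inner ℝ v w) (u (x - w)) (u x)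
    have e : φ (u (x - w)) - (1 * φ (u x + inner ℝ v w) +1 * (deriv φ (u x) * u (x - w) +1 * (-(deriv φ (u x) * (u x + inner ℝ v w)))))
      = φ (u (x - w)) - φ (u x + inner ℝ v w) - deriv φ (u x) * (u (x - w) - (u x + inner ℝ v w)) := by ring
    rw [e]
    refine h1.trans ?_
    have h2 := ht x w hw
    rw [← hv w] at h2
    have h3 : |u x + inner ℝ v w - u x| ≤ L * ‖w‖ := by
      rw [add_sub_cancel_left, hv, abs_neg]; exact hd x w
    have t0 := norm_nonneg w
    calc _ ≤ l * (L * ‖w‖ + L * ‖w‖) * (L * ‖w‖ ^2) := by gcongr; exact hlip w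
      _ =2 * l * L ^2 * ‖w‖ ^3 := by ring
      _ ≤ _ := mlr (by nlinarith) (by positivity)

def KM (M : ℕ) (x : E3) : ℝ := 1 * farM 1 (cutf N0) M x + (-1) * farM 1 (cutf N0) 0 x

lemma KM_cs (M : ℕ) : CS (KM M) := by
  refine ⟨((kN0.sbM M).lin (kN0.sbM 0) 1 (-1)).1, fun x hx => ?_⟩
  have h : ∀ M, farM 1 (cutf N0) M x = N0 x := fun M => by
    have h2 : (1:ℝ) ≤2 ^ M := one_le_pow₀ (by norm_num)
    rw [farM, kN0.eq, ← kN0.hom (2 ^ M) (by positivity) x]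
    · simp; ring
    · rw [norm_smul, Real.norm_of_nonneg (by positivity)]; nlinarith
  simp only [KM, h]; ring

lemma KM_succ (M : ℕ) (l : List E3) : dd l (KM (M+1)) = fun x => dd l (KM M) x +
    2 ^ M * (2 ^ M) ^ l.length * dd l (zet 1 (cutf N0)) ((2:ℝ) ^ M • x) := by
  have e : KM (M+1) = fun x => 1 * KM M x +1 * (2 ^ M * zet 1 (cutf N0) ((2:ℝ) ^ M • x)) := by
    funext x; simp only [KM, farM_succ]; rw [one_mul M]; ring
  rw [e, dd_lin 1 1 l ((KM_cs M).1.of_le (by exact_mod_cast le_top))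
    ((kN0.sbz.scale _ _).1.of_le (by exact_mod_cast le_top)), dd_scale kN0.sbz.1]
  simp

lemma KM_int (M p : ℕ) (l : List E3) (hl : l.length = p +1) :
    ∫ w, ‖w‖ ^ p * |dd l (KM M) w| ≤ (2 - 2 * (1 /2) ^ M) * ∫ w, ‖w‖ ^ p * |dd l (zet 1 (cutf N0)) w| := by
  have hi : ∀ {K : E3 → ℝ}, CS K → Integrable (fun w => ‖w‖ ^ p * |dd l K w|) := fun hK => by
    have := ((hK.dd l).intg (P := fun w => ‖w‖ ^ p) (by fun_prop)).norm
    simpa [abs_mul] using this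
  induction M with
  | zero =>
    have : ∀ x, KM 0 x =0 := fun x => by simp [KM]
    have e : dd l (KM 0) = fun _ => 0 := by
      rw [show KM 0 = fun x => KM 0 x - KM 0 x from by funext x; simp [this], dd_sub l
        ((KM_cs 0).1.of_le (by exact_mod_cast le_top)) ((KM_cs 0).1.of_le (by exact_mod_cast le_top))]; simp
    simp [e]
  | succ M ih =>
    set Z := dd l (zet 1 (cutf N0)) with hZ
    set t : ℝ := 2 ^ M with ht
    have ht0 : 0 < t := by positivity
    have hs : ∫ w : E3, ‖w‖ ^ p * |t * t ^ l.length * Z (t • w)| = (1 /2) ^ M * ∫ w, ‖w‖ ^ p * |Z w| := by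
      have h1 := Measure.integral_comp_smul (volume : Measure E3) (fun w => ‖w‖ ^ p * |Z w|) t
      have e : ∀ w : E3, ‖w‖ ^ p * |t * t ^ l.length * Z (t • w)| = t ^2 * (‖t • w‖ ^ p * |Z (t • w)|) := fun w => by
        rw [abs_mul, abs_of_pos (by positivity : 0 < t * t ^ l.length), norm_smul, Real.norm_of_nonneg ht0.le, hl]; ring
      simp only [e, integral_const_mul, h1, finrank_euclideanSpace, Fintype.card_fin, smul_eq_mul]
      rw [abs_of_pos (by positivity), one_div, inv_pow, ← ht]
      field_simp
    have hi2 : Integrable (fun w : E3 => ‖w‖ ^ p * |t * t ^ l.length * Z (t • w)|) := by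
      have : (fun w : E3 => ‖w‖ ^ p * |t * t ^ l.length * Z (t • w)|) =
        fun w => t ^2 * (fun w => ‖w‖ ^ p * |Z w|) (t • w) := by
        funext w; simp only
        rw [abs_mul, abs_of_pos (by positivity : 0 < t * t ^ l.length), norm_smul, Real.norm_of_nonneg ht0.le, hl]; ring
      rw [this]
      exact ((hi kN0.cs).comp_smul ht0.ne').const_mul _
    calc _ ≤ ∫ w : E3, (‖w‖ ^ p * |dd l (KM M) w| + ‖w‖ ^ p * |t * t ^ l.length * Z (t • w)|) := by
          refine integral_mono (hi (KM_cs _)) ((hi (KM_cs _)).add hi2) fun w => ?_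
          simp only [KM_succ]
          rw [← mul_add]
          exact mll (abs_add_le _ _) (by positivity)
      _ = _ := integral_add (hi (KM_cs _)) hi2
      _ ≤ _ := by
          rw [hs, pow_succ]; nlinarith

lemma lap_farM (M : ℕ) (x : E3) : lap (farM 1 (cutf N0) M) x = (2 ^ M) ^3 * lap (cutf N0) ((2:ℝ) ^ M • x) := by
  simp only [lap, Finset.mul_sum]
  refine Finset.sum_congr rfl fun i _ => ?_
  rw [show farM 1 (cutf N0) M = fun x => 2 ^ (1 * M) * cutf N0 ((2:ℝ) ^ M • x) from rfl, dd_scale kN0.sb.1]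
  simp only [List.length_cons, List.length_nil]; ring

lemma KM_lap (M : ℕ) : ∫ w, |lap (KM M) w| ≤2 * ∫ w, |lap (cutf N0) w| := by
  have hi0 : Integrable (lap (cutf N0)) := by simpa using lapf_cs.intg (P := fun _ => 1) continuous_const
  have hi : ∀ M, Integrable (fun w => |lap (farM 1 (cutf N0) M) w|) := fun M => by
    simp only [lap_farM]
    exact ((hi0.comp_smul (by positivity)).const_mul _).norm
  have hI : ∀ M, ∫ w, |lap (farM 1 (cutf N0) M) w| = ∫ w, |lap (cutf N0) w| := fun M => by
    have ht0 : (0:ℝ) <2 ^ M := by positivity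
    have h1 := Measure.integral_comp_smul (volume : Measure E3) (fun w => |lap (cutf N0) w|) (2 ^ M)
    simp only [lap_farM, abs_mul, abs_of_pos (pow_pos ht0 3), integral_const_mul, h1, finrank_euclideanSpace,
      Fintype.card_fin, smul_eq_mul]
    rw [abs_of_pos (by positivity)]
    field_simp
  have e : ∀ w, lap (KM M) w = lap (farM 1 (cutf N0) M) w - lap (farM 1 (cutf N0) 0) w := fun w => by
    simp only [lap, ← Finset.sum_sub_distrib]
    refine Finset.sum_congr rfl fun i _ => ?_
    rw [show KM M = fun x => 1 * farM 1 (cutf N0) M x + (-1) * farM 1 (cutf N0) 0 x from rfl, dd_lin 1 (-1) _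
      ((kN0.sbM M).1.of_le (by exact_mod_cast le_top)) ((kN0.sbM 0).1.of_le (by exact_mod_cast le_top))]
    ring
  calc _ ≤ ∫ w, (|lap (farM 1 (cutf N0) M) w| + |lap (farM 1 (cutf N0) 0) w|) := by
        refine integral_mono ?_ ((hi M).add (hi 0)) fun w => ?_
        · simpa using ((lap_cs (KM_cs M)).intg (P := fun _ => 1) continuous_const).norm
        · simp only [e]; exact abs_sub _ _
    _ = _ := by rw [integral_add (hi M) (hi 0), hI, hI]; ring

lemma TW.bd4 {A L f} (hf : Den A L f) (ht : TW f) : ∃ C, ∀ M x i j k m,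
    |dd [ee i, ee j, ee k, ee m] (cv f (farM 1 (cutf N0) M)) x| ≤ C := by
  obtain ⟨C, hC, ht⟩ := ht
  obtain ⟨B0, hB0⟩ : ∃ B, ∀ x i j k m, |dd [ee i, ee j, ee k, ee m] (cv f (farM 1 (cutf N0) 0)) x| ≤ B := by
    choose b hb using fun i j k m => (kN0.sbM 0).2 [ee i, ee j, ee k, ee m]
    have hb0 : ∀ i j k m, 0 ≤ b i j k m := fun i j k m => (abs_nonneg _).trans (hb i j k m 0)
    have hs : ∀ i j k m, b i j k m ≤ ∑ q : (Fin 3 × Fin 3) × (Fin 3 × Fin 3), b q.1.1 q.1.2 q.2.1 q.2.2 :=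
      fun i j k m => Finset.single_le_sum (f := fun q : (Fin 3 × Fin 3) × (Fin 3 × Fin 3) => b q.1.1 q.1.2 q.2.1 q.2.2)
        (fun q _ => hb0 _ _ _ _) (Finset.mem_univ ((i, j), (k, m)))
    refine ⟨∫ y, |f y| * ∑ q : (Fin 3 × Fin 3) × (Fin 3 × Fin 3), b q.1.1 q.1.2 q.2.1 q.2.2, fun x i j k m => ?_⟩
    rw [cv_dd hf.int (kN0.sbM 0), cv, ← Real.norm_eq_abs]
    refine norm_integral_le_of_norm_le (hf.int.norm.mul_const _) (Eventually.of_forall fun y => ?_)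
    rw [norm_mul]
    exact mll ((hb i j k m _).trans (hs i j k m)) (norm_nonneg _)
  choose z hz using fun i j k m : Fin 3 => (⟨_, rfl⟩ : ∃ z, z = ∫ w, ‖w‖ ^3 * |dd [ee i, ee j, ee k, ee m] (zet 1 (cutf N0)) w|)
  have hz0 : ∀ i j k m, 0 ≤ z i j k m := fun i j k m => by rw [hz]; exact integral_nonneg fun _ => by positivity
  set Zs := ∑ q : (Fin 3 × Fin 3) × (Fin 3 × Fin 3), z q.1.1 q.1.2 q.2.1 q.2.2 with hZs
  have hzs : ∀ i j k m, z i j k m ≤ Zs := fun i j k m =>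
    Finset.single_le_sum (f := fun q : (Fin 3 × Fin 3) × (Fin 3 × Fin 3) => z q.1.1 q.1.2 q.2.1 q.2.2)
        (fun q _ => hz0 _ _ _ _) (Finset.mem_univ ((i, j), (k, m)))
  set G := 2 * (∫ w, |lap (cutf N0) w|) + ∑ i, 2 * ∫ w, |pd (ee i) (zet 1 (cutf N0)) w| with hG
  refine ⟨B0 + (C * G + C * (2 * Zs)), fun M x i j k m => ?_⟩
  have half : ∀ M : ℕ, (2 - 2 * (1 /2 : ℝ) ^ M) ≤2 := fun M => by
    have : (0:ℝ) ≤ (1/2) ^ M := by positivity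
    linarith
  set l := [ee i, ee j, ee k, ee m] with hl
  obtain ⟨_, p, _, _, Mo, hMo, hfM⟩ := ht x
  have hCS := KM_cs M
  have hint : Integrable (fun w => f (x - w) * dd l (KM M) w) := by
    have hi : Integrable (dd l (KM M)) := by simpa using (hCS.dd l).intg (P := fun _ => 1) continuous_const
    exact hi.bdd_mul (c := L) (hf.meas.comp (by fun_prop)).aestronglyMeasurable
      (Eventually.of_forall fun w => hf.bd _)
  have e1 : dd l (cv f (farM 1 (cutf N0) M)) x = dd l (cv f (farM 1 (cutf N0) 0)) x + ∫ w, f (x - w) * dd l (KM M) w := by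
    rw [cv_dd hf.int (kN0.sbM M), cv_dd hf.int (kN0.sbM 0)]
    have a0 := cv_int hf.int ((kN0.sbM 0).dd l) x
    have a1 := cv_int hf.int ((kN0.sbM M).dd l) x
    have e2 : ∫ w, f (x - w) * dd l (KM M) w = ∫ y, f y * dd l (KM M) (x - y) := by
      rw [← integral_sub_left_eq_self _ volume x]; simp
    rw [e2, cv, cv, ← sub_eq_iff_eq_add', ← integral_sub a1 a0]
    congr 1; ext y
    rw [show KM M = fun x => 1 * farM 1 (cutf N0) M x + (-1) * farM 1 (cutf N0) 0 x from rfl, dd_lin 1 (-1) l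
      ((kN0.sbM M).1.of_le (by exact_mod_cast le_top)) ((kN0.sbM 0).1.of_le (by exact_mod_cast le_top))]
    ring
  have e3 : ∫ w, f (x - w) * dd l (KM M) w = (∫ w, Mo w * dd l (KM M) w) +
      ∫ w, (f (x - w) - Mo w) * dd l (KM M) w := by
    simp only [sub_mul]
    rw [integral_sub hint ((hCS.dd l).intg hMo.1)]; ring
  have b1 : |∫ w, Mo w * dd l (KM M) w| ≤ C * G := by
    refine (hMo.2 _ hCS i j k m).trans (mll (add_le_add (KM_lap M) ?_) hC)
    refine Finset.sum_le_sum fun i _ => ?_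
    have h := KM_int M 0 [ee i] (by simp)
    simp only [pow_zero, one_mul, dd] at h
    exact h.trans (mlr (half M) (integral_nonneg fun _ => abs_nonneg _))
  have b2 : |∫ w, (f (x - w) - Mo w) * dd l (KM M) w| ≤ C * (2 * Zs) := by
    have h := KM_int M 3 l (by simp [hl])
    have hi : Integrable (fun w => ‖w‖ ^3 * |dd l (KM M) w|) := by
      have := ((hCS.dd l).intg (P := fun w => ‖w‖ ^3) (by fun_prop)).norm
      simpa [abs_mul] using this
    rw [← Real.norm_eq_abs]
    refine (norm_integral_le_of_norm_le (hi.const_mul C) (Eventually.of_forall fun w => ?_)).trans ?_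
    · by_cases hw : ‖w‖ ≤1
      · rw [norm_mul, ← mul_assoc]
        exact mlr (hfM w hw) (abs_nonneg _)
      · simp [(hCS.dd l).2 w (not_le.1 hw)]
    · rw [integral_const_mul]
      refine mll (h.trans ?_) hC
      rw [← hz]
      exact mul_le_mul (half M) (hzs _ _ _ _) (hz0 _ _ _ _) (by norm_num)
  rw [e1, e3]
  refine (abs_add_le _ _).trans (add_le_add (hB0 x i j k m) ((abs_add_le _ _).trans (add_le_add b1 b2)))

lemma lip_lim {d N far} (hK : Ker d N far) {A L f} (hf : Den2 A L 1 f) {C : ℝ} (i j k : Fin 3)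
    (h : ∀ M x m, |dd [ee i, ee j, ee k, ee m] (cv f (farM d far M)) x| ≤ C) (x y : E3) :
    |dd [ee i, ee j, ee k] (cv f N) x - dd [ee i, ee j, ee k] (cv f N) y| ≤3 * C * ‖x - y‖ := by
  have ht := (hK.R3 one_pos le_rfl hf).2 [ee i, ee j, ee k] (by simp)
  refine le_of_tendsto ((ht x).sub (ht y)).abs (Eventually.of_forall fun M => ?_)
  refine lip_pd ((cdi_dd (cv_smooth hf.int (hK.sbM M)) _).differentiable (by simp)) (fun m x => ?_) x y
  rw [dd_snoc]; exact h M x m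

lemma R4_0 {N far} (hK : Ker 0 N far) {A L f} (hf : Den2 A L 1 f) : ∃ C, ∀ i j k x y,
    |dd [ee i, ee j, ee k] (cv f N) x - dd [ee i, ee j, ee k] (cv f N) y| ≤ C * ‖x - y‖ := by
  have key : ∀ i j k m : Fin 3, ∃ C, 0 ≤ C ∧ ∀ M x, |dd [ee i, ee j, ee k, ee m] (cv f (farM 0 far M)) x| ≤ C := by
    intro i j k m
    obtain ⟨C, hC, h⟩ := hK.main A (1/2) (by norm_num) (by norm_num) [ee i, ee j, ee k, ee m]
    refine ⟨C * L, mul_nonneg hC hf.nn, (h f L (fun q => L * ((1 /2 : ℝ) ^ (1:ℝ)) ^ q * (1 /2) ^ q) hf.toDen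
      (fun q => ?_) fun q x => hK.osc3 one_pos hf _ (by simp) q x).2⟩
    have e : (2:ℝ) ^ ((0 + [ee i, ee j, ee k, ee m].length) * q) /8 ^ q =2 ^ q := by
      rw [show 0 + [ee i, ee j, ee k, ee m].length =4 from rfl, pow_mul, ← div_pow]; norm_num
    rw [e, Real.rpow_one]
    have e2 : (2:ℝ) ^ q * (1 /2) ^ q =1 := by rw [← mul_pow]; norm_num
    exact le_of_eq (by linear_combination (L * (1 /2) ^ q) * e2)
  choose c hc0 hc using key
  refine ⟨3 * ∑ q : (Fin 3 × Fin 3) × (Fin 3 × Fin 3), c q.1.1 q.1.2 q.2.1 q.2.2, fun i j k x y =>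
    lip_lim hK hf i j k (fun M x m => (hc i j k m M x).trans
      (Finset.single_le_sum (f := fun q : (Fin 3 × Fin 3) × (Fin 3 × Fin 3) => c q.1.1 q.1.2 q.2.1 q.2.2)
        (fun q _ => hc0 _ _ _ _) (Finset.mem_univ ((i, j), (k, m))))) x y⟩

lemma R4_1 {A L f} (hf : Den2 A L 1 f) (ht : TW f) : ∃ C, ∀ i j k x y,
    |dd [ee i, ee j, ee k] (cv f N0) x - dd [ee i, ee j, ee k] (cv f N0) y| ≤ C * ‖x - y‖ := by
  obtain ⟨C, hC⟩ := ht.bd4 hf.toDen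
  exact ⟨3 * C, fun i j k x y => lip_lim kN0 hf i j k (fun M x m => hC M x i j k m) x y⟩

abbrev E2 := EuclideanSpace ℝ (Fin 2)

lemma sq2 : Measure.map (fun y : E2 => ‖y‖ ^2) volume =
    ((volume (ball (0:E2) 1)).toNNReal) • (volume.restrict (Ioi (0:ℝ))) := by
  symm
  refine Measure.ext_of_Ioc _ _ fun a b hab => ?_
  have hm : Measurable (fun y : E2 => ‖y‖ ^2) := by fun_prop
  have hc : volume (ball (0:E2) 1) ≠ ⊤ := measure_ball_lt_top.ne
  have h1 : ∀ b : ℝ, Measure.map (fun y : E2 => ‖y‖ ^2) volume (Iic b)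
      = ENNReal.ofReal b * volume (ball (0:E2) 1) := fun b => by
    rw [Measure.map_apply hm measurableSet_Iic]
    rcases lt_or_ge b 0 with hb | hb
    · have : (fun y : E2 => ‖y‖ ^2) ⁻¹' Iic b = ∅ := by
        ext y; simp only [mem_preimage, mem_Iic, mem_empty_iff_false, iff_false, not_le]
        exact hb.trans_le (by positivity)
      rw [this, ENNReal.ofReal_of_nonpos hb.le]; simp
    · have : (fun y : E2 => ‖y‖ ^2) ⁻¹' Iic b = closedBall 0 (Real.sqrt b) := by
        ext y; simp only [mem_preimage, mem_Iic, mem_closedBall, dist_zero_right]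
        exact (Real.le_sqrt (norm_nonneg _) hb).symm
      rw [this, Measure.addHaar_closedBall _ _ (Real.sqrt_nonneg _)]
      simp [Real.sq_sqrt hb]
  have h0 : Measure.map (fun y : E2 => ‖y‖ ^2) volume (Ioc a b) = ENNReal.ofReal b * volume (ball (0:E2) 1)
      - ENNReal.ofReal a * volume (ball (0:E2) 1) := by
    rw [show Ioc a b = Iic b \ Iic a by ext; simp [and_comm],
      measure_diff (Iic_subset_Iic.2 hab.le) measurableSet_Iic.nullMeasurableSet
        (by rw [h1]; finiteness), h1, h1]
  rw [h0]
  simp only [Measure.smul_apply, Measure.restrict_apply measurableSet_Ioc]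
  have h2 : Ioc a b ∩ Ioi 0 = Ioc (max a 0) b := by
    ext t; simp only [mem_inter_iff, mem_Ioc, mem_Ioi, max_lt_iff]; tauto
  rw [h2, Real.volume_Ioc, ENNReal.ofReal_sub _ (le_max_right _ _), ENNReal.smul_def, smul_eq_mul,
    ENNReal.coe_toNNReal hc, ← ENNReal.sub_mul (fun _ _ => hc), mul_comm]
  congr 2
  rcases le_total a 0 with h | h
  · simp [h, ENNReal.ofReal_of_nonpos h]
  · simp [h]

lemma hatbox {Φ : ℝ → ℝ → ENNReal} (hΦ : Measurable (fun p : ℝ × ℝ => Φ p.1 p.2)) :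
    ∫⁻ y : E3, Φ (y 2) (‖y‖ ^2) = ((volume (ball (0:E2) 1)).toNNReal : ENNReal) *
      ∫⁻ s, ∫⁻ z, (if z ^2 < s then Φ z s else 0) := by
  set c := (volume (ball (0:E2) 1)).toNNReal with hc
  have hq : ∀ f : ℝ → ENNReal, Measurable f → ∫⁻ w : E2, f (‖w‖ ^2) = c * ∫⁻ t in Ioi (0:ℝ), f t := fun f hf => by
    have := lintegral_map hf (by fun_prop : Measurable (fun y : E2 => ‖y‖ ^2)) (μ := volume)
    rw [← this, sq2, lintegral_smul_measure]; rfl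
  have hn3 : ∀ v : Fin 3 → ℝ, ‖(WithLp.toLp 2 v : E3)‖ ^2 = v 2 ^2 + ‖(WithLp.toLp 2 (fun j : Fin 2 => v (Fin.succAbove 2 j)) : E2)‖ ^2 := fun v => by
    rw [EuclideanSpace.norm_sq_eq, EuclideanSpace.norm_sq_eq]
    simp [Fin.sum_univ_three, Fin.sum_univ_two, Fin.succAbove]; ring_nf
  have m1 : Measurable (fun p : ℝ × (Fin 2 → ℝ) => Φ p.1 (p.1 ^2 + ‖(WithLp.toLp 2 p.2 : E2)‖ ^2)) :=
    hΦ.comp (by fun_prop : Measurable fun p : ℝ × (Fin 2 → ℝ) => (p.1, p.1 ^2 + ‖(WithLp.toLp 2 p.2 : E2)‖ ^2))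
  have hind : Measurable (fun p : ℝ × ℝ => if p.1 ^2 < p.2 then Φ p.1 p.2 else 0) :=
    Measurable.ite (measurableSet_lt (by fun_prop) (by fun_prop)) hΦ measurable_const
  calc ∫⁻ y : E3, Φ (y 2) (‖y‖ ^2)
      = ∫⁻ v : Fin 3 → ℝ, Φ ((WithLp.toLp 2 v : E3) 2) (‖(WithLp.toLp 2 v : E3)‖ ^2) :=
        ((PiLp.volume_preserving_toLp (Fin 3)).lintegral_comp (f := fun y : E3 => Φ (y 2) (‖y‖ ^2))
          (hΦ.comp (by fun_prop : Measurable fun y : E3 => (y 2, ‖y‖ ^2)))).symm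
    _ = ∫⁻ v : Fin 3 → ℝ, (fun p : ℝ × (Fin 2 → ℝ) => Φ p.1 (p.1 ^2 + ‖(WithLp.toLp 2 p.2 : E2)‖ ^2))
          (MeasurableEquiv.piFinSuccAbove (fun _ : Fin 3 => ℝ) 2 v) := by
        congr 1; ext v; rw [hn3]; rfl
    _ = ∫⁻ p : ℝ × (Fin 2 → ℝ), Φ p.1 (p.1 ^2 + ‖(WithLp.toLp 2 p.2 : E2)‖ ^2) :=
        (volume_preserving_piFinSuccAbove (fun _ : Fin 3 => ℝ) 2).lintegral_comp m1
    _ = ∫⁻ z, ∫⁻ w : Fin 2 → ℝ, Φ z (z ^2 + ‖(WithLp.toLp 2 w : E2)‖ ^2) := by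
        rw [Measure.volume_eq_prod, lintegral_prod _ m1.aemeasurable]
    _ = ∫⁻ z, ∫⁻ w : E2, Φ z (z ^2 + ‖w‖ ^2) := by
        congr 1; ext z
        exact (PiLp.volume_preserving_toLp (Fin 2)).lintegral_comp (f := fun w : E2 => Φ z (z ^2 + ‖w‖ ^2))
          (hΦ.comp (by fun_prop : Measurable fun w : E2 => (z, z ^2 + ‖w‖ ^2)))
    _ = ∫⁻ z, c * ∫⁻ s, (if z ^2 < s then Φ z s else 0) := by
        congr 1; ext z
        rw [hq (fun t => Φ z (z ^2 + t)) (hΦ.comp (by fun_prop : Measurable fun t : ℝ => (z, z ^2 + t)))]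
        congr 1
        rw [← lintegral_indicator measurableSet_Ioi,
          ← lintegral_sub_right_eq_self _ (z ^2)]
        congr 1; ext s
        simp only [indicator, mem_Ioi, sub_pos, add_sub_cancel]
    _ = c * ∫⁻ z, ∫⁻ s, (if z ^2 < s then Φ z s else 0) := by
        rw [lintegral_const_mul]; exact hind.lintegral_prod_right'
    _ = _ := by
        rw [lintegral_lintegral_swap hind.aemeasurable]

lemma inner_z {r s : ℝ} (hr : 0 < r) (hs : 0 < s) :
    ∫⁻ z in Ioo (-s) s, ENNReal.ofReal (1 / Real.sqrt (s ^2 - 2 * z * r + r ^2)) =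
      ∫⁻ z in Ioo (-s) s, ENNReal.ofReal (1 / max r s) := by
  have hp : ∀ z ∈ Ioo (-s) s, 0 < s ^2 - 2 * z * r + r ^2 := fun z hz => by
    nlinarith [sq_nonneg (s - r), mul_pos hr (sub_pos.2 hz.2)]
  set g : ℝ → ℝ := fun z => -Real.sqrt (s ^2 - 2 * z * r + r ^2) / r with hg
  have hgc : Continuous g := by fun_prop
  have hd : ∀ z ∈ Ioo (-s) s, HasDerivAt g (1 / Real.sqrt (s ^2 - 2 * z * r + r ^2)) z := fun z hz => by
    have h1 : HasDerivAt (fun z : ℝ => s ^2 - 2 * z * r + r ^2) (-(2 * r)) z := by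
      have := ((((hasDerivAt_id z).const_mul 2).mul_const r).const_sub (s ^2)).add_const (r ^2)
      simpa using this
    have h2 := ((h1.sqrt (hp z hz).ne').neg).div_const r
    have := Real.sqrt_pos.2 (hp z hz)
    refine h2.congr_deriv ?_
    field_simp
  have hss : -s ≤ s := by linarith
  have hi : IntervalIntegrable (fun z => 1 / Real.sqrt (s ^2 - 2 * z * r + r ^2)) volume (-s) s :=
    intervalIntegral.intervalIntegrable_deriv_of_nonneg hgc.continuousOn
      (by simpa [hss] using hd) (fun z _ => by positivity)
  have h3 := intervalIntegral.integral_eq_sub_of_hasDerivAt_of_le hss hgc.continuousOn hd hi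
  have h4 : g s - g (-s) =2 * s * (1 / max r s) := by
    simp only [hg]
    rw [show s ^2 - 2 * s * r + r ^2 = (s - r) ^2 by ring, show s ^2 - 2 * -s * r + r ^2 = (s + r) ^2 by ring,
      Real.sqrt_sq_eq_abs, Real.sqrt_sq (by positivity)]
    rcases le_total r s with h | h
    · rw [abs_of_nonneg (by linarith), max_eq_right h]; field_simp; ring
    · rw [abs_of_nonpos (by linarith), max_eq_left h]; field_simp; ring
  rw [intervalIntegral.integral_of_le hss, integral_Ioc_eq_integral_Ioo] at h3
  rw [← ofReal_integral_eq_lintegral_ofReal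
    (((intervalIntegrable_iff_integrableOn_Ioc_of_le hss).1 hi).mono_set Ioo_subset_Ioc_self)
    (Eventually.of_forall fun z => by positivity), h3, h4, setLIntegral_const, Real.volume_Ioo,
    ← ENNReal.ofReal_mul (by positivity)]
  congr 1; ring

lemma shell_axis {F : ℝ → ENNReal} (hF : Measurable F) {r : ℝ} (hr : 0 < r) :
    ∫⁻ y : E3, F (‖y‖ ^2) * ENNReal.ofReal (1 / ‖r • ee 2 - y‖) =
      ∫⁻ y : E3, F (‖y‖ ^2) * ENNReal.ofReal (1 / max r ‖y‖) := by
  have e1 : ∀ y : E3, ‖r • ee 2 - y‖ = Real.sqrt (‖y‖ ^2 - 2 * y 2 * r + r ^2) := fun y => by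
    rw [← Real.sqrt_sq (norm_nonneg (r • ee 2 - y)), norm_sub_sq_real, norm_smul, norm_ee, Real.norm_of_nonneg hr.le,
      real_inner_smul_left]
    congr 1
    simp [ee, EuclideanSpace.inner_single_left]; ring
  have e2 : ∀ y : E3, max r ‖y‖ = max r (Real.sqrt (‖y‖ ^2)) := fun y => by
    rw [Real.sqrt_sq (norm_nonneg _)]
  simp only [e1, e2]
  rw [hatbox (Φ := fun z s => F s * ENNReal.ofReal (1 / Real.sqrt (s - 2 * z * r + r ^2))) (by fun_prop),
    hatbox (Φ := fun z s => F s * ENNReal.ofReal (1 / max r (Real.sqrt s))) (by fun_prop)]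
  congr 1; congr 1; ext s
  rcases le_or_gt s 0 with hs | hs
  · have : ∀ z : ℝ, ¬ z ^2 < s := fun z => not_lt.2 (hs.trans (sq_nonneg z))
    simp [this]
  · have hq := Real.sqrt_pos.2 hs
    have hset : ∀ (G : ℝ → ENNReal), ∫⁻ z, (if z ^2 < s then F s * G z else 0) =
        ∫⁻ z in Ioo (-Real.sqrt s) (Real.sqrt s), F s * G z := fun G => by
      rw [← lintegral_indicator measurableSet_Ioo]
      congr 1; ext z
      simp only [indicator, mem_Ioo, ← abs_lt, Real.lt_sqrt (abs_nonneg z), sq_abs]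
    rw [hset (fun z => ENNReal.ofReal (1 / Real.sqrt (s - 2 * z * r + r ^2))),
      hset (fun _ => ENNReal.ofReal (1 / max r (Real.sqrt s))), lintegral_const_mul _ (by fun_prop),
      lintegral_const_mul _ (by fun_prop)]
    have := inner_z hr hq
    rw [Real.sq_sqrt hs.le] at this
    rw [this]

lemma exists_rot {x x' : E3} (h : ‖x‖ = ‖x'‖) : ∃ A : E3 ≃ₗᵢ[ℝ] E3, A x = x' :=
  ⟨(Submodule.reflection (ℝ ∙ (x - x'))ᗮ), Submodule.reflection_sub h⟩

lemma shell_l {F : ℝ → ENNReal} (hF : Measurable F) {x : E3} (hx : x ≠0) :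
    ∫⁻ y : E3, F (‖y‖ ^2) * ENNReal.ofReal (1 / ‖x - y‖) =
      ∫⁻ y : E3, F (‖y‖ ^2) * ENNReal.ofReal (1 / max ‖x‖ ‖y‖) := by
  obtain ⟨A, hA⟩ := exists_rot (x := x) (x' := ‖x‖ • ee 2) (by simp [norm_smul, norm_ee])
  rw [← shell_axis hF (norm_pos_iff.2 hx)]
  refine Eq.trans ?_ (A.measurePreserving.lintegral_comp
    (f := fun y => F (‖y‖ ^2) * ENNReal.ofReal (1 / ‖‖x‖ • ee 2 - y‖)) (by fun_prop))
  congr 1; ext y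
  rw [← hA, ← map_sub, A.norm_map, A.norm_map]

lemma shell {A L f} (hf : Den A L f) (hr : ∀ x y : E3, ‖x‖ = ‖y‖ → f x = f y) (x : E3) :
    pot f x = ∫ y, f y / max ‖x‖ ‖y‖ := by
  rcases eq_or_ne x 0 with rfl | hx
  · simp [pot]
  have hx0 := norm_pos_iff.2 hx
  set F : ℝ → ℝ := fun s => f (Real.sqrt s • ee 0) with hF
  have hFm : Measurable F := hf.meas.comp (by fun_prop)
  have hfF : ∀ y, f y = F (‖y‖ ^2) := fun y => hr _ _ (by
    rw [norm_smul, norm_ee, Real.sqrt_sq (norm_nonneg _)]; simp)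
  have i1 : Integrable (fun y => f y / ‖x - y‖) := by
    have := kN0.int hf (g := N0) kN0.meas kN0.bd x
    simpa [N0, div_eq_mul_inv] using this
  have i2 : Integrable (fun y => f y / max ‖x‖ ‖y‖) := by
    have := hf.int.bdd_mul (f := fun y : E3 => 1 / max ‖x‖ ‖y‖) (c := 1 / ‖x‖)
      (by fun_prop : Measurable fun y : E3 => 1 / max ‖x‖ ‖y‖).aestronglyMeasurable (Eventually.of_forall fun y => by
        rw [Real.norm_of_nonneg (by positivity)]
        exact one_div_le_one_div_of_le hx0 (le_max_left _ _))
    simpa [div_eq_mul_inv, mul_comm] using this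
  rw [pot, integral_eq_lintegral_pos_part_sub_lintegral_neg_part i1,
    integral_eq_lintegral_pos_part_sub_lintegral_neg_part i2]
  have key : ∀ G : ℝ → ℝ, Measurable G → ∫⁻ y : E3, ENNReal.ofReal (G (‖y‖ ^2) / ‖x - y‖) =
      ∫⁻ y : E3, ENNReal.ofReal (G (‖y‖ ^2) / max ‖x‖ ‖y‖) := fun G hG => by
    have := shell_l (F := fun s => ENNReal.ofReal (G s)) (by fun_prop) hx
    simp only [div_eq_mul_inv] at this ⊢
    simp only [ENNReal.ofReal_mul' (inv_nonneg.2 (norm_nonneg _)),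
      ENNReal.ofReal_mul' (inv_nonneg.2 (le_max_of_le_right (norm_nonneg _)))]
    simpa using this
  simp only [hfF, ← neg_div]
  rw [key F hFm, key (fun s => -F s) hFm.neg]

lemma pot_int {A L f} (hf : Den A L f) (x : E3) : Integrable (fun y => f y / ‖x - y‖) := by
  have := kN0.int hf (g := N0) kN0.meas kN0.bd x
  simpa [N0, div_eq_mul_inv] using this

lemma pot_c1 {A L f} (hf : Den A L f) : ContDiff ℝ 1 (pot f) := cv_N0 f ▸ (kN0.R1 hf).1

lemma pot_bd (A : ℝ) : ∃ C, 0 ≤ C ∧ ∀ f L, Den A L f → ∀ x, |pot f x| ≤ C * L := by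
  obtain ⟨C, hC, h⟩ := kN0.R1b A [] (by simp)
  exact ⟨C, hC, fun f L hf x => by simpa [dd, cv_N0] using h f L hf x⟩

lemma pot_bd1 (A : ℝ) : ∃ C, 0 ≤ C ∧ ∀ f L, Den A L f → ∀ x, ‖fderiv ℝ (pot f) x‖ ≤ C * L := by
  choose C hC h using fun i => kN0.R1b A [ee i] (by simp)
  refine ⟨3 * ∑ i, C i, by positivity [Finset.sum_nonneg fun i (_ : i ∈ Finset.univ) => hC i], fun f L hf x => ?_⟩
  rw [mul_assoc]
  refine clm_bd _ fun i => ?_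
  have := h i f L hf x
  simp only [dd, cv_N0, pd] at this
  exact this.trans (mlr (Finset.single_le_sum (fun i _ => hC i) (Finset.mem_univ i)) hf.nn)

lemma pot_rot (A : E3 ≃ₗᵢ[ℝ] E3) (f : E3 → ℝ) (x : E3) : pot (fun y => f (A y)) x = pot f (A x) := by
  have := A.measurePreserving.integral_comp A.toHomeomorph.measurableEmbedding (fun y => f y / ‖A x - y‖)
  rw [pot, pot, ← this]
  congr 1; ext y
  rw [← map_sub, A.norm_map]

lemma Den.abs {A L f} (h : Den A L f) : Den A L (fun x => |f x|) :=
  ⟨h.meas.abs, fun x => by simpa using h.bd x, fun x hx => by simp [h.supp x hx]⟩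

lemma Den.mulc {A L f} (h : Den A L f) {g : E3 → ℝ} (hg : Continuous g) : ∃ L', Den A L' (fun x => f x * g x) := by
  obtain ⟨B, hB⟩ := (isCompact_closedBall (0:E3) A).exists_bound_of_continuousOn hg.continuousOn
  refine ⟨L * |B|, h.meas.mul hg.measurable, fun x => ?_, fun x hx => by simp [h.supp x hx]⟩
  rw [abs_mul]
  by_cases hx : ‖x‖ ≤ A
  · exact mul_le_mul (h.bd x) ((hB x (by simpa using hx)).trans (le_abs_self B)) (abs_nonneg _) h.nn
  · rw [h.supp x (not_le.1 hx)]; simp; exact mul_nonneg h.nn (abs_nonneg _)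

lemma pot_symm {A L f B M g} (hf : Den A L f) (hg : Den B M g) : ∫ x, f x * pot g x = ∫ y, g y * pot f y := by
  have h1 : ∀ x, f x * pot g x = ∫ y, f x * (g y / ‖x - y‖) := fun x => by rw [integral_const_mul]; rfl
  have h2 : ∀ y, g y * pot f y = ∫ x, f x * (g y / ‖x - y‖) := fun y => by
    rw [pot, ← integral_const_mul]
    congr 1; ext x; rw [norm_sub_rev]; ring
  simp only [h1, h2]
  refine integral_integral_swap ?_
  have hm : Measurable (Function.uncurry fun x y => f x * (g y / ‖x - y‖)) := by
    have := hf.meas; have := hg.meas; unfold Function.uncurry; fun_prop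
  refine (integrable_prod_iff hm.aestronglyMeasurable).2 ⟨Eventually.of_forall fun x => (pot_int hg x).const_mul (f x), ?_⟩
  obtain ⟨L', h⟩ := hf.abs.mulc (pot_c1 hg.abs).continuous
  refine h.int.congr (Eventually.of_forall fun x => ?_)
  simp only [Function.uncurry, norm_mul, norm_div, Real.norm_eq_abs, abs_norm]
  rw [integral_const_mul]; rfl

lemma pot_mono {A L f} (hf : Den A L f) (hr : ∀ x y : E3, ‖x‖ = ‖y‖ → f x = f y) (h0 : ∀ x, 0 ≤ f x) {x y : E3}
    (h : ‖x‖ ≤ ‖y‖) : pot f y ≤ pot f x := by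
  rw [shell hf hr, shell hf hr]
  have hi : ∀ x : E3, Integrable (fun z => f z / max ‖x‖ ‖z‖) := fun x => by
    refine (pot_int hf 0).mono' ?_ ((show ∀ᵐ z : E3, z ≠0 from compl_mem_ae_iff.2 (measure_singleton (0:E3))).mono fun z hz => ?_)
    · have := hf.meas
      exact (by fun_prop : Measurable fun z : E3 => f z / max ‖x‖ ‖z‖).aestronglyMeasurable
    · rw [Real.norm_of_nonneg (div_nonneg (h0 z) (by positivity)), zero_sub, norm_neg]
      exact div_le_div_of_nonneg_left (h0 z) (norm_pos_iff.2 hz) (le_max_right _ _)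
  refine integral_mono_ae (hi y) (hi x) ?_
  filter_upwards [compl_mem_ae_iff.2 (measure_singleton (0:E3))] with z hz
  exact div_le_div_of_nonneg_left (h0 z) (lt_max_of_lt_right (norm_pos_iff.2 hz)) (max_le_max_right _ h)

lemma pot_out {A L f} (hf : Den A L f) (hr : ∀ x y : E3, ‖x‖ = ‖y‖ → f x = f y) {x : E3} (hx : A ≤ ‖x‖) :
    pot f x = (∫ y, f y) / ‖x‖ := by
  rw [shell hf hr, ← integral_div]
  congr 1; ext y
  by_cases hy : ‖y‖ ≤ A
  · rw [max_eq_left (hy.trans hx)]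
  · simp [hf.supp y (not_le.1 hy)]

lemma dint {g f : E3 → ℝ} {w : E3 → E3} (hg : Measurable g) (hw : Continuous w) (hf : ContDiff ℝ 1 f) {B : ℝ}
    (hB : ∀ x, ‖fderiv ℝ f x‖ ≤ B) (hi : Integrable fun y => |g y| * ‖w y‖) (hi2 : Integrable fun y => g y * f y) :
    HasDerivAt (fun t : ℝ => ∫ y, g y * f (y + t • w y)) (∫ y, g y * fderiv ℝ f y (w y)) 0 := by
  have hfc := hf.continuous
  have hd : ∀ y, ∀ t : ℝ, HasDerivAt (fun t : ℝ => g y * f (y + t • w y)) (g y * fderiv ℝ f (y + t • w y) (w y)) t :=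
    fun y t => by
      have h1 : HasDerivAt (fun t : ℝ => y + t • w y) (w y) t := by
        simpa using ((hasDerivAt_id t).smul_const (w y)).const_add y
      exact (((hf.differentiable (by norm_num) _).hasFDerivAt.comp_hasDerivAt t h1)).const_mul (g y)
  have hdf : Continuous (fderiv ℝ f) := hf.continuous_fderiv (by norm_num)
  have := (hasDerivAt_integral_of_dominated_loc_of_deriv_le (μ := volume) (x₀ := (0:ℝ)) (s := univ)
    (F := fun t y => g y * f (y + t • w y)) (F' := fun t y => g y * fderiv ℝ f (y + t • w y) (w y))
    (bound := fun y => B * (|g y| * ‖w y‖)) univ_mem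
    (Eventually.of_forall fun t => (hg.mul (by fun_prop : Continuous fun y => f (y + t • w y)).measurable).aestronglyMeasurable)
    (by simpa using hi2) ?_ (Eventually.of_forall fun y t _ => ?_) (hi.const_mul B)
    (Eventually.of_forall fun y t _ => hd y t)).2
  · simpa using this
  · exact (hg.mul (by fun_prop : Continuous fun y => fderiv ℝ f (y + (0:ℝ) • w y) (w y)).measurable).aestronglyMeasurable
  · rw [norm_mul, Real.norm_eq_abs]
    have := (fderiv ℝ f (y + t • w y)).le_opNorm (w y)
    nlinarith [hB (y + t • w y), abs_nonneg (g y), norm_nonneg (w y), mlr (hB (y + t • w y)) (norm_nonneg (w y))]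

lemma c0_ne : c0 ≠0 := by
  intro hc
  set f : E3 → ℝ := fun y => max 0 (2 - ‖y‖) with hf
  have hD : Den1 2 2 f := by
    refine ⟨⟨by fun_prop, fun x => ?_, fun x hx => max_eq_left (by linarith)⟩, fun x y => ?_⟩
    · rw [abs_of_nonneg (le_max_left _ _)]; exact max_le (by norm_num) (by linarith [norm_nonneg x])
    · have h1 := abs_max_sub_max_le_abs (2 - ‖x‖) (2 - ‖y‖) 0
      have h2 := abs_norm_sub_norm_le x y
      have h3 : |(2 - ‖x‖) - (2 - ‖y‖)| = |‖x‖ - ‖y‖| := by rw [← abs_neg]; congr 1; ring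
      simp only [hf, max_comm (0:ℝ)]
      linarith [norm_nonneg (x - y)]
  have hr : ∀ x y : E3, ‖x‖ = ‖y‖ → f x = f y := fun x y h => by simp [hf, h]
  have hlap := poisson hD 0
  have h2 : ContDiff ℝ 2 (pot f) := cv_N0 f ▸ (kN0.R2 hD).1
  rw [hc, zero_mul, lap] at hlap
  obtain ⟨i, -, hi⟩ : ∃ i ∈ Finset.univ, 0 ≤ dd [ee i, ee i] (pot f) 0 := by
    by_contra! h
    exact absurd hlap (Finset.sum_neg h ⟨0, by simp⟩).ne
  set V := (volume : Measure E3).real (closedBall 0 1) with hV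
  have hV0 : 0 < V := by
    rw [hV, Measure.real, ENNReal.toReal_pos_iff]
    exact ⟨measure_closedBall_pos _ _ one_pos, measure_closedBall_lt_top⟩
  have hdrop : ∀ x : E3, x ≠0 → ‖x‖ ≤1 → V /8 * ‖x‖ ^2 ≤ pot f 0 - pot f x := fun x hx hx1 => by
    have hx0 := norm_pos_iff.2 hx
    have i0 := pot_int hD.toDen 0
    have hb : Integrable ((closedBall (0:E3) (‖x‖ /2)).indicator (fun _ => 1 / ‖x‖)) := ball_int _ _ _
    have i1 : Integrable (fun y => f y / max ‖x‖ ‖y‖) := by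
      have hm : Measurable fun y => f y / max ‖x‖ ‖y‖ := by fun_prop
      refine (hD.int.const_mul (1 / ‖x‖)).mono' hm.aestronglyMeasurable (Eventually.of_forall fun y => ?_)
      rw [Real.norm_of_nonneg (div_nonneg (le_max_left _ _) (by positivity)), one_div, inv_mul_eq_div]
      exact div_le_div_of_nonneg_left (le_max_left _ _) hx0 (le_max_left _ _)
    have h1 : V /8 * ‖x‖ ^2 = ∫ y, (closedBall (0:E3) (‖x‖ /2)).indicator (fun _ => 1 / ‖x‖) y := by
      rw [integral_indicator measurableSet_closedBall]
      simp only [integral_const, smul_eq_mul, measureReal_restrict_apply_univ]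
      rw [Measure.real, Measure.addHaar_closedBall_eq_addHaar_ball, Measure.addHaar_ball _ _ (by positivity),
        ← Measure.addHaar_closedBall_eq_addHaar_ball, ENNReal.toReal_mul, ENNReal.toReal_ofReal (by positivity)]
      simp only [finrank_euclideanSpace, Fintype.card_fin]
      change _ = (‖x‖ /2) ^3 * V * (1 / ‖x‖)
      field_simp; norm_num
    rw [shell hD.toDen hr x, h1, pot, ← integral_sub i0 i1]
    refine integral_mono_ae hb (i0.sub i1) ?_
    filter_upwards [compl_mem_ae_iff.2 (measure_singleton (0:E3))] with y hy
    have hy0 : 0 < ‖y‖ := norm_pos_iff.2 hy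
    simp only [zero_sub, norm_neg]
    by_cases hyx : ‖y‖ ≤ ‖x‖ /2
    · rw [indicator_of_mem (by simpa using hyx), max_eq_left (by linarith)]
      have hf1 : 1 ≤ f y := le_max_of_le_right (by linarith)
      have h3 : 1 / ‖x‖ ≤1 / ‖y‖ - 1 / ‖x‖ := by
        have : 2 / ‖x‖ ≤1 / ‖y‖ := by rw [div_le_div_iff₀ hx0 hy0]; linarith
        have h4 : 2 / ‖x‖ =1 / ‖x‖ +1 / ‖x‖ := by ring
        linarith
      have h5 : 0 <1 / ‖x‖ := by positivity
      calc 1 / ‖x‖ ≤ f y * (1 / ‖y‖ - 1 / ‖x‖) := by nlinarith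
        _ = _ := by ring
    · rw [indicator_of_notMem (by simpa using hyx)]
      exact sub_nonneg.2 (div_le_div_of_nonneg_left (le_max_left _ _) hy0 (le_max_right _ _))
  set e := V /16 with he
  have he0 : 0 < e := by positivity
  set h : ℝ → ℝ := fun t => pot f (t • ee i) + e * t ^2 with hh
  have hl : ∀ t : ℝ, HasDerivAt (fun t : ℝ => t • ee i) (ee i) t := fun t => by
    simpa using (hasDerivAt_id t).smul_const (ee i)
  have d1 : ∀ t, HasDerivAt h (pd (ee i) (pot f) (t • ee i) +2 * e * t) t := fun t => by
    have a1 := ((h2.differentiable (by norm_num) _).hasFDerivAt.comp_hasDerivAt t (hl t))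
    have a2 := ((hasDerivAt_pow 2 t).const_mul e)
    exact (a1.add a2).congr_deriv (by simp [pd]; ring)
  have hpd : ContDiff ℝ 1 (pd (ee i) (pot f)) := by exact_mod_cast cd_pd (n := 1) (by exact_mod_cast h2) (ee i)
  have d2 : HasDerivAt (deriv h) (dd [ee i, ee i] (pot f) 0 +2 * e) 0 := by
    rw [show deriv h = fun t => pd (ee i) (pot f) (t • ee i) +2 * e * t from funext fun t => (d1 t).deriv]
    have a1 := ((hpd.differentiable (by norm_num) _).hasFDerivAt.comp_hasDerivAt 0 (hl 0))
    have a2 := ((hasDerivAt_id (0:ℝ)).const_mul (2 * e))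
    exact (a1.add a2).congr_deriv (by simp [pd, dd])
  have hlt : ∀ t : ℝ, t ≠0 → |t| ≤1 → h t < h 0 := fun t ht ht1 => by
    have hn : ‖t • ee i‖ = |t| := by rw [norm_smul, norm_ee]; simp
    have := hdrop (t • ee i) (by rw [← norm_pos_iff, hn]; positivity) (by rw [hn]; exact ht1)
    rw [hn, sq_abs] at this
    simp only [hh, zero_smul]
    have : 0 < t ^2 := by positivity
    nlinarith
  have hmax : IsLocalMax h 0 := by
    filter_upwards [closedBall_mem_nhds (0:ℝ) one_pos] with t ht
    rcases eq_or_ne t 0 with rfl | h0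
    · exact le_rfl
    · exact (hlt t h0 (by simpa using ht)).le
  have hmin : IsLocalMin h 0 := isLocalMin_of_deriv_deriv_pos (by rw [d2.deriv]; linarith) hmax.deriv_eq_zero
    (d1 0).continuousAt
  obtain ⟨δ, hδ, hb⟩ := Metric.eventually_nhds_iff.1 hmin
  have := hb (y := min (δ /2) 1) (by
    rw [Real.dist_eq, sub_zero, abs_of_pos (by positivity)]; exact (min_le_left _ _).trans_lt (by linarith))
  have := hlt (min (δ /2) 1) (by positivity) (by rw [abs_of_pos (by positivity)]; exact min_le_right _ _)
  linarith

structure LEm (R n c : ℝ) (H H' : ℝ → ℝ) (ρ : E3 → ℝ) : Prop where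
  R0 : 0 < R
  n3 : n ≠3
  n1 : 1 < n
  hH : ∀ s, HasDerivAt H (H' s) s
  cH : Continuous H'
  H0 : ∀ s ≤0, H s =0
  H0' : ∀ s ≤0, H' s =0
  Hp : ∀ s, 0 < s → 0 < H s
  Hn : ∀ s, 0 ≤ H' s
  hom : ∀ s, s * H' s = n * H s
  rad : ∀ x y : E3, ‖x‖ = ‖y‖ → ρ x = ρ y
  eq : ∀ x, ρ x = H (pot ρ x + c)
  pos : ∀ x, 0 < ρ x ↔ ‖x‖ < R
  c1 : ContDiff ℝ 1 ρ

namespace LEm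
variable {R n c : ℝ} {H H' : ℝ → ℝ} {ρ : E3 → ℝ}

lemma nn (h : LEm R n c H H' ρ) (x : E3) : 0 ≤ ρ x := by
  rw [h.eq]
  rcases le_or_gt (pot ρ x + c) 0 with h' | h'
  · rw [h.H0 _ h']
  · exact (h.Hp _ h').le

lemma out (h : LEm R n c H H' ρ) {x : E3} (hx : R ≤ ‖x‖) : ρ x =0 :=
  le_antisymm (not_lt.1 fun h' => not_lt.2 hx ((h.pos x).1 h')) (h.nn x)

lemma den (h : LEm R n c H H' ρ) : ∃ L, Den R L ρ := by
  obtain ⟨B, hB⟩ := (isCompact_closedBall (0:E3) R).exists_bound_of_continuousOn h.c1.continuous.continuousOn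
  refine ⟨|B|, h.c1.continuous.measurable, fun x => ?_, fun x hx => h.out hx.le⟩
  by_cases hx : ‖x‖ ≤ R
  · exact (hB x (by simpa using hx)).trans (le_abs_self B)
  · rw [h.out (not_le.1 hx).le]; simp

end LEm

def LEm.q (c : ℝ) (H' : ℝ → ℝ) (ρ : E3 → ℝ) (x : E3) : ℝ := H' (pot ρ x + c)

namespace LEm
variable {R n c : ℝ} {H H' : ℝ → ℝ} {ρ : E3 → ℝ}

lemma pc1 (h : LEm R n c H H' ρ) : ContDiff ℝ 1 (pot ρ) := pot_c1 h.den.choose_spec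

lemma qc (h : LEm R n c H H' ρ) : Continuous (q c H' ρ) := h.cH.comp (h.pc1.continuous.add_const c)

lemma q0 (h : LEm R n c H H' ρ) {x : E3} (hx : R ≤ ‖x‖) : q c H' ρ x =0 :=
  h.H0' _ (not_lt.1 fun h' => (h.Hp _ h').ne' (by rw [← h.eq, h.out hx]))

lemma prad (h : LEm R n c H H' ρ) {x y : E3} (hxy : ‖x‖ = ‖y‖) : pot ρ x = pot ρ y := by
  obtain ⟨A, rfl⟩ := exists_rot hxy
  rw [← pot_rot]
  exact congrArg (fun f => pot f x) (funext fun z => h.rad _ _ (A.norm_map z).symm)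

lemma qrad (h : LEm R n c H H' ρ) {x y : E3} (hxy : ‖x‖ = ‖y‖) : q c H' ρ x = q c H' ρ y := by rw [q, q, h.prad hxy]

lemma qd (h : LEm R n c H H' ρ) : ∃ L, Den R L (q c H' ρ) := by
  obtain ⟨B, hB⟩ := (isCompact_closedBall (0:E3) R).exists_bound_of_continuousOn h.qc.continuousOn
  refine ⟨|B|, h.qc.measurable, fun x => ?_, fun x hx => h.q0 hx.le⟩
  by_cases hx : ‖x‖ ≤ R
  · exact (hB x (by simpa using hx)).trans (le_abs_self B)
  · rw [h.q0 (not_le.1 hx).le]; simp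

lemma qv (h : LEm R n c H H' ρ) {v : E3 → ℝ} (hv : Continuous v) : ∃ L, Den R L (fun x => q c H' ρ x * v x) :=
  h.qd.choose_spec.mulc hv

lemma fd (h : LEm R n c H H' ρ) (x : E3) : fderiv ℝ ρ x = q c H' ρ x • fderiv ℝ (pot ρ) x := by
  have := (h.hH (pot ρ x + c)).comp_hasFDerivAt x (((h.pc1.differentiable (by norm_num)) x).hasFDerivAt.add_const c)
  exact (this.congr_of_eventuallyEq (Eventually.of_forall h.eq)).fderiv

lemma mass_pos (h : LEm R n c H H' ρ) : 0 < ∫ x, ρ x := by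
  have hi := h.den.choose_spec.int
  rw [integral_pos_iff_support_of_nonneg h.nn hi]
  refine (measure_ball_pos volume (0:E3) h.R0).trans_le (measure_mono fun x hx => ?_)
  exact ((h.pos x).2 (by simpa using hx)).ne'

lemma fd_bd (h : LEm R n c H H' ρ) : ∃ B, ∀ x, ‖fderiv ℝ ρ x‖ ≤ B := by
  obtain ⟨C, -, hC⟩ := pot_bd1 R
  obtain ⟨L, hL⟩ := h.den
  obtain ⟨Q, hQ⟩ := h.qd
  refine ⟨Q * (C * L), fun x => ?_⟩
  rw [h.fd, norm_smul]
  exact mul_le_mul (hQ.bd x) (hC ρ L hL x) (norm_nonneg _) hQ.nn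

lemma mu0 (h : LEm R n c H H' ρ) {v : E3 → ℝ} {μ : ℝ} (hc : Continuous v) (hv : ∀ x, v x = pot (fun y => q c H' ρ y * v y) x + μ)
    (hm : ∫ x, q c H' ρ x * v x =0) : μ =0 := by
  obtain ⟨L, hL⟩ := h.den
  obtain ⟨L1, hL1⟩ := h.qv hc
  obtain ⟨C, hC, hCb⟩ := pot_bd1 R
  obtain ⟨B, hB⟩ := h.fd_bd
  have hR := h.R0
  have hR2 : Den (2 * R) 1 ((closedBall (0:E3) (2 * R)).indicator fun _ => 1) := by
    refine ⟨measurable_const.indicator measurableSet_closedBall, fun x => ?_, fun x hx => ?_⟩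
    · simp only [indicator]; split_ifs <;> simp
    · rw [indicator_of_notMem]; simpa using hx
  obtain ⟨L2, hL2⟩ := hR2.mulc hc
  obtain ⟨L3, hL3⟩ := hL1.abs.mulc continuous_norm
  obtain ⟨L4, hL4⟩ := hL2.abs.mulc continuous_norm
  obtain ⟨L5, hL5⟩ := hL1.mulc h.pc1.continuous
  obtain ⟨L6, hL6⟩ := hL2.mulc h.c1.continuous
  have hJ := dint hL1.meas continuous_id h.pc1 (hCb ρ L hL) hL3.int hL5.int
  have hI := dint hL2.meas continuous_id h.c1 hB hL4.int hL6.int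
  set v1 : E3 → ℝ := fun x => (closedBall (0:E3) (2 * R)).indicator (fun _ => 1) x * v x with hv1
  have hv1e : ∀ x, ‖x‖ ≤2 * R → v1 x = v x := fun x hx => by
    simp only [hv1]; rw [indicator_of_mem (by simpa using hx), one_mul]
  have hD : ∫ y, v1 y * fderiv ℝ ρ y (id y) = ∫ y, q c H' ρ y * v y * fderiv ℝ (pot ρ) y (id y) := by
    congr 1; ext y
    rw [h.fd]; simp only [_root_.smul_apply, smul_eq_mul]
    by_cases hy : ‖y‖ ≤2 * R
    · rw [hv1e y hy]; ring
    · rw [h.q0 (by linarith)]; ring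
  rw [hD] at hI
  set D := ∫ y, q c H' ρ y * v y * fderiv ℝ (pot ρ) y (id y)
  set M := ∫ x, ρ x with hM
  have hsc : ∀ t : ℝ, |t| <1 /2 → ∫ y, q c H' ρ y * v y * pot ρ (y + t • id y) =
      (1 + t) ^2 * (∫ y, v1 y * ρ (y + t • id y)) - μ * M * (1 + t)⁻¹ := fun t ht => by
    set s := 1 + t with hs
    have hs0 : 1 /2 < s := by linarith [(abs_lt.1 ht).1]
    have e1 : ∀ y : E3, y + t • id y = s • y := fun y => by rw [hs, add_smul, one_smul]; rfl
    simp only [e1]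
    have e2 : ∀ x, pot ρ (s • x) = s ^2 * pot (fun y => ρ (s • y)) x := fun x => by
      have := Measure.integral_comp_smul (volume : Measure E3) (fun y => ρ y / ‖s • x - y‖) s
      simp only [finrank_euclideanSpace, Fintype.card_fin, ← smul_sub, norm_smul] at this
      rw [Real.norm_of_nonneg (by linarith), abs_of_pos (by positivity)] at this
      have e3 : (∫ y, ρ (s • y) / (s * ‖x - y‖)) = s⁻¹ * pot (fun y => ρ (s • y)) x := by
        rw [pot, ← integral_const_mul]; congr 1; ext y; rw [div_mul_eq_div_div, inv_mul_eq_div]; ring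
      rw [e3, smul_eq_mul] at this
      have hp : pot ρ (s • x) = ∫ y, ρ y / ‖s • x - y‖ := rfl
      rw [hp]
      field_simp at this
      linarith
    have hds : Den (2 * R) L (fun y => ρ (s • y)) := by
      refine ⟨hL.meas.comp (by fun_prop), fun x => hL.bd _, fun x hx => hL.supp _ ?_⟩
      rw [norm_smul, Real.norm_of_nonneg (by linarith)]; nlinarith
    have e4 : ∫ y, ρ (s • y) = (s ^3)⁻¹ * M := by
      rw [Measure.integral_comp_smul]; simp [abs_of_pos (show 0 < s by linarith), hM]
    obtain ⟨L7, hL7⟩ := hds.mulc hc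
    calc ∫ y, q c H' ρ y * v y * pot ρ (s • y)
        = s ^2 * ∫ y, q c H' ρ y * v y * pot (fun y => ρ (s • y)) y := by
          rw [← integral_const_mul]; congr 1; ext y; rw [e2]; ring
      _ = s ^2 * ∫ y, ρ (s • y) * pot (fun y => q c H' ρ y * v y) y := by rw [pot_symm hL1 hds]
      _ = s ^2 * ((∫ y, ρ (s • y) * v y) - ∫ y, μ * ρ (s • y)) := by
          rw [← integral_sub hL7.int (hds.int.const_mul μ)]; congr 2; ext y; rw [hv y]; ring
      _ = _ := by
          have e5 : ∫ y, ρ (s • y) * v y = ∫ y, v1 y * ρ (s • y) := by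
            congr 1; ext y
            by_cases hy : ‖y‖ ≤2 * R
            · rw [hv1e y hy, mul_comm]
            · rw [hds.supp y (not_le.1 hy)]; simp
          rw [integral_const_mul, e4, e5]; field_simp
  have h1t : HasDerivAt (fun t : ℝ => 1 + t) 1 0 := (hasDerivAt_id 0).const_add 1
  have hI2 := ((h1t.pow 2).mul hI).sub ((h1t.inv (by norm_num)).const_mul (μ * M))
  have hu := hJ.unique (hI2.congr_of_eventuallyEq (by
    filter_upwards [ball_mem_nhds (0:ℝ) (by norm_num : (0:ℝ) <1 /2)] with t ht
    simpa using hsc t (by simpa using ht)))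
  have h00 := hsc 0 (by norm_num)
  have hIv : ∫ y, v1 y * ρ y = ∫ y, ρ y * v y := by
    congr 1; ext y
    by_cases hy : ‖y‖ ≤2 * R
    · rw [hv1e y hy, mul_comm]
    · rw [h.out (by linarith)]; simp
  simp [hIv] at hu h00
  have hn : ∫ y, q c H' ρ y * v y * pot ρ y = n * ∫ y, ρ y * v y := by
    have : ∫ y, q c H' ρ y * v y * (pot ρ y + c) = ∫ y, q c H' ρ y * v y * pot ρ y := by
      simp only [mul_add]
      rw [integral_add hL5.int (hL1.int.mul_const c), integral_mul_const, hm]; ring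
    rw [← this, ← integral_const_mul]; congr 1; ext y
    have := h.hom (pot ρ y + c)
    rw [← h.eq] at this
    rw [q]; linear_combination v y * this
  rw [hn] at h00
  have hM0 : M ≠0 := h.mass_pos.ne'
  set I := ∫ y, ρ y * v y
  have h3 : (n - 3) * I =0 := by linarith
  have hI0 : I =0 := (mul_eq_zero.1 h3).resolve_left (sub_ne_zero.2 h.n3)
  have : μ * M =0 := by rw [hI0] at h00; linarith
  exact (mul_eq_zero.1 this).resolve_right hM0

lemma rad0 (h : LEm R n c H H' ρ) {v : E3 → ℝ} (hc : Continuous v) (hv : ∀ x, v x = pot (fun y => q c H' ρ y * v y) x)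
    (hm : ∫ x, q c H' ρ x * v x =0) (hr : ∀ x y : E3, ‖x‖ = ‖y‖ → v x = v y) (x : E3) : v x =0 := by
  obtain ⟨L, hL⟩ := h.qv hc
  obtain ⟨Q, hQ⟩ := h.qd
  have hR := h.R0
  have hrad : ∀ x y : E3, ‖x‖ = ‖y‖ → q c H' ρ x * v x = q c H' ρ y * v y := fun x y hxy => by
    rw [h.qrad hxy, hr x y hxy]
  set V := (volume : Measure E3).real (closedBall 0 R)
  have hV : 0 ≤ V := measureReal_nonneg
  have key : ∀ a m : ℝ, 0 < a → 0 ≤ m → ∀ x : E3, a ≤ ‖x‖ → ∀ b, ‖x‖ ≤ b → (∀ y : E3, b < ‖y‖ → v y =0) →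
      (∀ y : E3, ‖x‖ ≤ ‖y‖ → ‖y‖ ≤ b → |v y| ≤ m) → |v x| ≤ Q * m * ((b - ‖x‖) / a ^2) * V := by
    intro a m ha hm0 x hx b hb hvb hvm
    have hx0 : 0 < ‖x‖ := ha.trans_le hx
    have i1 : Integrable (fun y => q c H' ρ y * v y / max ‖x‖ ‖y‖) := by
      have hmm : Measurable fun y => q c H' ρ y * v y / max ‖x‖ ‖y‖ := by have := hL.meas; fun_prop
      refine (hL.int.norm.const_mul (1 / ‖x‖)).mono' hmm.aestronglyMeasurable (Eventually.of_forall fun y => ?_)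
      rw [norm_div, one_div, inv_mul_eq_div, Real.norm_of_nonneg (le_max_of_le_left (norm_nonneg x))]
      exact div_le_div_of_nonneg_left (norm_nonneg _) hx0 (le_max_left _ _)
    have e : v x = ∫ y, (q c H' ρ y * v y / max ‖x‖ ‖y‖ - q c H' ρ y * v y * (1 / ‖x‖)) := by
      rw [integral_sub i1 (hL.int.mul_const _), integral_mul_const, hm, ← shell hL hrad, ← hv]; ring
    have hK : 0 ≤ Q * m * ((b - ‖x‖) / a ^2) :=
      mul_nonneg (mul_nonneg hQ.nn hm0) (div_nonneg (by linarith) (by positivity))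
    rw [e, ← Real.norm_eq_abs]
    refine (norm_integral_le_integral_norm _).trans ((integral_mono (i1.sub (hL.int.mul_const _)).norm
      (ball_int R (Q * m * ((b - ‖x‖) / a ^2)) 0) fun y => ?_).trans ?_)
    · change ‖q c H' ρ y * v y / max ‖x‖ ‖y‖ - q c H' ρ y * v y * (1 / ‖x‖)‖ ≤ _
      by_cases hyR : ‖y‖ ≤ R
      · rw [indicator_of_mem (by simpa using hyR)]
        rcases le_or_gt ‖y‖ ‖x‖ with hy | hy
        · rw [max_eq_left hy, mul_one_div, sub_self, norm_zero]; exact hK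
        · by_cases hyb : ‖y‖ ≤ b
          · rw [max_eq_right hy.le]
            have e2 : q c H' ρ y * v y / ‖y‖ - q c H' ρ y * v y * (1 / ‖x‖) =
              q c H' ρ y * v y * ((‖x‖ - ‖y‖) / (‖x‖ * ‖y‖)) := by
              have : ‖y‖ ≠0 := (hx0.trans hy).ne'
              field_simp
            rw [e2, norm_mul, norm_mul]
            refine mul_le_mul (mul_le_mul (hQ.bd y) (hvm y hy.le hyb) (norm_nonneg _) hQ.nn) ?_ (norm_nonneg _)
              (mul_nonneg hQ.nn hm0)
            rw [norm_div, Real.norm_of_nonneg (by positivity : 0 ≤ ‖x‖ * ‖y‖), Real.norm_eq_abs, abs_sub_comm,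
              abs_of_pos (by linarith)]
            exact div_le_div₀ (by linarith) (by linarith) (by positivity) (by nlinarith)
          · rw [hvb y (not_le.1 hyb)]; simpa using hK
      · rw [hL.supp y (not_le.1 hyR), indicator_of_notMem (by simpa using hyR)]; simp
    · rw [integral_indicator measurableSet_closedBall]; simp [V, mul_comm]
  have hsub : ∀ a : ℝ, 0 < a → ∀ x : E3, a < ‖x‖ → v x =0 := by
    intro a ha
    set T := {b : ℝ | a ≤ b ∧ ∀ y : E3, b < ‖y‖ → v y =0} with hT
    have hbd : BddBelow T := ⟨a, fun b hb => hb.1⟩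
    have hne : T.Nonempty := by
      refine ⟨max a R, le_max_left _ _, fun y hy => ?_⟩
      have hyR : R < ‖y‖ := (le_max_right _ _).trans_lt hy
      rw [hv, pot_out hL hrad hyR.le, hm, zero_div]
    set b := sInf T with hb
    have hab : a ≤ b := le_csInf hne fun b hb => hb.1
    have hvb : ∀ y : E3, b < ‖y‖ → v y =0 := fun y hy => by
      obtain ⟨b', hb', h'⟩ := exists_lt_of_csInf_lt hne hy
      exact hb'.2 y h'
    by_contra! hcon
    have hab' : a < b := by
      refine lt_of_le_of_ne hab fun hh => ?_
      obtain ⟨x, hx, hx'⟩ := hcon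
      exact hx' (hvb x (hh ▸ hx))
    obtain ⟨δ, hδ, hδ1⟩ : ∃ δ > 0, Q * (δ / a ^2) * V ≤1 /2 := by
      refine ⟨a ^2 / (2 * (Q * V +1)), by have := hQ.nn; positivity, ?_⟩
      have := mul_nonneg hQ.nn hV
      field_simp
      nlinarith
    set b' := max a (b - δ) with hb'
    have hb'b : b' < b := max_lt hab' (by linarith)
    have hb'T : b' ∈ T := by
      refine ⟨le_max_left _ _, fun y hy => ?_⟩
      by_contra hvy
      obtain ⟨z, hz, hzm⟩ := ((isCompact_closedBall (0:E3) b).inter_right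
        (isClosed_le continuous_const continuous_norm : IsClosed {w : E3 | ‖y‖ ≤ ‖w‖})).exists_isMaxOn
        (f := fun w => |v w|) ⟨y, by simpa using not_lt.1 fun h' => hvy (hvb y h'), le_refl ‖y‖⟩
        (by fun_prop)
      have hz1 : ‖z‖ ≤ b := by simpa using hz.1
      have hz2 : ‖y‖ ≤ ‖z‖ := hz.2
      have h1 := key a |v z| ha (abs_nonneg _) z (by linarith [le_max_left a (b - δ)]) b hz1 hvb
        fun w hw hwb => hzm ⟨by simpa using hwb, show ‖y‖ ≤ ‖w‖ by linarith⟩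
      have h2 : |v y| ≤ |v z| := hzm ⟨by simpa using not_lt.1 fun h' => hvy (hvb y h'), le_refl ‖y‖⟩
      have h3 : Q * |v z| * ((b - ‖z‖) / a ^2) * V ≤ |v z| * (Q * (δ / a ^2) * V) := by
        have : (b - ‖z‖) / a ^2 ≤ δ / a ^2 :=
          div_le_div_of_nonneg_right (by linarith [le_max_right a (b - δ)]) (by positivity)
        have h4 : 0 ≤ Q * |v z| := mul_nonneg hQ.nn (abs_nonneg _)
        calc Q * |v z| * ((b - ‖z‖) / a ^2) * V ≤ Q * |v z| * (δ / a ^2) * V := by gcongr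
          _ = _ := by ring
      have h5 : 0 < |v y| := abs_pos.2 hvy
      nlinarith [abs_nonneg (v z)]
    exact absurd (csInf_le hbd hb'T) (not_le.2 hb'b)
  have h0 : ∀ x, x ≠0 → v x =0 := fun x hx => hsub (‖x‖ /2) (by positivity) x (by have := norm_pos_iff.2 hx; linarith)
  rcases eq_or_ne x 0 with rfl | hx
  · have : v = fun _ => 0 := hc.ext_on (dense_compl_singleton (0:E3)) continuous_const fun x hx => h0 x hx
    rw [this]
  · exact h0 x hx

end LEm

def rfl3 (e : E3) : E3 ≃ₗᵢ[ℝ] E3 := Submodule.reflection (ℝ ∙ e)ᗮ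

lemma rfl3_apply {e : E3} (he : ‖e‖ =1) (y : E3) : rfl3 e y = y - (2 * inner ℝ e y) • e := by
  rw [rfl3, Submodule.reflection_orthogonal_apply, Submodule.reflection_singleton_apply]
  simp only [RCLike.ofReal_real_eq_id, id, he]
  rw [two_smul, ← add_smul]; simp only [one_pow, div_one, ← two_mul]; rw [neg_sub]

lemma rfl3_in {e : E3} (he : ‖e‖ =1) (y : E3) : inner ℝ e (rfl3 e y) = - inner ℝ e y := by
  rw [rfl3_apply he, inner_sub_right, inner_smul_right, real_inner_self_eq_norm_sq, he]; ring

lemma rfl3_rfl3 (e y : E3) : rfl3 e (rfl3 e y) = y := Submodule.reflection_reflection _ _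

def sg (e y : E3) : ℝ := Real.sign (inner ℝ e y)

lemma sg_meas (e : E3) : Measurable (sg e) := by
  have : Measurable Real.sign := by
    unfold Real.sign
    exact Measurable.ite measurableSet_Iio measurable_const (Measurable.ite measurableSet_Ioi measurable_const measurable_const)
  exact this.comp (by fun_prop)

lemma sg_cases (e y : E3) : (0 < inner ℝ e y ∧ sg e y =1) ∨ (inner ℝ e y =0 ∧ sg e y =0) ∨ (inner ℝ e y <0 ∧ sg e y = -1) := by
  rcases lt_trichotomy (inner ℝ e y) 0 with h | h | h
  · exact .inr (.inr ⟨h, Real.sign_of_neg h⟩)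
  · exact .inr (.inl ⟨h, by rw [sg, h, Real.sign_zero]⟩)
  · exact .inl ⟨h, Real.sign_of_pos h⟩

lemma sg_rfl {e : E3} (he : ‖e‖ =1) (y : E3) : sg e (rfl3 e y) = - sg e y := by
  rw [sg, rfl3_in he, Real.sign_neg]; rfl

lemma sg_neg (e y : E3) : sg e (-y) = - sg e y := by rw [sg, inner_neg_right, Real.sign_neg]; rfl

lemma sg_le (e y : E3) : |sg e y| ≤1 := by rcases sg_cases e y with h | h | h <;> rw [h.2] <;> norm_num

lemma Den.sg {A L f} (hf : Den A L f) (e : E3) : Den A L (fun y => sg e y * f y) :=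
  ⟨(sg_meas e).mul hf.meas, fun x => by
    rw [abs_mul]; nlinarith [hf.bd x, sg_le e x, abs_nonneg (f x), abs_nonneg (_root_.sg e x)],
    fun x hx => by simp [hf.supp x hx]⟩

lemma pot_sub {A L f B M g} (hf : Den A L f) (hg : Den B M g) (x : E3) :
    pot (fun y => f y - g y) x = pot f x - pot g x := by
  rw [pot, pot, pot, ← integral_sub (pot_int hf x) (pot_int hg x)]
  congr 1; ext y; ring

lemma half_pos' {e : E3} (he : ‖e‖ =1) {A L g} (hg : Den A L g) (g0 : ∀ x, 0 ≤ g x) (gs : ∀ x, g (rfl3 e x) = g x)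
    (x : E3) : 0 ≤ sg e x * pot (fun y => sg e y * g y) x ∧
      (sg e x ≠0 → sg e x * pot (fun y => sg e y * g y) x =0 → ∀ᵐ y, sg e y * g y =0) := by
  set k : E3 → ℝ := fun y => sg e x * sg e y * (1 / ‖x - y‖ - 1 / ‖x - rfl3 e y‖) with hk
  have hsq : ∀ y, ‖x - rfl3 e y‖ ^2 = ‖x - y‖ ^2 +4 * (inner ℝ e x * inner ℝ e y) := fun y => by
    have h1 : inner ℝ (x - y) e = inner ℝ e x - inner ℝ e y := by rw [real_inner_comm, inner_sub_right]
    rw [rfl3_apply he, show x - (y - (2 * inner ℝ e y) • e) = (x - y) + (2 * inner ℝ e y) • e by abel,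
      norm_add_sq_real, norm_smul, he, real_inner_smul_right, h1, mul_one, Real.norm_eq_abs, sq_abs]; ring
  have hkp : ∀ y, y ≠ x → y ≠ rfl3 e x → (sg e x * sg e y ≠0 → 0 < k y) ∧ 0 ≤ k y := fun y hy hy' => by
    have hd : 0 < ‖x - y‖ := norm_pos_iff.2 (sub_ne_zero.2 hy.symm)
    have hd' : 0 < ‖x - rfl3 e y‖ := norm_pos_iff.2 (sub_ne_zero.2 fun h => hy' (by rw [h, rfl3_rfl3]))
    have h2 := hsq y
    have pos : 0 < inner ℝ e x * inner ℝ e y → 0 <1 / ‖x - y‖ - 1 / ‖x - rfl3 e y‖ := fun h => by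
      have : ‖x - y‖ < ‖x - rfl3 e y‖ := lt_of_pow_lt_pow_left₀ 2 (norm_nonneg _) (by rw [h2]; linarith)
      exact sub_pos.2 (one_div_lt_one_div_of_lt hd this)
    have neg : inner ℝ e x * inner ℝ e y <0 → 1 / ‖x - y‖ - 1 / ‖x - rfl3 e y‖ <0 := fun h => by
      have : ‖x - rfl3 e y‖ < ‖x - y‖ := lt_of_pow_lt_pow_left₀ 2 (norm_nonneg _) (by rw [h2]; linarith)
      exact sub_neg.2 (one_div_lt_one_div_of_lt hd' this)
    simp only [hk]
    rcases sg_cases e x with h | h | h <;> rcases sg_cases e y with h' | h' | h' <;> rw [h.2, h'.2] <;> norm_num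
    · have := pos (mul_pos h.1 h'.1); norm_num at this; exact ⟨this, this.le⟩
    · have := neg (mul_neg_of_pos_of_neg h.1 h'.1); norm_num at this; exact ⟨this, this.le⟩
    · have := neg (mul_neg_of_neg_of_pos h.1 h'.1); norm_num at this; exact ⟨this, this.le⟩
    · have := pos (mul_pos_of_neg_of_neg h.1 h'.1); norm_num at this; exact ⟨this, this.le⟩
  have hf := hg.sg e
  have hS : ∀ y, ‖rfl3 e x - y‖ = ‖x - rfl3 e y‖ := fun y => by
    rw [← (rfl3 e).norm_map, map_sub, rfl3_rfl3]
  have hneg : pot (fun y => sg e y * g y) (rfl3 e x) = - pot (fun y => sg e y * g y) x := by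
    rw [← pot_rot, pot, pot, ← integral_neg]
    congr 1; ext y; rw [sg_rfl he, gs]; ring
  have hI1 := pot_int hf x
  have hI2 := pot_int hf (rfl3 e x)
  have hgk : ∀ y, g y * k y = sg e x * (sg e y * g y / ‖x - y‖ - sg e y * g y / ‖rfl3 e x - y‖) := fun y => by
    rw [hS]; simp only [hk]; ring
  have hint : Integrable fun y => g y * k y := by
    simp_rw [hgk]; exact (hI1.sub hI2).const_mul _
  have heq : ∫ y, g y * k y =2 * (sg e x * pot (fun y => sg e y * g y) x) := by
    simp_rw [hgk]
    rw [integral_const_mul, integral_sub hI1 hI2]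
    have e1 : ∫ y, sg e y * g y / ‖rfl3 e x - y‖ = - pot (fun y => sg e y * g y) x := hneg
    rw [e1]; simp only [pot]; ring
  have hae : ∀ᵐ y : E3, y ≠ x ∧ y ≠ rfl3 e x := by
    have h1 : ∀ z : E3, ∀ᵐ y : E3, y ≠ z := fun z => by simp [ae_iff]
    filter_upwards [h1 x, h1 (rfl3 e x)] with y a b using ⟨a, b⟩
  have hnn : 0 ≤ᵐ[volume] fun y => g y * k y := by
    filter_upwards [hae] with y hy using mul_nonneg (g0 y) (hkp y hy.1 hy.2).2
  refine ⟨?_, fun hs h0 => ?_⟩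
  · have := integral_nonneg_of_ae hnn
    linarith
  · rw [h0, mul_zero, integral_eq_zero_iff_of_nonneg_ae hnn hint] at heq
    filter_upwards [heq, hae] with y h1 h2
    by_contra h3
    have h4 := (mul_ne_zero_iff.1 h3)
    exact (mul_pos (lt_of_le_of_ne (g0 y) h4.2.symm) ((hkp y h2.1 h2.2).1 (mul_ne_zero hs h4.1))).ne' h1

lemma pot_ae {f g : E3 → ℝ} (h : f =ᵐ[volume] g) (x : E3) : pot f x = pot g x :=
  integral_congr_ae (by filter_upwards [h] with y hy; rw [hy])

namespace LEm
variable {R n c : ℝ} {H H' : ℝ → ℝ} {ρ : E3 → ℝ}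

lemma pq (h : LEm R n c H H' ρ) (e x : E3) : pd e (pot ρ) x = pot (fun y => q c H' ρ y * pd e (pot ρ) y) x := by
  obtain ⟨L, hL⟩ := h.den
  obtain ⟨B, hB⟩ := h.fd_bd
  have hR := h.R0
  have hD : Den (R + ‖e‖) 1 ((closedBall (0:E3) (R + ‖e‖)).indicator fun _ => 1) := by
    refine ⟨measurable_const.indicator measurableSet_closedBall, fun x => ?_, fun x hx => ?_⟩
    · simp only [indicator]; split_ifs <;> simp
    · rw [indicator_of_notMem]; simpa using hx
  have hgi := pot_int hD x
  set g : E3 → ℝ := fun y => (closedBall (0:E3) (R + ‖e‖)).indicator (fun _ => 1) y / ‖x - y‖ with hg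
  have hge : ∀ y (t : ℝ), |t| ≤1 → ρ (y + t • e) / ‖x - y‖ = g y * ρ (y + t • e) := fun y t ht => by
    by_cases hy : ‖y‖ ≤ R + ‖e‖
    · simp only [hg]; rw [indicator_of_mem (by simpa using hy)]; ring
    · have h1 := norm_sub_le (y + t • e) (t • e)
      rw [add_sub_cancel_right, norm_smul, Real.norm_eq_abs] at h1
      rw [h.out (by nlinarith [norm_nonneg e])]; simp
  have hd := dint (w := fun _ => e) (hD.meas.div (by fun_prop)) continuous_const h.c1 hB (hgi.norm.mul_const ‖e‖)
    (by refine (pot_int hL x).congr (Eventually.of_forall fun y => ?_); simpa using hge y 0 (by simp))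
  have h2 : (fun t : ℝ => pot ρ (x + t • e)) =ᶠ[𝓝 0] fun t => ∫ y, g y * ρ (y + t • e) := by
    filter_upwards [Metric.closedBall_mem_nhds (0:ℝ) one_pos] with t ht
    rw [pot, ← integral_add_right_eq_self _ (t • e)]
    congr 1; ext y
    rw [add_sub_add_right_eq_sub, hge y t (by simpa using ht)]
  have h3 : HasDerivAt (fun t : ℝ => pot ρ (x + t • e)) (pd e (pot ρ) x) 0 := by
    have h1 : HasDerivAt (fun t : ℝ => x + t • e) e 0 := by
      simpa using ((hasDerivAt_id (0:ℝ)).smul_const e).const_add x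
    have h4 : HasFDerivAt (pot ρ) (fderiv ℝ (pot ρ) x) (x + (0:ℝ) • e) := by
      simpa using ((h.pc1.differentiable (by norm_num)) x).hasFDerivAt
    exact h4.comp_hasDerivAt 0 h1
  rw [h3.unique (hd.congr_of_eventuallyEq h2), pot]
  congr 1; ext y
  have := hge y 0 (by simp)
  rw [h.fd, _root_.smul_apply, smul_eq_mul, pd]
  by_cases hy : ‖y‖ ≤ R + ‖e‖
  · simp only [Pi.div_apply]; rw [indicator_of_mem (by simpa using hy)]; ring
  · rw [h.q0 (by linarith [norm_nonneg e])]; simp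

lemma pneg (h : LEm R n c H H' ρ) {e x : E3} (hx : 0 ≤ inner ℝ e x) : pd e (pot ρ) x ≤0 := by
  obtain ⟨L, hL⟩ := h.den
  have h1 : HasDerivAt (fun t : ℝ => x + t • e) e 0 := by
    simpa using ((hasDerivAt_id (0:ℝ)).smul_const e).const_add x
  have h4 : HasFDerivAt (pot ρ) (fderiv ℝ (pot ρ) x) (x + (0:ℝ) • e) := by
    simpa using ((h.pc1.differentiable (by norm_num)) x).hasFDerivAt
  have h3 : HasDerivAt (fun t : ℝ => pot ρ (x + t • e)) (pd e (pot ρ) x) 0 := by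
    exact h4.comp_hasDerivAt 0 h1
  refine le_of_tendsto h3.tendsto_slope_zero_right ?_
  filter_upwards [self_mem_nhdsWithin] with t ht
  have ht' : 0 < t := ht
  simp only [zero_add, zero_smul, add_zero, smul_eq_mul]
  refine mul_nonpos_of_nonneg_of_nonpos (inv_nonneg.2 ht'.le) (sub_nonpos.2 (pot_mono hL h.rad h.nn ?_))
  refine le_of_sq_le_sq ?_ (norm_nonneg _)
  rw [norm_add_sq_real, real_inner_smul_right, real_inner_comm]
  have := mul_nonneg ht'.le hx
  nlinarith [sq_nonneg ‖t • e‖]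

lemma refl (h : LEm R n c H H' ρ) {v : E3 → ℝ} (hc : Continuous v) (hv : ∀ x, v x = pot (fun y => q c H' ρ y * v y) x)
    (hev : ∀ x, v (-x) = v x) {e : E3} (he : ‖e‖ =1) (x : E3) : v (rfl3 e x) = v x := by
  set Q := q c H' ρ with hQ
  have hQS : ∀ y, Q (rfl3 e y) = Q y := fun y => h.qrad ((rfl3 e).norm_map y)
  have hQ0 : ∀ y, 0 ≤ Q y := fun y => h.Hn _
  set z : E3 → ℝ := fun y => v y - v (rfl3 e y) with hz
  have hcS : Continuous fun y => v (rfl3 e y) := hc.comp (rfl3 e).continuous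
  have hzc : Continuous z := hc.sub hcS
  obtain ⟨L1, hL1⟩ := h.qv hc
  obtain ⟨L2, hL2⟩ := h.qv hcS
  have hzp : ∀ x, z x = pot (fun y => Q y * z y) x := fun x => by
    have h1 : pot (fun y => Q y * v (rfl3 e y)) x = v (rfl3 e x) := by
      rw [hv (rfl3 e x), ← pot_rot]; simp_rw [hQS]
    have := pot_sub hL1 hL2 x
    rw [← hv, h1] at this
    simp only [hz]; rw [← this]; simp only [mul_sub]; rfl
  have hzS : ∀ y, z (rfl3 e y) = - z y := fun y => by simp only [hz, rfl3_rfl3]; ring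
  have fix : ∀ y, sg e y =0 → rfl3 e y = y := fun y hy => by
    have : inner ℝ e y =0 := by
      rcases sg_cases e y with h | h | h
      · linarith [h.2]
      · exact h.1
      · linarith [h.2]
    rw [rfl3_apply he, this]; simp
  have s2 : ∀ {f : E3 → ℝ}, (∀ y, f (rfl3 e y) = - f y) → ∀ y, sg e y * (sg e y * f y) = f y := fun {f} hf y => by
    rcases sg_cases e y with h | h | h
    · rw [h.2]; ring
    · have := hf y; rw [fix y h.2] at this
      rw [h.2]; linarith
    · rw [h.2]; ring
  have hznz : ∀ y, z (-y) = z y := fun y => by simp only [hz, map_neg, hev]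
  obtain ⟨L3, hL3⟩ := h.qv hzc
  obtain ⟨L4, hL4⟩ := h.qv hzc.abs
  set Φ : E3 → ℝ := fun x => sg e x * pot (fun y => sg e y * (Q y * |z y|)) x with hΦ
  have hpm : ∀ σ : ℝ, |σ| =1 → ∀ x, 0 ≤ Φ x - σ * (sg e x * z x) ∧
      (sg e x ≠0 → Φ x - σ * (sg e x * z x) =0 → ∀ᵐ y, sg e y * (Q y * |z y|) = σ * (Q y * z y)) := fun σ hσ x => by
    have hD : Den R (L4 + |σ| * L3) fun y => Q y * |z y| - σ * (sg e y * (Q y * z y)) := by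
      refine ⟨hL4.meas.sub ((hL3.sg e).meas.const_mul σ), fun y => ?_, fun y hy => ?_⟩
      · refine (abs_sub _ _).trans (add_le_add (hL4.bd y) ?_)
        rw [abs_mul]; exact mll ((hL3.sg e).bd y) (abs_nonneg _)
      · have a := hL4.supp y hy
        have b := hL3.supp y hy
        simp only [← hQ] at a b
        rw [a, b]; simp
    have key : ∀ y, sg e y * (Q y * |z y| - σ * (sg e y * (Q y * z y))) = sg e y * (Q y * |z y|) - σ * (Q y * z y) :=
      fun y => by have := s2 hzS y; linear_combination (-σ * Q y) * this
    have hp := half_pos' he hD (fun y => by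
        have : |σ * (sg e y * z y)| ≤ |z y| := by
          rw [abs_mul, abs_mul, hσ, one_mul]; nlinarith [sg_le e y, abs_nonneg (z y)]
        nlinarith [hQ0 y, le_abs_self (σ * (sg e y * z y))])
      (fun y => by simp only [hQS, hzS, sg_rfl he, abs_neg]; ring) x
    simp_rw [key] at hp
    have hL5 : Den R (|σ| * L3) fun y => σ * (Q y * z y) :=
      ⟨hL3.meas.const_mul σ, fun y => by rw [abs_mul]; exact mll (hL3.bd y) (abs_nonneg _),
        fun y hy => by rw [hL3.supp y hy, mul_zero]⟩
    have hsp : pot (fun y => σ * (Q y * z y)) x = σ * z x := by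
      rw [hzp x, pot, pot, ← integral_const_mul]; congr 1; ext y; ring
    rw [pot_sub (hL4.sg e) hL5, hsp] at hp
    rw [show Φ x - σ * (sg e x * z x) = sg e x * (pot (fun y => sg e y * (Q y * |z y|)) x - σ * z x) by
      simp only [hΦ]; ring]
    refine ⟨hp.1, fun a b => ?_⟩
    filter_upwards [hp.2 a b] with y hy using sub_eq_zero.1 hy
  have habs : ∀ x, |z x| ≤ Φ x := fun x => by
    have a := (hpm 1 (by simp) x).1
    have b := (hpm (-1) (by simp) x).1
    rcases sg_cases e x with hs | hs | hs <;> rw [hs.2] at a b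
    · exact abs_le.2 ⟨by linarith, by linarith⟩
    · have h1 := s2 hzS x; rw [hs.2] at h1
      rw [← h1]; simpa using a
    · exact abs_le.2 ⟨by linarith, by linarith⟩
  set p : E3 → ℝ := fun x => - pd e (pot ρ) x with hp
  have hpc : Continuous p := by
    have := h.pc1.continuous_fderiv (by norm_num)
    exact (this.clm_apply continuous_const).neg
  have hpp : ∀ x, p x = pot (fun y => Q y * p y) x := fun x => by
    simp only [hp]; rw [h.pq e x, pot, pot, ← integral_neg]; congr 1; ext y; ring
  have hps : ∀ x, 0 ≤ sg e x * p x := fun x => by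
    rcases sg_cases e x with hs | hs | hs <;> rw [hs.2]
    · have := h.pneg hs.1.le; simp only [hp]; linarith
    · simp
    · have := h.pneg (e := -e) (x := x) (by rw [inner_neg_left]; linarith)
      simp only [pd, map_neg] at this; simp only [hp, pd]; linarith
  have hpS : ∀ y, p (rfl3 e y) = - p y := fun y => by
    have h0 : pot ρ = pot ρ ∘ rfl3 e := funext fun y => h.prad ((rfl3 e).norm_map y).symm
    have h1 : fderiv ℝ (pot ρ) y = (fderiv ℝ (pot ρ) (rfl3 e y)).comp ((rfl3 e).toContinuousLinearEquiv : E3 →L[ℝ] E3) := by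
      conv_lhs => rw [h0]
      exact (((h.pc1.differentiable (by norm_num)) _).hasFDerivAt.comp y
        ((rfl3 e).toContinuousLinearEquiv : E3 →L[ℝ] E3).hasFDerivAt).fderiv
    have h2 : rfl3 e e = -e := by
      rw [rfl3_apply he, real_inner_self_eq_norm_sq, he]; module
    simp only [hp, pd]
    rw [h1]; simp [h2]
  obtain ⟨L6, hL6⟩ := h.qv hpc
  have hsy := pot_symm hL6 (hL4.sg e)
  simp_rw [← hQ, ← hpp] at hsy
  have hΦd : ∀ y, Q y * p y * pot (fun y => sg e y * (Q y * |z y|)) y = Q y * (sg e y * p y) * Φ y := fun y => by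
    have := s2 hpS y; simp only [hΦ]
    linear_combination (-Q y * pot (fun y => sg e y * (Q y * |z y|)) y) * this
  have hΦc : Continuous (pot (fun y => sg e y * (Q y * |z y|))) := (pot_c1 (hL4.sg e)).continuous
  have hi1 : Integrable fun y => Q y * (sg e y * p y) * Φ y := by
    obtain ⟨L7, hL7⟩ := hL6.mulc hΦc
    exact hL7.int.congr (Eventually.of_forall hΦd)
  have hi2 : Integrable fun y => Q y * (sg e y * p y) * |z y| := by
    obtain ⟨L7, hL7⟩ := (hL4.sg e).mulc hpc
    exact hL7.int.congr (Eventually.of_forall fun y => by simp only [← hQ]; ring)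
  have hz0 : ∫ y, Q y * (sg e y * p y) * (Φ y - |z y|) =0 := by
    simp_rw [mul_sub]
    rw [integral_sub hi1 hi2, ← integral_congr_ae (Eventually.of_forall hΦd), hsy, sub_eq_zero]
    congr 1; ext y; ring
  rw [integral_eq_zero_iff_of_nonneg (fun y => mul_nonneg (mul_nonneg (hQ0 y) (hps y)) (sub_nonneg.2 (habs y)))
    (by simp_rw [mul_sub]; exact hi1.sub hi2)] at hz0
  obtain ⟨x0, hx0, hx1⟩ : ∃ x0, Q x0 * p x0 ≠0 ∧ Q x0 * (sg e x0 * p x0) * (Φ x0 - |z x0|) =0 := by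
    by_contra hcon
    push Not at hcon
    have h1 : (fun y => Q y * p y) =ᵐ[volume] fun _ => 0 := by
      filter_upwards [hz0] with y hy
      by_contra h3; exact hcon y h3 hy
    have h2 : ∀ x, p x =0 := fun x => by rw [hpp, pot_ae h1]; simp [pot]
    have h3 : ∀ t : ℝ, HasDerivAt (fun t : ℝ => pot ρ (t • e)) 0 t := fun t => by
      have h1 : HasDerivAt (fun t : ℝ => t • e) e t := by simpa using (hasDerivAt_id t).smul_const e
      have := ((h.pc1.differentiable (by norm_num)) (t • e)).hasFDerivAt.comp_hasDerivAt t h1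
      have h4 := h2 (t • e); simp only [hp, pd] at h4
      rwa [neg_eq_zero.1 h4] at this
    have h4 := is_const_of_deriv_eq_zero (fun t => (h3 t).differentiableAt) (fun t => (h3 t).deriv) 0 R
    simp only [zero_smul] at h4
    have h5 := h.out (x := R • e) (by rw [norm_smul, he, Real.norm_of_nonneg h.R0.le, mul_one])
    rw [h.eq, ← h4, ← h.eq] at h5
    exact ((h.pos 0).2 (by simpa using h.R0)).ne' h5
  have hsx : sg e x0 ≠0 := fun h0 => hx0 (by
    have := s2 hpS x0; rw [h0] at this; rw [← this]; simp)
  have hΦ0 : Φ x0 - |z x0| =0 := by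
    rcases mul_eq_zero.1 hx1 with h1 | h1
    · exact absurd h1 (by
        have := mul_ne_zero_iff.1 hx0
        exact mul_ne_zero this.1 (mul_ne_zero hsx this.2))
    · exact h1
  obtain ⟨σ, hσ, hσ1⟩ : ∃ σ : ℝ, |σ| =1 ∧ Φ x0 - σ * (sg e x0 * z x0) =0 := by
    have : |z x0| = |sg e x0 * z x0| := by
      rw [abs_mul]
      rcases sg_cases e x0 with hs | hs | hs <;> rw [hs.2]
      · simp
      · exact absurd hs.2 hsx
      · simp
    rcases abs_choice (sg e x0 * z x0) with h1 | h1
    · exact ⟨1, by simp, by rw [one_mul, ← h1, ← this, hΦ0]⟩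
    · exact ⟨-1, by simp, by rw [neg_one_mul, ← h1, ← this, hΦ0]⟩
  have hae := (hpm σ hσ x0).2 hsx hσ1
  have hae2 := ((LinearIsometryEquiv.neg ℝ (E := E3)).measurePreserving.quasiMeasurePreserving.ae hae)
  have hQz : (fun y => Q y * z y) =ᵐ[volume] fun _ => 0 := by
    filter_upwards [hae, hae2] with y h1 h2
    simp only [LinearIsometryEquiv.coe_neg, hznz, sg_neg, show Q (-y) = Q y from h.qrad (norm_neg y)] at h2
    have h3 : σ ≠0 := fun h0 => by rw [h0] at hσ; simp at hσ
    have : σ * (Q y * z y) =0 := by linarith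
    exact (mul_eq_zero.1 this).resolve_left h3
  have := hzp x
  rw [pot_ae hQz] at this
  simp only [pot, zero_div, integral_zero, hz] at this
  linarith

lemma nondeg (h : LEm R n c H H' ρ) {v : E3 → ℝ} {μ : ℝ} (hc : Continuous v) (hv : ∀ x, v x = pot (fun y => q c H' ρ y * v y) x + μ)
    (hev : ∀ x, v (-x) = v x) (hm : ∫ x, q c H' ρ x * v x =0) : (∀ x, v x =0) ∧ μ =0 := by
  have hμ := h.mu0 hc hv hm
  refine ⟨?_, hμ⟩
  have hv' : ∀ x, v x = pot (fun y => q c H' ρ y * v y) x := fun x => by rw [hv x, hμ, add_zero]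
  refine h.rad0 hc hv' hm fun x y hxy => ?_
  by_cases hne : x = y
  · rw [hne]
  have hd : ‖x - y‖ ≠0 := norm_ne_zero_iff.2 (sub_ne_zero.2 hne)
  set e := ‖x - y‖⁻¹ • (x - y) with he
  have he1 : ‖e‖ =1 := by rw [he, norm_smul, norm_inv, norm_norm, inv_mul_cancel₀ hd]
  rw [← h.refl hc hv' hev he1 x]
  congr 1
  have h1 : 2 * inner ℝ e x = ‖x - y‖ := by
    rw [he, real_inner_smul_left, inner_sub_left, real_inner_self_eq_norm_sq]
    have := norm_sub_sq_real x y
    rw [real_inner_comm x y, ← mul_assoc, mul_comm (2:ℝ), mul_assoc, inv_mul_eq_iff_eq_mul₀ hd]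
    rw [hxy] at this ⊢; linarith
  rw [rfl3_apply he1, h1, he, smul_smul, mul_inv_cancel₀ hd]; simp
end LEm

def HH (n C s : ℝ) : ℝ := C * (max s 0) ^ n

lemma HH_cont {n : ℝ} (hn : 0 < n) (C : ℝ) : Continuous (HH n C) :=
  continuous_const.mul ((continuous_id.max continuous_const).rpow_const fun _ => .inr hn.le)

lemma HH_deriv {n : ℝ} (hn : 1 < n) (C s : ℝ) : HasDerivAt (HH n C) (HH (n - 1) (C * n) s) s := by
  have key : ∀ y ≠ (0:ℝ), HasDerivAt (HH n C) (HH (n - 1) (C * n) y) y := fun y hy => by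
    rcases lt_or_gt_of_ne hy with h | h
    · have : HH (n - 1) (C * n) y =0 := by rw [HH, max_eq_right h.le, Real.zero_rpow (by linarith), mul_zero]
      rw [this]
      refine (hasDerivAt_const y (0:ℝ)).congr_of_eventuallyEq ?_
      filter_upwards [gt_mem_nhds h] with t ht
      rw [HH, max_eq_right ht.le, Real.zero_rpow (by linarith), mul_zero]
    · have := ((Real.hasDerivAt_rpow_const (x := y) (p := n) (.inl hy)).const_mul C)
      rw [HH, max_eq_left h.le, mul_assoc]
      refine this.congr_of_eventuallyEq ?_
      filter_upwards [lt_mem_nhds h] with t ht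
      rw [HH, max_eq_left ht.le]
  by_cases h : s =0
  · subst h
    exact hasDerivAt_of_hasDerivAt_of_ne (fun y hy => key y hy) (HH_cont (by linarith) C).continuousAt
      (HH_cont (by linarith) _).continuousAt
  · exact key s h

lemma rpow_hol {β : ℝ} (h0 : 0 < β) (h1 : β ≤1) {a b : ℝ} (ha : 0 ≤ a) (hb : 0 ≤ b) : |a ^ β - b ^ β| ≤ |a - b| ^ β := by
  wlog h : b ≤ a generalizing a b
  · rw [abs_sub_comm, abs_sub_comm a]; exact this hb ha (not_le.1 h).le
  rw [abs_of_nonneg (sub_nonneg.2 h), abs_of_nonneg (sub_nonneg.2 (Real.rpow_le_rpow hb h h0.le))]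
  have := Real.rpow_add_le_add_rpow (sub_nonneg.2 h) hb h0.le h1
  rw [sub_add_cancel] at this; linarith

lemma HH_hol {β : ℝ} (h0 : 0 < β) (C B : ℝ) : ∃ D, 0 ≤ D ∧ ∀ s t, s ≤ B → t ≤ B →
    |HH β C s - HH β C t| ≤ D * |s - t| ^ (min β 1) := by
  rcases le_or_gt β 1 with h | h
  · refine ⟨|C|, abs_nonneg _, fun s t _ _ => ?_⟩
    rw [min_eq_left h, HH, HH, ← mul_sub, abs_mul]
    refine mll ((rpow_hol h0 h (le_max_right _ _) (le_max_right _ _)).trans ?_) (abs_nonneg _)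
    exact Real.rpow_le_rpow (abs_nonneg _) (abs_max_sub_max_le_abs _ _ _) h0.le
  · rw [min_eq_right h.le]
    have hB : 0 ≤ max B 0 := le_max_right _ _
    refine ⟨|C * β| * (max B 0) ^ (β - 1), by positivity, fun s t hs ht => ?_⟩
    have := (convex_Iic B).norm_image_sub_le_of_norm_hasDerivWithin_le (f := HH β C)
      (fun x _ => (HH_deriv h C x).hasDerivWithinAt) (C := |C * β| * (max B 0) ^ (β - 1)) (fun x hx => by
        rw [HH, norm_mul, Real.norm_eq_abs, Real.norm_eq_abs]
        refine mll ?_ (abs_nonneg _)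
        rw [abs_of_nonneg (Real.rpow_nonneg (le_max_right _ _) _)]
        exact Real.rpow_le_rpow (le_max_right _ _) (max_le_max_right _ hx) (by linarith)) ht hs
    simpa using this

lemma LE_data {γ R : ℝ} (hγ1 : 6/5 < γ) (hγ2 : γ <2) (hγ3 : γ ≠4/3) (hR : 0 < R)
    {hent : ℝ → ℝ} (hhent : ∀ s : ℝ, hent s = (γ/(γ - 1)) * s ^ (γ - 1)) {ρ₀ : E3 → ℝ}
    (hradial : ∃ F : ℝ → ℝ, ∀ x : E3, ρ₀ x = F ‖x‖) (hnonneg : ∀ x, 0 ≤ ρ₀ x)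
    (hposball : ∀ x : E3, 0 < ρ₀ x ↔ ‖x‖ < R) (hreg1 : ContDiff ℝ 1 ρ₀)
    (hLaneEmden : ∃ c : ℝ, ∀ x ∈ ball (0:E3) R, hent (ρ₀ x) - pot ρ₀ x = c) :
    ∃ n C c, 1 < n ∧ 0 < C ∧ n - 1 = (2 - γ) / (γ - 1) ∧ (∀ s, 0 < s → hent (HH n C s) = s) ∧
      LEm R n c (HH n C) (HH (n - 1) (C * n)) ρ₀ ∧ ∀ x : E3, R < ‖x‖ → pot ρ₀ x + c <0 := by
  obtain ⟨F, hF⟩ := hradial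
  obtain ⟨c, hc⟩ := hLaneEmden
  have g1 : 0 < γ - 1 := by linarith
  set n := 1 / (γ - 1) with hn
  have hng : (γ - 1) * n =1 := by rw [hn]; field_simp
  have hn1 : 1 < n := by rw [hn, lt_div_iff₀ g1]; linarith
  set C := ((γ - 1) / γ) ^ n with hC
  have hb : 0 < (γ - 1) / γ := div_pos g1 (by linarith)
  have hC0 : 0 < C := Real.rpow_pos_of_pos hb n
  have hent_H : ∀ s, 0 < s → hent (HH n C s) = s := fun s hs => by
    rw [hhent, HH, max_eq_left hs.le, hC, ← Real.mul_rpow hb.le hs.le, ← Real.rpow_mul (by positivity), mul_comm n,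
      hng, Real.rpow_one]
    field_simp
  have hH_ent : ∀ s, 0 < s → HH n C (hent s) = s := fun s hs => by
    have h1 : 0 < s ^ (γ - 1) := Real.rpow_pos_of_pos hs _
    have h2 : 0 ≤ hent s := by rw [hhent]; have : 0 < γ / (γ - 1) := div_pos (by linarith) g1
                               positivity
    rw [HH, max_eq_left h2, hC, ← Real.mul_rpow hb.le h2, hhent,
      show (γ - 1) / γ * (γ / (γ - 1) * s ^ (γ - 1)) = s ^ (γ - 1) by field_simp, ← Real.rpow_mul hs.le, hng, Real.rpow_one]
  have rad : ∀ x y : E3, ‖x‖ = ‖y‖ → ρ₀ x = ρ₀ y := fun x y h => by rw [hF, hF, h]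
  have out : ∀ x : E3, R ≤ ‖x‖ → ρ₀ x =0 := fun x hx =>
    le_antisymm (not_lt.1 fun h' => not_lt.2 hx ((hposball x).1 h')) (hnonneg x)
  obtain ⟨L, hL⟩ : ∃ L, Den R L ρ₀ := by
    obtain ⟨B, hB⟩ := (isCompact_closedBall (0:E3) R).exists_bound_of_continuousOn hreg1.continuous.continuousOn
    refine ⟨|B|, hreg1.continuous.measurable, fun x => ?_, fun x hx => out x hx.le⟩
    by_cases hx : ‖x‖ ≤ R
    · exact (hB x (by simpa using hx)).trans (le_abs_self B)
    · rw [out x (not_le.1 hx).le]; simp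
  have hpc : Continuous (pot ρ₀) := (pot_c1 hL).continuous
  have hentc : Continuous hent := by
    rw [show hent = fun s => (γ/(γ - 1)) * s ^ (γ - 1) from funext hhent]
    exact continuous_const.mul (continuous_id.rpow_const fun _ => .inr g1.le)
  have hcl : ∀ x ∈ closedBall (0:E3) R, hent (ρ₀ x) - pot ρ₀ x = c := by
    have hcl : IsClosed {x : E3 | hent (ρ₀ x) - pot ρ₀ x = c} :=
      isClosed_eq ((hentc.comp hreg1.continuous).sub hpc) continuous_const
    have := hcl.closure_subset_iff.2 (fun x hx => hc x hx : ball (0:E3) R ⊆ _)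
    rwa [closure_ball _ hR.ne'] at this
  set M := ∫ x, ρ₀ x with hM
  have hM0 : 0 < M := by
    rw [hM, integral_pos_iff_support_of_nonneg hnonneg hL.int]
    exact (measure_ball_pos volume (0:E3) hR).trans_le (measure_mono fun x hx => ((hposball x).2 (by simpa using hx)).ne')
  have hcM : c = - M / R := by
    have h1 : ‖R • ee 0‖ = R := by simp [norm_smul, norm_ee, abs_of_pos hR]
    have h2 := hcl (R • ee 0) (by rw [mem_closedBall, dist_zero_right, h1])
    rw [out _ h1.ge, hhent, Real.zero_rpow g1.ne', pot_out hL rad h1.ge, h1] at h2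
    rw [← h2]; ring
  have hout : ∀ x : E3, R < ‖x‖ → pot ρ₀ x + c <0 := fun x hx => by
    rw [pot_out hL rad hx.le, hcM, neg_div, ← sub_eq_add_neg, sub_neg]
    exact div_lt_div_of_pos_left hM0 hR hx
  refine ⟨n, C, c, hn1, hC0, ?_, hent_H, ⟨hR, ?_, hn1, HH_deriv hn1 C, HH_cont (by linarith) _, ?_, ?_, ?_, ?_, ?_, rad,
    fun x => ?_, hposball, hreg1⟩, hout⟩
  · rw [hn]; field_simp; ring
  · intro h3; apply hγ3
    rw [h3] at hng; linarith
  · intro s hs; rw [HH, max_eq_right hs, Real.zero_rpow (by linarith), mul_zero]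
  · intro s hs; rw [HH, max_eq_right hs, Real.zero_rpow (by linarith), mul_zero]
  · intro s hs; rw [HH, max_eq_left hs.le]; positivity
  · intro s; rw [HH]; have := Real.rpow_nonneg (le_max_right s 0) (n - 1); positivity
  · intro s
    rcases le_or_gt s 0 with hs | hs
    · rw [HH, HH, max_eq_right hs, Real.zero_rpow (by linarith), Real.zero_rpow (by linarith)]; simp
    · rw [HH, HH, max_eq_left hs.le, Real.rpow_sub_one hs.ne']; field_simp
  · rcases lt_or_ge ‖x‖ R with hx | hx
    · have h1 := hc x (by simpa using hx)
      rw [show pot ρ₀ x + c = hent (ρ₀ x) by linarith, hH_ent _ ((hposball x).2 hx)]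
    · rw [out x hx]
      have : pot ρ₀ x + c ≤0 := by
        rcases hx.eq_or_lt with h | h
        · have h1 := hcl x (by simp [h])
          rw [out x hx, hhent, Real.zero_rpow g1.ne'] at h1; linarith
        · exact (hout x h).le
      rw [HH, max_eq_right this, Real.zero_rpow (by linarith), mul_zero]

section abs
variable {X : Type*} [MetricSpace X] [CompactSpace X]

lemma cpt_of_lip {Z : Type*} [NormedAddCommGroup Z] [NormedSpace ℝ Z] (T : Z →L[ℝ] C(X, ℝ)) {C : ℝ} (hC : 0 ≤ C)
    (h : ∀ f x y, |T f x - T f y| ≤ C * ‖f‖ * dist x y) : IsCompactOperator T := by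
  set I := ContinuousMap.linearIsometryBoundedOfCompact X ℝ ℝ
  set T' : Z →L[ℝ] BoundedContinuousFunction X ℝ := (I.toContinuousLinearEquiv : _ →L[ℝ] _).comp T with hT'
  have hc : IsCompactOperator T' := by
    change IsCompactOperator (T' : Z →ₗ[ℝ] BoundedContinuousFunction X ℝ)
    rw [isCompactOperator_iff_isCompact_closure_image_ball (T' : Z →ₗ[ℝ] BoundedContinuousFunction X ℝ) (r := 1) one_pos]
    refine BoundedContinuousFunction.arzela_ascoli (closedBall 0 (‖T‖)) (isCompact_closedBall _ _) _ ?_ ?_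
    · rintro _ x ⟨f, hf, rfl⟩
      rw [mem_closedBall, dist_zero_right]
      have h1 : ‖T f x‖ ≤ ‖T f‖ := (T f).norm_coe_le_norm x
      have h2 := T.le_opNorm f
      have h3 : ‖f‖ <1 := by simpa using hf
      change ‖T f x‖ ≤ _
      nlinarith [norm_nonneg T]
    · refine LipschitzWith.uniformEquicontinuous _ (Real.toNNReal C) (fun g => LipschitzWith.of_dist_le_mul fun x y => ?_) |>.equicontinuous
      obtain ⟨_, f, hf, rfl⟩ := g
      rw [Real.coe_toNNReal _ hC, Real.dist_eq]
      have h3 : ‖f‖ <1 := by simpa using hf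
      refine (h f x y).trans ?_
      have := mul_nonneg hC (dist_nonneg (x := x) (y := y))
      nlinarith
  have := hc.clm_comp (I.symm.toContinuousLinearEquiv : _ →L[ℝ] C(X, ℝ))
  exact this

def nem {φ : ℝ → ℝ} (hφ : Continuous φ) (f : C(X, ℝ)) : C(X, ℝ) := (ContinuousMap.mk φ hφ).comp f

lemma nem_cont {φ : ℝ → ℝ} (hφ : Continuous φ) : Continuous (nem hφ : C(X, ℝ) → C(X, ℝ)) :=
  ContinuousMap.continuous_postcomp _

lemma nem_strict {φ φ' : ℝ → ℝ} (hφ : ∀ s, HasDerivAt φ (φ' s) s) (hc : Continuous φ) (hc' : Continuous φ') (f : C(X, ℝ)) :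
    HasStrictFDerivAt (nem hc) (ContinuousLinearMap.mul ℝ C(X, ℝ) (nem hc' f)) f := by
  rw [hasStrictFDerivAt_iff_isLittleO, Asymptotics.isLittleO_iff]
  intro ε hε
  obtain ⟨δ, hδ, h⟩ := Metric.continuous_iff.1 (nem_cont (X := X) hc') f ε hε
  filter_upwards [prod_mem_nhds (Metric.ball_mem_nhds f hδ) (Metric.ball_mem_nhds f hδ)] with ⟨g, g'⟩ hg
  simp only [mem_prod, mem_ball] at hg
  rw [ContinuousMap.norm_le _ (by positivity)]
  intro x
  have key : ∀ t ∈ ball (f x) δ, ‖φ' t - φ' (f x)‖ ≤ ε := fun t ht => by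
    have h1 := h (f + ContinuousMap.const X (t - f x)) (by
      rw [dist_eq_norm, add_sub_cancel_left]
      refine lt_of_le_of_lt ((ContinuousMap.norm_le _ (norm_nonneg (t - f x))).2 fun y => le_rfl) ?_
      rwa [← dist_eq_norm])
    have h2 := (ContinuousMap.dist_apply_le_dist (f := nem hc' (f + ContinuousMap.const X (t - f x))) (g := nem hc' f) x).trans h1.le
    simpa [nem, Real.dist_eq] using h2
  have hx : ∀ k : C(X, ℝ), dist k f < δ → k x ∈ ball (f x) δ := fun k hk =>
    (ContinuousMap.dist_apply_le_dist x).trans_lt hk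
  have := (convex_ball (f x) δ).norm_image_sub_le_of_norm_hasDerivWithin_le (f := fun t => φ t - φ' (f x) * t)
    (f' := fun t => φ' t - φ' (f x)) (fun t _ => ((hφ t).sub (by simpa using (hasDerivAt_id t).const_mul (φ' (f x)))).hasDerivWithinAt)
    key (hx g' hg.2) (hx g hg.1)
  have h3 : ‖g x - g' x‖ ≤ ‖g - g'‖ := (g - g').norm_coe_le_norm x
  refine le_trans (le_of_eq ?_) (this.trans (mll h3 hε.le))
  simp only [nem, ContinuousMap.sub_apply, ContinuousMap.comp_apply, ContinuousMap.coe_mk, ContinuousLinearMap.mul_apply',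
    ContinuousMap.mul_apply]
  congr 1; ring
end abs

lemma ift {Z : Type*} [NormedAddCommGroup Z] [NormedSpace ℝ Z] [CompleteSpace Z] {F G : Z → Z} {z0 : Z} (e : Z)
    {B : Z ≃L[ℝ] Z} {G' : Z →L[ℝ] Z} (hF : HasStrictFDerivAt F (B : Z →L[ℝ] Z) z0) (hG : HasStrictFDerivAt G G' z0) (h0 : F z0 =0) :
    ∃ δ : ℝ, 0 < δ ∧ ∃ z : ℝ × ℝ → Z, Continuous z ∧ z 0 = z0 ∧
      ∀ p : ℝ × ℝ, |p.1| ≤ δ → |p.2| ≤ δ → F (z p) - (p.1 ^2) • e + p.2 • G (z p) =0 := by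
  set Φ : (ℝ × ℝ) × Z → Z := fun w => F w.2 - (w.1.1 ^2) • e + w.1.2 • G w.2 with hΦ
  set u : (ℝ × ℝ) × Z := (0, z0) with hu
  have f1 : HasStrictFDerivAt (fun w : (ℝ × ℝ) × Z => w.2) (ContinuousLinearMap.snd ℝ (ℝ × ℝ) Z) u := hasStrictFDerivAt_snd
  have f2 : HasStrictFDerivAt (fun w : (ℝ × ℝ) × Z => w.1) (ContinuousLinearMap.fst ℝ (ℝ × ℝ) Z) u := hasStrictFDerivAt_fst
  obtain ⟨D, hD, hDe⟩ : ∃ D : (ℝ × ℝ) × Z →L[ℝ] Z, HasStrictFDerivAt Φ D u ∧ ∀ z, D (0, z) = B z :=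
    ⟨_, ((HasStrictFDerivAt.comp u (g := F) hF f1).sub ((f2.fst.pow 2).smul_const e)).add
      (f2.snd.smul (HasStrictFDerivAt.comp u (g := G) hG f1)), fun z => by simp [hu]⟩
  have hinv : (D ∘L ContinuousLinearMap.inr ℝ (ℝ × ℝ) Z).IsInvertible :=
    ⟨B, by ext z; simp [hDe]⟩
  set z := hD.implicitFunctionOfProdDomain hinv with hz
  have h1 := hD.eventually_apply_implicitFunctionOfProdDomain hinv
  obtain ⟨K, s, hs, hL⟩ := (hD.hasStrictFDerivAt_implicitFunctionOfProdDomain hinv).exists_lipschitzOnWith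
  have hz0 : z 0 = z0 := (hD.eventually_apply_eq_iff_implicitFunctionOfProdDomain hinv).self_of_nhds.mp rfl
  obtain ⟨δ, hδ, hb⟩ := Metric.nhds_basis_closedBall.mem_iff.1 (inter_mem h1 hs)
  set cl : ℝ → ℝ := fun t => max (-δ) (min δ t) with hcl
  have hclb : ∀ t, |cl t| ≤ δ := fun t => abs_le.2 ⟨le_max_left _ _, max_le (by linarith) (min_le_left _ _)⟩
  have hcle : ∀ t, |t| ≤ δ → cl t = t := fun t ht => by
    have := abs_le.1 ht
    rw [hcl]; simp only; rw [min_eq_right this.2, max_eq_right this.1]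
  have hin : ∀ p : ℝ × ℝ, |p.1| ≤ δ → |p.2| ≤ δ → p ∈ closedBall u.1 δ := fun p h1 h2 => by
    rw [mem_closedBall, hu, dist_zero_right, Prod.norm_def]
    exact max_le h1 h2
  have hΦ0 : Φ u =0 := by simp [hΦ, hu, h0]
  refine ⟨δ, hδ, fun p => z (cl p.1, cl p.2), ?_, ?_, fun p p1 p2 => ?_⟩
  · refine hL.continuousOn.comp_continuous (by simp only [hcl]; fun_prop) fun p => (hb (hin _ (hclb _) (hclb _))).2
  · have : cl 0 =0 := hcle 0 (by simpa using hδ.le)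
    simp only [Prod.fst_zero, Prod.snd_zero, this]; exact hz0
  · beta_reduce; rw [hcle _ p1, hcle _ p2]
    have := (hb (hin p p1 p2)).1
    rw [← hΦ0]; exact this

lemma fred {Z : Type*} [NormedAddCommGroup Z] [NormedSpace ℝ Z] [CompleteSpace Z] {T : Z →L[ℝ] Z} (hT : IsCompactOperator T)
    (hi : ∀ z, T z = z → z =0) : ∃ B : Z ≃L[ℝ] Z, (B : Z →L[ℝ] Z) =1 - T := by
  rcases hT.hasEigenvalue_or_mem_resolventSet one_ne_zero with h | h
  · obtain ⟨z, hz⟩ := h.exists_hasEigenvector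
    exact absurd (hi z (by simpa using hz.apply_eq_smul)) hz.2
  · rw [spectrum.mem_resolventSet_iff, map_one] at h
    obtain ⟨w, hw⟩ := h
    exact ⟨ContinuousLinearEquiv.unitsEquiv ℝ Z w, by rw [← hw]; rfl⟩

def fold (y : E3) : E3 := mk3 (cylRad y) 0 |y 2|

lemma nsq (x : E3) : ‖x‖ ^2 = x 0 ^2 + x 1 ^2 + x 2 ^2 := by
  rw [EuclideanSpace.norm_sq_eq, Fin.sum_univ_three]; simp
lemma cyl_sq (x : E3) : cylRad x ^2 = x 0 ^2 + x 1 ^2 := Real.sq_sqrt (by positivity)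
lemma mk3_0 (a b c : ℝ) : mk3 a b c 0 = a := rfl
lemma mk3_1 (a b c : ℝ) : mk3 a b c 1 = b := rfl
lemma mk3_2 (a b c : ℝ) : mk3 a b c 2 = c := rfl
lemma ext3 {x y : E3} (h0 : x 0 = y 0) (h1 : x 1 = y 1) (h2 : x 2 = y 2) : x = y := by
  ext i; fin_cases i <;> assumption

lemma fold_norm (x : E3) : ‖fold x‖ = ‖x‖ := by
  rw [← sq_eq_sq₀ (norm_nonneg _) (norm_nonneg _), nsq, nsq, fold, mk3_0, mk3_1, mk3_2, cyl_sq, sq_abs]; ring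

lemma fold_cont : Continuous fold := by
  unfold fold mk3 cylRad
  refine (PiLp.continuous_toLp 2 _).comp (continuous_pi fun i => ?_)
  fin_cases i <;> simp <;> fun_prop

def Sy (M : E3 ≃ₗᵢ[ℝ] E3) : Prop := ∃ σ : ℝ, σ * σ =1 ∧ ∀ x, (M x) 2 = σ * x 2

lemma Sy.fold {M} (h : Sy M) (x : E3) : fold (M x) = fold x := by
  obtain ⟨σ, h1, h2⟩ := h
  have h3 : (M x) 2 ^2 = x 2 ^2 := by rw [h2]; linear_combination (x 2 ^2) * h1
  have h4 := congrArg (· ^2) (M.norm_map x)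
  simp only [nsq] at h4
  rw [_root_.fold, _root_.fold, cylRad, cylRad, (sq_eq_sq_iff_abs_eq_abs _ _).1 h3]
  congr 2; linarith

lemma Sy.hor {M} (h : Sy M) (x y : E3) : (M x) 0 * (M y) 0 + (M x) 1 * (M y) 1 = x 0 * y 0 + x 1 * y 1 := by
  obtain ⟨σ, h1, h2⟩ := h
  have := M.inner_map_map x y
  simp only [PiLp.inner_apply, Fin.sum_univ_three] at this
  simp only [RCLike.inner_apply, conj_trivial, h2] at this
  linear_combination this - (x 2 * y 2) * h1

lemma Sy.rfl {e : E3} (he : ‖e‖ =1) (h2 : e 2 =0) : Sy (rfl3 e) :=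
  ⟨1, by simp, fun x => by rw [rfl3_apply he]; simp [h2]⟩

lemma Sy.rfl2 : Sy (rfl3 (ee 2)) :=
  ⟨-1, by simp, fun x => by rw [rfl3_apply (norm_ee 2), real_inner_comm, inner_ee]; simp [ee]; ring⟩

lemma Sy.neg : Sy (LinearIsometryEquiv.neg ℝ) := ⟨-1, by simp, fun x => by simp⟩

def SymE (f : E3 → ℝ) : Prop := ∀ x, f x = f (fold x)

lemma SymE.sy {f} (h : SymE f) {M} (hM : Sy M) (x : E3) : f (M x) = f x := by rw [h, hM.fold, ← h]

lemma SymE.of {f : E3 → ℝ} (h : ∀ M, Sy M → ∀ x, f (M x) = f x) : SymE f := fun x => by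
  set y := mk3 (cylRad x) 0 (x 2) with hy
  have h1 : f y = f x := by
    by_cases hne : x = y
    · rw [← hne]
    have hd : ‖x - y‖ ≠0 := norm_ne_zero_iff.2 (sub_ne_zero.2 hne)
    set e := ‖x - y‖⁻¹ • (x - y) with he
    have he1 : ‖e‖ =1 := by rw [he, norm_smul, norm_inv, norm_norm, inv_mul_cancel₀ hd]
    rw [← h _ (Sy.rfl he1 (by simp [he, hy, mk3_2])) x]
    congr 1
    have hxy : ‖x‖ ^2 = ‖y‖ ^2 := by rw [nsq, nsq, hy, mk3_0, mk3_1, mk3_2, cyl_sq]; ring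
    have h1 : 2 * inner ℝ e x = ‖x - y‖ := by
      rw [he, real_inner_smul_left, inner_sub_left, real_inner_self_eq_norm_sq]
      have := norm_sub_sq_real x y
      rw [real_inner_comm x y, ← mul_assoc, mul_comm (2:ℝ), mul_assoc, inv_mul_eq_iff_eq_mul₀ hd]
      rw [hxy] at this ⊢; linarith
    rw [rfl3_apply he1, h1, he, smul_smul, mul_inv_cancel₀ hd]; simp
  rw [← h1, fold]
  rcases abs_choice (x 2) with h2 | h2
  · rw [h2]
  · rw [h2, ← h _ Sy.rfl2 y]
    congr 1
    rw [rfl3_apply (norm_ee 2), real_inner_comm, inner_ee]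
    refine ext3 ?_ ?_ ?_ <;> simp [hy, mk3_0, mk3_1, mk3_2, ee]; ring

lemma fold_fold (x : E3) : fold (fold x) = fold x := by
  refine ext3 ?_ rfl ?_ <;> simp only [fold, mk3_0, mk3_2, abs_abs]
  rw [cylRad, mk3_0, mk3_1]; simp [Real.sqrt_sq, cylRad]

lemma SymE.pot {f} (h : SymE f) : SymE (pot f) := .of fun M hM x => by
  rw [← pot_rot]; congr 1; ext y; exact h.sy hM y

def hp (g : E3 → ℝ) (x : E3) : ℝ := x 0 * pot (fun y => g y * y 0) x + x 1 * pot (fun y => g y * y 1) x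

lemma hp_eq {A L g} (hg : Den A L g) (x : E3) : hp g x = ∫ y, g y * (x 0 * y 0 + x 1 * y 1) / ‖x - y‖ := by
  obtain ⟨L0, h0⟩ := hg.mulc (g := fun y => y 0) (by fun_prop)
  obtain ⟨L1, h1⟩ := hg.mulc (g := fun y => y 1) (by fun_prop)
  rw [hp, _root_.pot, _root_.pot, ← integral_const_mul, ← integral_const_mul, ← integral_add ((pot_int h0 x).const_mul _) ((pot_int h1 x).const_mul _)]
  congr 1; ext y; ring

lemma SymE.hp {A L g} (h : SymE g) (hg : Den A L g) : SymE (hp g) := .of fun M hM x => by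
  rw [hp_eq hg, hp_eq hg, ← M.measurePreserving.integral_comp M.toHomeomorph.measurableEmbedding]
  congr 1; ext y
  rw [h.sy hM, hM.hor, ← map_sub, M.norm_map]

lemma hp_tan {A L g} (h : SymE g) (hg : Den A L g) (x : E3) :
    x 0 * _root_.pot (fun y => g y * y 1) x = x 1 * _root_.pot (fun y => g y * y 0) x := by
  obtain ⟨L0, h0⟩ := hg.mulc (g := fun y => y 0) (by fun_prop)
  obtain ⟨L1, h1⟩ := hg.mulc (g := fun y => y 1) (by fun_prop)
  by_cases hr : x 0 ^2 + x 1 ^2 =0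
  · have a : x 0 =0 := by nlinarith [sq_nonneg (x 0), sq_nonneg (x 1)]
    have b : x 1 =0 := by nlinarith [sq_nonneg (x 0), sq_nonneg (x 1)]
    rw [a, b]; ring
  set v := mk3 (-x 1) (x 0) 0 with hv
  have hvn : ‖v‖ ≠0 := fun h0 => hr (by
    have := nsq v; rw [h0, hv, mk3_0, mk3_1, mk3_2] at this; linarith)
  set e := ‖v‖⁻¹ • v with he
  have he1 : ‖e‖ =1 := by rw [he, norm_smul, norm_inv, norm_norm, inv_mul_cancel₀ hvn]
  have hin : ∀ y : E3, inner ℝ e y = ‖v‖⁻¹ * (x 0 * y 1 - x 1 * y 0) := fun y => by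
    rw [he, real_inner_smul_left]
    simp only [PiLp.inner_apply, Fin.sum_univ_three, hv, mk3_0, mk3_1, mk3_2]
    simp; left; ring
  have hS : Sy (rfl3 e) := Sy.rfl he1 (by simp [he, hv, mk3_2])
  have hx : rfl3 e x = x := by rw [rfl3_apply he1, hin]; simp [mul_comm]
  have hy : ∀ y, x 0 * (rfl3 e y) 1 - x 1 * (rfl3 e y) 0 = - (x 0 * y 1 - x 1 * y 0) := fun y => by
    have := rfl3_in he1 y
    rw [hin, hin, ← mul_neg] at this
    exact mul_left_cancel₀ (inv_ne_zero hvn) this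
  have hw : x 0 * _root_.pot (fun y => g y * y 1) x - x 1 * _root_.pot (fun y => g y * y 0) x =
      ∫ y, g y * (x 0 * y 1 - x 1 * y 0) / ‖x - y‖ := by
    rw [_root_.pot, _root_.pot, ← integral_const_mul, ← integral_const_mul, ← integral_sub ((pot_int h1 x).const_mul _) ((pot_int h0 x).const_mul _)]
    congr 1; ext y; ring
  have h2 : ∫ y, g y * (x 0 * y 1 - x 1 * y 0) / ‖x - y‖ = - ∫ y, g y * (x 0 * y 1 - x 1 * y 0) / ‖x - y‖ := by
    conv_lhs => rw [← (rfl3 e).measurePreserving.integral_comp (rfl3 e).toHomeomorph.measurableEmbedding]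
    rw [← integral_neg]
    congr 1; ext y
    have h3 : ‖x - rfl3 e y‖ = ‖x - y‖ := by
      conv_lhs => rw [← hx]
      rw [← map_sub, (rfl3 e).norm_map]
    rw [h3, hy, h.sy hS]; ring
  linarith

section ops
variable {A : ℝ} [hA : Fact (0 < A)]

instance : CompactSpace (closedBall (0:E3) A) := isCompact_iff_compactSpace.1 (isCompact_closedBall _ _)

def ret (y : E3) : closedBall (0:E3) A := ⟨(A / max A ‖y‖) • fold y, by
  have h1 : 0 < max A ‖y‖ := lt_max_of_lt_left hA.out
  rw [mem_closedBall, dist_zero_right, norm_smul, fold_norm, Real.norm_of_nonneg (div_nonneg hA.out.le h1.le),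
    div_mul_eq_mul_div, div_le_iff₀ h1]
  exact mll (le_max_right _ _) hA.out.le⟩

lemma ret_cont : Continuous (ret (A := A)) := by
  refine Continuous.subtype_mk (Continuous.smul (continuous_const.div (continuous_const.max continuous_norm) fun y => ?_) fold_cont) _
  exact (lt_max_of_lt_left hA.out).ne'

lemma ret_in {y : E3} (hy : ‖y‖ ≤ A) : ((ret y : closedBall (0:E3) A) : E3) = fold y := by
  rw [ret]; simp only; rw [max_eq_left hy, div_self hA.out.ne', one_smul]

def ex (f : C(closedBall (0:E3) A, ℝ)) : E3 → ℝ := (closedBall (0:E3) A).indicator fun y => f (ret y)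

lemma ex_in (f : C(closedBall (0:E3) A, ℝ)) {y : E3} (hy : ‖y‖ ≤ A) : ex f y = f (ret y) :=
  indicator_of_mem (by simpa using hy) _
lemma ex_out (f : C(closedBall (0:E3) A, ℝ)) {y : E3} (hy : A < ‖y‖) : ex f y =0 :=
  indicator_of_notMem (by simpa using hy) _

lemma ex_den (f : C(closedBall (0:E3) A, ℝ)) : Den A ‖f‖ (ex f) :=
  ⟨(f.continuous.comp ret_cont).measurable.indicator measurableSet_closedBall, fun x => by
    rcases le_or_gt ‖x‖ A with h | h
    · rw [ex_in f h]; exact f.norm_coe_le_norm _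
    · rw [ex_out f h]; simp, fun x hx => ex_out f hx⟩

lemma ex_sym (f : C(closedBall (0:E3) A, ℝ)) : SymE (ex f) := fun x => by
  rcases le_or_gt ‖x‖ A with h | h
  · rw [ex_in f h, ex_in f (by rwa [fold_norm])]
    congr 1; ext1; rw [ret_in h, ret_in (by rwa [fold_norm]), fold_fold]
  · rw [ex_out f h, ex_out f (by rwa [fold_norm])]

lemma ex_add (f g : C(closedBall (0:E3) A, ℝ)) (y : E3) : ex (f + g) y = ex f y + ex g y := by
  simp only [ex, indicator]; split_ifs <;> simp
lemma ex_smul (a : ℝ) (g : C(closedBall (0:E3) A, ℝ)) (y : E3) : ex (a • g) y = a * ex g y := by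
  simp only [ex, indicator]; split_ifs <;> simp

lemma ex_bd (m : C(E3, ℝ)) : ∃ B, 0 ≤ B ∧ ∀ f : C(closedBall (0:E3) A, ℝ), Den A (B * ‖f‖) fun y => ex f y * m y := by
  obtain ⟨B, hB⟩ := (isCompact_closedBall (0:E3) A).exists_bound_of_continuousOn m.continuous.continuousOn
  refine ⟨|B|, abs_nonneg _, fun f => ⟨(ex_den f).meas.mul m.continuous.measurable, fun y => ?_, fun y hy => by rw [ex_out f hy, zero_mul]⟩⟩
  rcases le_or_gt ‖y‖ A with h | h
  · rw [abs_mul, mul_comm]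
    exact mul_le_mul ((hB y (by simpa using h)).trans (le_abs_self B)) ((ex_den f).bd y) (abs_nonneg _) (abs_nonneg _)
  · rw [ex_out f h]; simp; positivity

def PP (m : C(E3, ℝ)) : C(closedBall (0:E3) A, ℝ) →L[ℝ] C(closedBall (0:E3) A, ℝ) :=
  LinearMap.mkContinuousOfExistsBound
    { toFun := fun f => ⟨fun x => pot (fun y => ex f y * m y) x,
        (pot_c1 ((ex_bd m).choose_spec.2 f)).continuous.comp continuous_subtype_val⟩
      map_add' := fun f g => by
        ext x
        change pot _ _ = pot _ _ + pot _ _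
        rw [pot, pot, pot, ← integral_add (pot_int ((ex_bd m).choose_spec.2 f) x) (pot_int ((ex_bd m).choose_spec.2 g) x)]
        congr 1; ext y; rw [ex_add]; ring
      map_smul' := fun a f => by
        ext x
        change pot _ _ = a * pot _ _
        rw [pot, pot, ← integral_const_mul]
        congr 1; ext y; rw [ex_smul]; ring }
    (by
      obtain ⟨B, hB, h⟩ := ex_bd (A := A) m
      obtain ⟨C, hC, h'⟩ := pot_bd A
      refine ⟨C * B, fun f => (ContinuousMap.norm_le _ (by positivity)).2 fun x => ?_⟩
      rw [mul_assoc]; exact h' _ _ (h f) x)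

lemma PP_apply (m : C(E3, ℝ)) (f : C(closedBall (0:E3) A, ℝ)) (x) : PP m f x = pot (fun y => ex f y * m y) x := rfl

lemma PP_cpt (m : C(E3, ℝ)) : IsCompactOperator (PP (A := A) m) := by
  obtain ⟨B, hB, h⟩ := ex_bd (A := A) m
  obtain ⟨C, hC, h'⟩ := pot_bd1 A
  refine cpt_of_lip _ (mul_nonneg hC hB) fun f x y => ?_
  rw [PP_apply, PP_apply]
  have := convex_univ.norm_image_sub_le_of_norm_fderiv_le (𝕜 := ℝ)
    (fun z _ => (pot_c1 (h f)).differentiable (by norm_num) z) (fun z _ => h' _ _ (h f) z) (mem_univ (y : E3)) (mem_univ (x : E3))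
  rw [mul_assoc]; rw [← mul_assoc] at this ⊢
  rw [Subtype.dist_eq, dist_eq_norm]
  exact this

def mass : C(closedBall (0:E3) A, ℝ) →L[ℝ] ℝ :=
  LinearMap.mkContinuousOfExistsBound
    { toFun := fun f => ∫ y, ex f y
      map_add' := fun f g => by
        rw [← integral_add (ex_den f).int (ex_den g).int]; congr 1; ext y; rw [ex_add]
      map_smul' := fun a f => by
        rw [RingHom.id_apply, smul_eq_mul, ← integral_const_mul]; congr 1; ext y; rw [ex_smul] }
    ⟨_, fun f => by
      refine (norm_integral_le_integral_norm _).trans ((integral_mono (ex_den f).int.norm (ball_int A ‖f‖ 0) fun x => ?_).trans ?_)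
      · exact (ex_den f).le_ind x
      · rw [integral_indicator_const _ measurableSet_closedBall, smul_eq_mul]⟩

lemma mass_apply (f : C(closedBall (0:E3) A, ℝ)) : mass f = ∫ y, ex f y := rfl
end ops

section sol
variable {A : ℝ} [hA : Fact (0 < A)]

def cx (i : Fin 3) : C(E3, ℝ) := ⟨fun y => y i, by fun_prop⟩
def rs (f : C(E3, ℝ)) : C(closedBall (0:E3) A, ℝ) := ⟨fun x => f x, by fun_prop⟩

def TT : C(closedBall (0:E3) A, ℝ) →L[ℝ] C(closedBall (0:E3) A, ℝ) :=
  (ContinuousLinearMap.mul ℝ _ (rs (cx 0))).comp (PP (cx 0)) + (ContinuousLinearMap.mul ℝ _ (rs (cx 1))).comp (PP (cx 1))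

lemma TT_apply (f : C(closedBall (0:E3) A, ℝ)) (x) : TT f x = hp (ex f) x := rfl

lemma PP1_apply (f : C(closedBall (0:E3) A, ℝ)) (x) : PP 1 f x = pot (ex f) x := by
  rw [PP_apply]; simp

variable {R n c : ℝ} {H H' : ℝ → ℝ} {ρ : E3 → ℝ}

lemma LEm.sol (h : LEm R n c H H' ρ) (hRA : R < A) (hc : Continuous H) {k k' K : ℝ → ℝ} (hk : ∀ s, HasDerivAt k (k' s) s)
    (hk' : Continuous k') (kc : Continuous k) (hK : ∀ s, HasDerivAt K (k s) s) :
    ∃ δ : ℝ, 0 < δ ∧ ∃ u ψ : ℝ × ℝ → C(closedBall (0:E3) A, ℝ), ∃ lam : ℝ × ℝ → ℝ, Continuous u ∧ Continuous ψ ∧ Continuous lam ∧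
      (∀ y, u 0 y = pot ρ y + c) ∧ ∀ p : ℝ × ℝ, |p.1| ≤ δ → |p.2| ≤ δ →
        (∀ x, u p x = pot (ex (nem hc (u p))) x + lam p + p.1 ^2 * (1 /2 * ((x:E3) 0 ^2 + (x:E3) 1 ^2)) - p.2 * K (ψ p x)) ∧
        (∫ x, ex (nem hc (u p)) x = ∫ x, ρ x) ∧
        ∀ x, ψ p x = p.2 / c0 * hp (ex (nem hc (u p) * nem kc (ψ p))) x := by
  have Kc : Continuous K := continuous_iff_continuousAt.2 fun s => (hK s).continuousAt
  let C := C(closedBall (0:E3) A, ℝ)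
  let Z := C × ℝ × C
  let u0 : C := rs ⟨fun x => pot ρ x + c, h.pc1.continuous.add_const c⟩
  have hu0 : ∀ x, u0 x = pot ρ x + c := fun x => rfl
  let z0 : Z := (u0, c, 0)
  let q : C := nem h.cH u0
  let p1 : Z →L[ℝ] C := ContinuousLinearMap.fst ℝ C (ℝ × C)
  let p2 : Z →L[ℝ] ℝ := (ContinuousLinearMap.fst ℝ ℝ C).comp (ContinuousLinearMap.snd ℝ C (ℝ × C))
  let p3 : Z →L[ℝ] C := (ContinuousLinearMap.snd ℝ ℝ C).comp (ContinuousLinearMap.snd ℝ C (ℝ × C))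
  let Q : Z →L[ℝ] C := (ContinuousLinearMap.mul ℝ C q).comp p1
  let S : ℝ × ℝ →L[ℝ] Z := (ContinuousLinearMap.toSpanSingleton ℝ ((1, 1, 0) : Z)).comp (ContinuousLinearMap.fst ℝ ℝ ℝ) -
    (ContinuousLinearMap.toSpanSingleton ℝ ((0, 1, 0) : Z)).comp (ContinuousLinearMap.snd ℝ ℝ ℝ)
  let Tc : Z →L[ℝ] Z := (ContinuousLinearMap.inl ℝ C (ℝ × C)).comp ((PP 1).comp Q) + S.comp (p2.prod (mass.comp Q))
  have hTc : IsCompactOperator Tc := by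
    have a : IsCompactOperator ((ContinuousLinearMap.inl ℝ C (ℝ × C)).comp ((PP 1).comp Q)) := ((PP_cpt (A := A) 1).comp_clm Q).clm_comp (ContinuousLinearMap.inl ℝ C (ℝ × C))
    have b : IsCompactOperator (S.comp (p2.prod (mass.comp Q))) := (isCompactOperator_of_locallyCompactSpace_rng S).comp_clm _
    exact a.add b
  have hT : ∀ z, Tc z = (PP 1 (q * z.1) + z.2.1 • (1 : C), z.2.1 - mass (q * z.1), 0) := fun z => by
    refine Prod.ext ?_ (Prod.ext ?_ ?_)
    · change PP 1 (q * z.1) + (z.2.1 • (1:C) - mass (q * z.1) • (0:C)) = _; rw [smul_zero, sub_zero]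
    · change 0 + (z.2.1 • (1:ℝ) - mass (q * z.1) • (1:ℝ)) = _; simp
    · change 0 + (z.2.1 • (0:C) - mass (q * z.1) • (0:C)) = _; simp
  have hin : ∀ z, Tc z = z → z =0 := by
    rintro ⟨v, μ, χ⟩ hz
    rw [hT] at hz
    have e1 : PP 1 (q * v) + μ • (1 : C) = v := congrArg (fun z : Z => z.1) hz
    have e2 : mass (q * v) =0 := by have : μ - mass (q * v) = μ := congrArg (fun z : Z => z.2.1) hz; linarith
    have e3 : 0 = χ := congrArg (fun z : Z => z.2.2) hz
    set V : E3 → ℝ := fun x => pot (ex (q * v)) x + μ with hV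
    have hs : SymE V := fun x => by rw [hV]; simp only; rw [(ex_sym (q * v)).pot x]
    have hv : ∀ x, v x = V x := fun x => by
      have := congrArg (fun f : C => f x) e1
      change PP 1 (q * v) x + μ *1 = v x at this
      rw [PP1_apply] at this
      rw [← this, hV, mul_one]
    have hex : ex (q * v) = fun y => LEm.q c H' ρ y * V y := by
      ext y
      rcases le_or_gt ‖y‖ A with hy | hy
      · rw [ex_in _ hy, ContinuousMap.mul_apply, hv, hs y, ret_in hy]
        congr 1
        change H' (u0 (ret y)) = _
        rw [hu0, ret_in hy, LEm.q, h.prad (fold_norm y)]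
      · rw [ex_out _ hy, h.q0 (hRA.le.trans hy.le), zero_mul]
    have hVc : Continuous V := (pot_c1 (ex_den _)).continuous.add_const _
    obtain ⟨a1, a2⟩ := h.nondeg hVc (μ := μ) (fun x => by rw [← hex]) (fun x => hs.sy Sy.neg x) (by
      rw [← hex]; exact e2)
    refine Prod.ext ?_ (Prod.ext a2 e3.symm)
    ext x; rw [hv, a1]; rfl
  obtain ⟨B, hB⟩ := fred hTc hin
  let F : Z → Z := fun z => (z.1 - PP 1 (nem hc z.1) - z.2.1 • (1 : C), mass (nem hc z.1) - ∫ x, ρ x, z.2.2)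
  let G : Z → Z := fun z => (nem Kc z.2.2, 0, (-(1 / c0)) • TT (nem hc z.1 * nem kc z.2.2))
  have d1 : HasStrictFDerivAt (fun z : Z => z.1) p1 z0 := p1.hasStrictFDerivAt
  have d2 : HasStrictFDerivAt (fun z : Z => z.2.1) p2 z0 := p2.hasStrictFDerivAt
  have d3 : HasStrictFDerivAt (fun z : Z => z.2.2) p3 z0 := p3.hasStrictFDerivAt
  have dH : HasStrictFDerivAt (fun z : Z => nem hc z.1) Q z0 :=
    HasStrictFDerivAt.comp z0 (g := nem hc) (nem_strict h.hH hc h.cH u0) d1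
  have dk := HasStrictFDerivAt.comp z0 (g := nem kc) (nem_strict hk kc hk' (0 : C)) d3
  have dK := HasStrictFDerivAt.comp z0 (g := nem Kc) (nem_strict hK Kc kc (0 : C)) d3
  have hF : HasStrictFDerivAt F (B : Z →L[ℝ] Z) z0 := by
    have := ((d1.sub ((PP 1 : C →L[ℝ] C).hasStrictFDerivAt.comp z0 dH)).sub (d2.smul_const (1 : C))).prodMk
      (((mass.hasStrictFDerivAt.comp z0 dH).sub_const (∫ x, ρ x)).prodMk d3)
    refine this.congr_fderiv ?_
    rw [hB]
    refine ContinuousLinearMap.ext fun z => Prod.ext ?_ (Prod.ext ?_ ?_)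
    · change z.1 - PP 1 (q * z.1) - z.2.1 • (1:C) = z.1 - (Tc z).1
      rw [hT]; simp only; abel
    · change mass (q * z.1) = z.2.1 - (Tc z).2.1
      rw [hT]; simp
    · change z.2.2 = z.2.2 - (Tc z).2.2
      rw [hT]; simp
  obtain ⟨G', hG⟩ : ∃ G', HasStrictFDerivAt G G' z0 :=
    ⟨_, dK.prodMk ((hasStrictFDerivAt_const (0:ℝ) z0).prodMk (((TT : C →L[ℝ] C).hasStrictFDerivAt.comp z0 (dH.mul' dk)).const_smul (-(1 / c0))))⟩
  have hex0 : ex (nem hc u0) = ρ := by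
    ext y
    rcases le_or_gt ‖y‖ A with hy | hy
    · rw [ex_in _ hy]; change H (u0 (ret y)) = _
      rw [hu0, ret_in hy, h.prad (fold_norm y), h.eq y]
    · rw [ex_out _ hy, h.out (hRA.le.trans hy.le)]
  have hF0 : F z0 =0 := by
    refine Prod.ext ?_ (Prod.ext ?_ rfl)
    · ext x
      change u0 x - PP 1 (nem hc u0) x - c *1 =0
      rw [PP1_apply, hex0, hu0]; ring
    · simp only [F, z0, mass_apply, hex0]; simp
  obtain ⟨δ, hδ, z, zc, zz, hz⟩ := ift ((rs ⟨fun x : E3 => 1 /2 * (x 0 ^2 + x 1 ^2), by fun_prop⟩, 0, 0) : Z) hF hG hF0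
  refine ⟨δ, hδ, fun p => (z p).1, fun p => (z p).2.2, fun p => (z p).2.1, by fun_prop, by fun_prop, by fun_prop,
    fun y => by beta_reduce; rw [zz, ← hu0], fun p h1 h2 => ?_⟩
  have := hz p h1 h2
  have b1 := congrArg (fun z : Z => z.1) this
  have b2 := congrArg (fun z : Z => z.2.1) this
  have b3 := congrArg (fun z : Z => z.2.2) this
  simp only [F, G] at b1 b2 b3
  refine ⟨fun x => ?_, ?_, fun x => ?_⟩
  · have := congrArg (fun f : C => f x) b1
    change (z p).1 x - PP 1 (nem hc (z p).1) x - (z p).2.1 *1 - p.1 ^2 * (1 /2 * ((x:E3) 0 ^2 + (x:E3) 1 ^2)) + p.2 * K ((z p).2.2 x) =0 at this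
    rw [PP1_apply] at this
    linarith
  · simp [mass_apply] at b2; linarith
  · have := congrArg (fun f : C => f x) b3
    change (z p).2.2 x - p.1 ^2 *0 + p.2 * (-(1 / c0) * TT (nem hc (z p).1 * nem kc (z p).2.2) x) =0 at this
    rw [TT_apply] at this
    beta_reduce
    rw [div_eq_mul_inv]; linear_combination this
end sol

lemma fd_supp {f : E3 → ℝ} {A : ℝ} (hA : ∀ x, A < ‖x‖ → f x =0) (x : E3) (hx : A < ‖x‖) : fderiv ℝ f x =0 := by
  ext v; exact pd_supp hA v x hx

lemma den1_of {f : E3 → ℝ} {A L : ℝ} (hf : ContDiff ℝ 1 f) (hA : ∀ x, A < ‖x‖ → f x =0) (h0 : ∀ x, |f x| ≤ L)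
    (h1 : ∀ x, ‖fderiv ℝ f x‖ ≤ L) : Den1 A L f :=
  ⟨⟨hf.continuous.measurable, h0, hA⟩, fun x y => convex_univ.norm_image_sub_le_of_norm_fderiv_le (𝕜 := ℝ)
    (fun z _ => hf.differentiable (by norm_num) z) (fun z _ => h1 z) (mem_univ y) (mem_univ x)⟩

lemma c1_den1 {f : E3 → ℝ} {A : ℝ} (hf : ContDiff ℝ 1 f) (hA : ∀ x, A < ‖x‖ → f x =0) : ∃ L, Den1 A L f := by
  obtain ⟨B, hB, h⟩ := cs_bdd hf.continuous hA
  obtain ⟨D, hD, h'⟩ := cs_bdd (hf.continuous_fderiv (by norm_num)).norm (A := A) fun x hx => by rw [fd_supp hA x hx, norm_zero]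
  exact ⟨B + D, den1_of hf hA (fun x => by linarith [h x]) fun x => by have := h' x; rw [abs_norm] at this; linarith⟩

lemma hol_den2 {f : E3 → ℝ} {A C a : ℝ} (hf : ContDiff ℝ 1 f) (hA : ∀ x, A < ‖x‖ → f x =0)
    (h : ∀ x y, ‖fderiv ℝ f x - fderiv ℝ f y‖ ≤ C * ‖x - y‖ ^ a) : ∃ L, Den2 A L a f := by
  obtain ⟨L, hL⟩ := c1_den1 hf hA
  have m : ∀ {x y z : ℝ}, 0 ≤ z → x ≤ y * z → x ≤ max L y * z := fun hz h => h.trans (mlr (le_max_right _ _) hz)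
  exact ⟨max L C, ⟨⟨hL.meas, fun x => (hL.bd x).trans (le_max_left _ _), hA⟩, fun x y => (hL.lip x y).trans
    (mlr (le_max_left _ _) (norm_nonneg _))⟩, hf, fun x y => m (by positivity) (h x y)⟩

lemma c2_den2 {f : E3 → ℝ} {A : ℝ} (hf : ContDiff ℝ 2 f) (hA : ∀ x, A < ‖x‖ → f x =0) : ∃ L, Den2 A L 1 f := by
  have h1 : ContDiff ℝ 1 (fderiv ℝ f) := hf.fderiv_right (by norm_num)
  obtain ⟨D, hD, h'⟩ := cs_bdd (h1.continuous_fderiv (by norm_num)).norm (A := A) fun x hx => by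
    have : fderiv ℝ f =ᶠ[𝓝 x] fun _ => 0 := by
      filter_upwards [(isOpen_lt continuous_const continuous_norm).mem_nhds hx] with y hy using fd_supp hA y hy
    rw [this.fderiv_eq]; simp
  refine hol_den2 (C := D) (hf.of_le (by norm_num)) hA fun x y => ?_
  rw [Real.rpow_one]
  exact convex_univ.norm_image_sub_le_of_norm_fderiv_le (𝕜 := ℝ) (fun z _ => h1.differentiable (by norm_num) z)
    (fun z _ => by have := h' z; rwa [abs_norm] at this) (mem_univ y) (mem_univ x)

lemma Den.mul_b (A : ℝ) {m : E3 → ℝ} (hm : Continuous m) : ∃ B, 0 ≤ B ∧ (∀ x, ‖x‖ ≤ A → |m x| ≤ B) ∧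
    ∀ L f, Den A L f → Den A (B * L) (fun x => f x * m x) := by
  obtain ⟨B, hB⟩ := (isCompact_closedBall (0:E3) A).exists_bound_of_continuousOn hm.continuousOn
  have hB' : ∀ x, ‖x‖ ≤ A → |m x| ≤ |B| := fun x hx => (hB x (by simpa using hx)).trans (le_abs_self B)
  refine ⟨|B|, abs_nonneg _, hB', fun L f hf => ⟨hf.meas.mul hm.measurable, fun y => ?_, fun y hy => by rw [hf.supp y hy, zero_mul]⟩⟩
  rcases le_or_gt ‖y‖ A with h | h
  · rw [abs_mul, mul_comm]
    exact mul_le_mul (hB' y h) (hf.bd y) (abs_nonneg _) (abs_nonneg _)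
  · rw [hf.supp y h, zero_mul, abs_zero]; exact mul_nonneg (abs_nonneg _) hf.nn

lemma Den1.mul_b (A : ℝ) {m : E3 → ℝ} (hm : ContDiff ℝ 1 m) : ∃ B, 0 ≤ B ∧
    ∀ L f, Den1 A L f → Den1 A (B * L) (fun x => f x * m x) := by
  obtain ⟨B, hB, hb, h⟩ := Den.mul_b A hm.continuous
  obtain ⟨D, hD⟩ := (isCompact_closedBall (0:E3) A).exists_bound_of_continuousOn (hm.continuous_fderiv (by norm_num)).continuousOn
  have key : ∀ L f, Den1 A L f → ∀ x y, ‖x‖ ≤ A → |f x * m x - f y * m y| ≤ (B + |D|) * L * ‖x - y‖ := fun L f hf x y hx => by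
    have n1 := norm_nonneg (x - y)
    have n2 := hf.nn
    have e1 : |(f x - f y) * m x| ≤ L * ‖x - y‖ * B := by
      rw [abs_mul]; exact mul_le_mul (hf.lip x y) (hb x hx) (abs_nonneg _) (by positivity)
    rcases le_or_gt ‖y‖ A with hy | hy
    · have := (convex_closedBall (0:E3) A).norm_image_sub_le_of_norm_fderiv_le (𝕜 := ℝ) (fun z _ => hm.differentiable (by norm_num) z)
        (fun z hz => (hD z hz).trans (le_abs_self D)) (by simpa using hy : y ∈ _) (by simpa using hx : x ∈ _)
      have e2 : |f y * (m x - m y)| ≤ L * (|D| * ‖x - y‖) := by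
        rw [abs_mul]; exact mul_le_mul (hf.bd y) this (abs_nonneg _) n2
      rw [show f x * m x - f y * m y = (f x - f y) * m x + f y * (m x - m y) by ring]
      refine (abs_add_le _ _).trans (le_trans (add_le_add e1 e2) (by linarith))
    · rw [hf.supp y hy] at e1 ⊢
      rw [zero_mul, sub_zero]; rw [sub_zero] at e1
      refine e1.trans ?_
      have : 0 ≤ |D| * L * ‖x - y‖ := by positivity
      linarith
  refine ⟨B + |D|, by positivity, fun L f hf => ⟨⟨(h L f hf.toDen).meas, fun x => ((h L f hf.toDen).bd x).trans ?_, (h L f hf.toDen).supp⟩, fun x y => ?_⟩⟩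
  · exact mlr (by linarith [abs_nonneg D]) hf.nn
  · rcases le_or_gt ‖x‖ A with hx | hx
    · exact key L f hf x y hx
    · rcases le_or_gt ‖y‖ A with hy | hy
      · rw [abs_sub_comm, norm_sub_rev]; exact key L f hf y x hy
      · rw [hf.supp x hx, hf.supp y hy]; simp
        exact mul_nonneg (mul_nonneg (by positivity) hf.nn) (norm_nonneg _)

def rr2 (y : E3) : ℝ := y 0 ^2 + y 1 ^2
lemma rr2_cd {n} : ContDiff ℝ n rr2 := by unfold rr2; fun_prop

lemma hp_cv {A L g} (hg : Den A L g) : hp g = fun x => 1 * (1 * cv (fun y => g y * y 0) (N1 0) x +1 * cv (fun y => g y * y 1) (N1 1) x) +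
    1 * cv (fun y => g y * rr2 y) N0 x := by
  funext x
  obtain ⟨L2, h2⟩ := hg.mulc (g := rr2) (rr2_cd (n := 0)).continuous
  have key : ∀ i : Fin 3, Integrable (fun y => g y * y i * N1 i (x - y)) := fun i => by
    obtain ⟨L0, h0⟩ := hg.mulc (g := fun y => y i) (by fun_prop)
    refine (((pot_int h0 x).const_mul (x i)).sub (pot_int (h0.mulc (g := fun y => y i) (by fun_prop)).choose_spec x)).congr (Eventually.of_forall fun y => ?_)
    simp only [N1, PiLp.sub_apply, Pi.sub_apply]; ring
  have k2 : Integrable (fun y => g y * rr2 y * N0 (x - y)) := (pot_int h2 x).congr (Eventually.of_forall fun y => by simp only [N0]; ring)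
  rw [hp_eq hg, cv, cv, cv, one_mul, one_mul, one_mul, one_mul, ← integral_add (key 0) (key 1)]
  refine Eq.trans ?_ (integral_add ((key 0).add (key 1)) k2)
  congr 1; ext y
  simp only [N1, N0, rr2, PiLp.sub_apply, Pi.add_apply]; ring

lemma hp_cd {A L g} (hg : Den A L g) {m : ℕ∞} (h0 : ∀ i, ContDiff ℝ m (cv (fun y => g y * y i) (N1 i))) (h2 : ContDiff ℝ m (cv (fun y => g y * rr2 y) N0)) :
    ContDiff ℝ m (hp g) := by
  rw [hp_cv hg]
  exact (contDiff_const.mul ((contDiff_const.mul (h0 0)).add (contDiff_const.mul (h0 1)))).add (contDiff_const.mul h2)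

lemma hp_dd {A L g} (hg : Den A L g) (l : List E3) (h0 : ∀ i, ContDiff ℝ l.length (cv (fun y => g y * y i) (N1 i)))
    (h2 : ContDiff ℝ l.length (cv (fun y => g y * rr2 y) N0)) (x : E3) :
    dd l (hp g) x = dd l (cv (fun y => g y * y 0) (N1 0)) x + dd l (cv (fun y => g y * y 1) (N1 1)) x + dd l (cv (fun y => g y * rr2 y) N0) x := by
  rw [hp_cv hg, dd_lin _ _ l ((contDiff_const.mul (h0 0)).add (contDiff_const.mul (h0 1))) h2, dd_lin _ _ l (h0 0) (h0 1)]; ring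

lemma hpb_gen {A : ℝ} {D : ℝ → (E3 → ℝ) → Prop} (hD : ∀ L f, D L f → Den A L f)
    (hm : ∀ m : E3 → ℝ, ContDiff ℝ 1 m → ∃ B, 0 ≤ B ∧ ∀ L f, D L f → D (B * L) (fun x => f x * m x)) (l : List E3)
    (hb : ∀ d N far, Ker d N far → ∃ C, 0 ≤ C ∧ ∀ L f, D L f → ContDiff ℝ l.length (cv f N) ∧ ∀ x, |dd l (cv f N) x| ≤ C * L) :
    ∃ C, 0 ≤ C ∧ ∀ L f, D L f → ContDiff ℝ l.length (hp f) ∧ ∀ x, |dd l (hp f) x| ≤ C * L := by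
  choose B B0 hB using fun i : Fin 3 => hm (fun y => y i) (by fun_prop)
  obtain ⟨B2, B20, hB2⟩ := hm rr2 rr2_cd
  choose C C0 hC using fun i : Fin 3 => hb _ _ _ (kN1 i)
  obtain ⟨C2, C20, hC2⟩ := hb _ _ _ kN0
  refine ⟨C 0 * B 0 + C 1 * B 1 + C2 * B2, by have := C0 0; have := C0 1; have := B0 0; have := B0 1; positivity, fun L f hf => ?_⟩
  have a : ∀ i, _ := fun i => hC i _ _ (hB i _ _ hf)
  have b := hC2 _ _ (hB2 _ _ hf)
  refine ⟨by exact_mod_cast hp_cd (m := (l.length : ℕ)) (hD _ _ hf) (fun i => by exact_mod_cast (a i).1) (by exact_mod_cast b.1), fun x => ?_⟩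
  rw [hp_dd (hD _ _ hf) l (fun i => (a i).1) b.1]
  refine (abs_add_three _ _ _).trans ?_
  have := (a 0).2 x; have := (a 1).2 x; have := b.2 x
  linarith

lemma hp_b1 (A : ℝ) (l : List E3) (hl : l.length ≤1) :
    ∃ C, 0 ≤ C ∧ ∀ L f, Den A L f → ContDiff ℝ l.length (hp f) ∧ ∀ x, |dd l (hp f) x| ≤ C * L :=
  hpb_gen (D := Den A) (fun _ _ h => h) (fun m hm => by obtain ⟨B, a, b, c⟩ := Den.mul_b A hm.continuous; exact ⟨B, a, c⟩) l fun d N far hK => by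
    obtain ⟨C, a, b⟩ := hK.R1b A l hl
    exact ⟨C, a, fun L f h => ⟨(hK.R1 h).1.of_le (by exact_mod_cast hl), b f L h⟩⟩
lemma hp_b2 (A : ℝ) (l : List E3) (hl : l.length ≤2) :
    ∃ C, 0 ≤ C ∧ ∀ L f, Den1 A L f → ContDiff ℝ l.length (hp f) ∧ ∀ x, |dd l (hp f) x| ≤ C * L :=
  hpb_gen (D := Den1 A) (fun _ _ h => h.toDen) (fun m hm => Den1.mul_b A hm) l fun d N far hK => by
    obtain ⟨C, a, b⟩ := hK.R2b A l hl
    exact ⟨C, a, fun L f h => ⟨(hK.R2 h).1.of_le (by exact_mod_cast hl), b f L h⟩⟩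

lemma hp_sub {A L M f g} (hf : Den A L f) (hg : Den A M g) (x : E3) : hp (fun y => f y - g y) x = hp f x - hp g x := by
  have h : ∀ i : Fin 3, pot (fun y => (f y - g y) * y i) x = pot (fun y => f y * y i) x - pot (fun y => g y * y i) x := fun i => by
    rw [← pot_sub (hf.mulc (g := fun y => y i) (by fun_prop)).choose_spec (hg.mulc (g := fun y => y i) (by fun_prop)).choose_spec]
    congr 1; ext y; ring
  rw [hp, hp, hp, h, h]; ring

section jc
variable {P : Type*} [TopologicalSpace P]

lemma jc {V : Type*} [NormedAddCommGroup V] {Φ : P → E3 → V} (hc : ∀ p, Continuous (Φ p))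
    (h : ∀ p, ∀ η > 0, ∀ᶠ p' in 𝓝 p, ∀ x, ‖Φ p' x - Φ p x‖ ≤ η) : Continuous fun q : P × E3 => Φ q.1 q.2 := by
  refine continuous_iff_continuousAt.2 fun ⟨p, x⟩ => Metric.tendsto_nhds.2 fun η hη => ?_
  have h2 := Metric.tendsto_nhds.1 ((hc p).tendsto x) (η /2) (half_pos hη)
  filter_upwards [(h p (η /3) (by positivity)).prod_nhds h2] with ⟨p', x'⟩ ⟨a, b⟩
  have := a x'
  rw [← dist_eq_norm] at this
  change dist (Φ p' x') (Φ p x) < η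
  linarith [dist_triangle (Φ p' x') (Φ p x') (Φ p x)]

structure JC (f : P → E3 → ℝ) : Prop where
  c1 : ∀ p, ContDiff ℝ 1 (f p)
  c : Continuous fun q : P × E3 => f q.1 q.2
  d : Continuous fun q : P × E3 => fderiv ℝ (f q.1) q.2

namespace JC
variable {f g : P → E3 → ℝ}
lemma df (h : JC f) (p x) : DifferentiableAt ℝ (f p) x := (h.c1 p).differentiable (by norm_num) x

lemma add (hf : JC f) (hg : JC g) : JC fun p x => f p x + g p x :=
  ⟨fun p => (hf.c1 p).add (hg.c1 p), hf.c.add hg.c, by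
    simp only [fun p x => fderiv_fun_add (hf.df p x) (hg.df p x)]; exact hf.d.add hg.d⟩
lemma mul (hf : JC f) (hg : JC g) : JC fun p x => f p x * g p x :=
  ⟨fun p => (hf.c1 p).mul (hg.c1 p), hf.c.mul hg.c, by
    simp only [fun p x => fderiv_fun_mul (hf.df p x) (hg.df p x)]; exact (hf.c.smul hg.d).add (hg.c.smul hf.d)⟩
lemma comp (hf : JC f) {φ φ' : ℝ → ℝ} (hφ : ∀ s, HasDerivAt φ (φ' s) s) (hc : Continuous φ') : JC fun p x => φ (f p x) := by
  have e : ∀ p x, fderiv ℝ (fun x => φ (f p x)) x = φ' (f p x) • fderiv ℝ (f p) x := fun p x =>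
    ((hφ _).comp_hasFDerivAt x (hf.df p x).hasFDerivAt).fderiv
  have h1 : ContDiff ℝ 1 φ := contDiff_one_iff_deriv.2 ⟨fun s => (hφ s).differentiableAt, by rwa [funext fun s => (hφ s).deriv]⟩
  exact ⟨fun p => h1.comp (hf.c1 p), h1.continuous.comp hf.c, by simp only [e]; exact (hc.comp hf.c).smul hf.d⟩
lemma par {a : P → ℝ} (ha : Continuous a) : JC fun p (_ : E3) => a p :=
  ⟨fun p => contDiff_const, ha.comp continuous_fst, by simp [continuous_const]⟩
lemma fix {m : E3 → ℝ} (hm : ContDiff ℝ 1 m) : JC fun (_ : P) x => m x :=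
  ⟨fun p => hm, hm.continuous.comp continuous_snd, (hm.continuous_fderiv (by norm_num)).comp continuous_snd⟩

lemma op {A : ℝ} {W : (E3 → ℝ) → E3 → ℝ} (hs : ∀ f g L M, Den A L f → Den A M g → ∀ x, W (fun y => f y - g y) x = W f x - W g x)
    (h1 : ∀ f L, Den A L f → ContDiff ℝ 1 (W f)) {C : ℝ} (hC : 0 ≤ C) (b0 : ∀ f L, Den A L f → ∀ x, |W f x| ≤ C * L)
    (b1 : ∀ f L, Den A L f → ∀ x, ‖fderiv ℝ (W f) x‖ ≤ C * L) (hf : ∀ p, ∃ L, Den A L (f p))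
    (hd : ∀ p, ∀ η > 0, ∀ᶠ p' in 𝓝 p, Den A η (fun x => f p' x - f p x)) : JC fun p => W (f p) := by
  choose L hL using hf
  have a : ∀ p, ContDiff ℝ 1 (W (f p)) := fun p => h1 _ _ (hL p)
  have e : ∀ p p', (W fun y => f p' y - f p y) = fun x => W (f p') x - W (f p) x := fun p p' => funext fun x => hs _ _ _ _ (hL p') (hL p) x
  have k : ∀ η > 0, C * (η / (C +1)) ≤ η := fun η hη => by
    rw [mul_div_assoc', div_le_iff₀ (by positivity)]; nlinarith
  refine ⟨a, jc (fun p => (a p).continuous) fun p η hη => ?_, jc (fun p => (a p).continuous_fderiv (by norm_num)) fun p η hη => ?_⟩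
  · filter_upwards [hd p (η / (C +1)) (by positivity)] with p' hp x
    have := b0 _ _ hp x
    rw [e] at this; exact this.trans (k η hη)
  · filter_upwards [hd p (η / (C +1)) (by positivity)] with p' hp x
    have := b1 _ _ hp x
    rw [e, fderiv_fun_sub ((a p').differentiable (by norm_num) x) ((a p).differentiable (by norm_num) x)] at this
    exact this.trans (k η hη)

lemma pot {A : ℝ} (hf : ∀ p, ∃ L, Den A L (f p)) (hd : ∀ p, ∀ η > 0, ∀ᶠ p' in 𝓝 p, Den A η (fun x => f p' x - f p x)) :
    JC fun p => pot (f p) := by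
  obtain ⟨C, hC, h⟩ := pot_bd A
  obtain ⟨D, hD, h'⟩ := pot_bd1 A
  exact op (fun f g L M hf hg x => pot_sub hf hg x) (fun f L h => pot_c1 h) (add_nonneg hC hD)
    (fun f L hf x => (h f L hf x).trans (by nlinarith [hf.nn])) (fun f L hf x => (h' f L hf x).trans (by nlinarith [hf.nn])) hf hd

lemma hp {A : ℝ} (hf : ∀ p, ∃ L, Den A L (f p)) (hd : ∀ p, ∀ η > 0, ∀ᶠ p' in 𝓝 p, Den A η (fun x => f p' x - f p x)) :
    JC fun p => hp (f p) := by
  obtain ⟨C, hC, h⟩ := hp_b1 A [] (by simp)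
  choose D hD h' using fun i : Fin 3 => hp_b1 A [ee i] (by simp)
  have hS : 0 ≤ ∑ i, D i := Finset.sum_nonneg fun i _ => hD i
  refine op (C := C +3 * ∑ i, D i) (fun f g L M hf hg x => hp_sub hf hg x) (fun f L hf => by simpa using (h' 0 L f hf).1) (by positivity)
    (fun f L hf x => ((h L f hf).2 x).trans (by nlinarith [hf.nn])) (fun f L hf x => ?_) hf hd
  refine (clm_bd _ (B := (∑ i, D i) * L) fun i => ((h' i L f hf).2 x).trans (mlr ?_ hf.nn)).trans (by nlinarith [hf.nn])
  exact Finset.single_le_sum (fun j _ => hD j) (Finset.mem_univ i)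

lemma unif (hf : JC f) (A : ℝ) (p : P) {η : ℝ} (hη : 0 < η) : ∀ᶠ p' in 𝓝 p, ∀ x ∈ closedBall (0:E3) A,
    |f p' x - f p x| ≤ η ∧ ‖fderiv ℝ (f p') x - fderiv ℝ (f p) x‖ ≤ η := by
  refine (isCompact_closedBall (0:E3) A).eventually_forall_of_forall_eventually fun x _ => ?_
  have e1 : Continuous fun q : P × E3 => |f q.1 q.2 - f p q.2| := (hf.c.sub ((hf.c1 p).continuous.comp continuous_snd)).abs
  have e2 : Continuous fun q : P × E3 => ‖fderiv ℝ (f q.1) q.2 - fderiv ℝ (f p) q.2‖ :=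
    (hf.d.sub (((hf.c1 p).continuous_fderiv (by norm_num)).comp continuous_snd)).norm
  filter_upwards [e1.continuousAt.eventually_lt (continuousAt_const (y := η)) (by simpa using hη),
    e2.continuousAt.eventually_lt (continuousAt_const (y := η)) (by simpa using hη)] with q h1 h2 using ⟨h1.le, h2.le⟩

lemma den1 (hf : JC f) {A : ℝ} (hs : ∀ p x, A < ‖x‖ → f p x =0) (p : P) {η : ℝ} (hη : 0 < η) :
    ∀ᶠ p' in 𝓝 p, Den1 A η (fun x => f p' x - f p x) := by
  filter_upwards [hf.unif A p hη] with p' h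
  have e : ∀ x, fderiv ℝ (fun x => f p' x - f p x) x = fderiv ℝ (f p') x - fderiv ℝ (f p) x := fun x => fderiv_fun_sub (hf.df p' x) (hf.df p x)
  refine den1_of ((hf.c1 p').sub (hf.c1 p)) (fun x hx => by rw [hs p x hx, hs p' x hx, sub_zero]) (fun x => ?_) fun x => ?_
  · rcases le_or_gt ‖x‖ A with hx | hx
    · exact (h x (by simpa using hx)).1
    · rw [hs p x hx, hs p' x hx]; simpa using hη.le
  · rw [e]
    rcases le_or_gt ‖x‖ A with hx | hx
    · exact (h x (by simpa using hx)).2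
    · rw [fd_supp (hs p) x hx, fd_supp (hs p') x hx]; simpa using hη.le
end JC
end jc

lemma clampL {φ φ' : ℝ → ℝ} (h : ∀ s, HasDerivAt φ (φ' s) s) (hc : Continuous φ') {B D : ℝ} (hB : 0 ≤ B) (hD0 : 0 ≤ D)
    (hD : ∀ s t, |s| ≤ B → |t| ≤ B → |φ' s - φ' t| ≤ D * |s - t|) :
    ∃ f, ContDiff ℝ 1 f ∧ (∀ s t, |deriv f s - deriv f t| ≤ D * |s - t|) ∧ ∀ s, |s| ≤ B → f s = φ s := by
  let cl : ℝ → ℝ := fun t => max (min t B) (-B)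
  have c0 : Continuous cl := by fun_prop
  have c1 : ∀ t, |cl t| ≤ B := fun t => abs_le.2 ⟨le_max_right _ _, max_le (min_le_right _ _) (by linarith)⟩
  have c2 : ∀ s t, |cl s - cl t| ≤ |s - t| := fun s t => (abs_max_sub_max_le_abs _ _ _).trans (abs_inf_sub_inf_le_abs _ _ _)
  have hf : ∀ s, HasDerivAt (fun s => φ 0 + ∫ t in (0:ℝ)..s, φ' (cl t)) (φ' (cl s)) s := fun s =>
    ((hc.comp c0).integral_hasStrictDerivAt 0 s).hasDerivAt.const_add _
  have hd := fun s => (hf s).deriv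
  refine ⟨_, contDiff_one_iff_deriv.2 ⟨fun s => (hf s).differentiableAt, by rw [funext hd]; exact hc.comp c0⟩, fun s t => ?_, fun s hs => ?_⟩
  · rw [hd, hd]; exact (hD _ _ (c1 s) (c1 t)).trans (mll (c2 s t) hD0)
  · have : ∫ t in (0:ℝ)..s, φ' (cl t) = ∫ t in (0:ℝ)..s, φ' t := intervalIntegral.integral_congr fun t ht => by
      have h1 : |t| ≤ B := by
        have := abs_sub_left_of_mem_uIcc ht
        rw [sub_zero, sub_zero] at this; linarith
      have h2 := abs_le.1 h1
      simp only [cl, min_eq_left h2.2, max_eq_left h2.1]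
    simp only [this]
    rw [intervalIntegral.integral_eq_sub_of_hasDerivAt (fun t _ => h t) (hc.intervalIntegrable _ _)]; ring

lemma TW.comp' {φ φ' : ℝ → ℝ} (h : ∀ s, HasDerivAt φ (φ' s) s) (hc : Continuous φ')
    (hD : ∀ B, ∃ D, 0 ≤ D ∧ ∀ s t, |s| ≤ B → |t| ≤ B → |φ' s - φ' t| ≤ D * |s - t|) {A : ℝ} {u : E3 → ℝ} (h3 : ContDiff ℝ 3 u)
    (hs : ∀ x, A < ‖x‖ → u x =0) : TW fun x => φ (u x) := by
  obtain ⟨B, hB, hb⟩ := cs_bdd h3.continuous hs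
  obtain ⟨D, hD0, hD⟩ := hD B
  obtain ⟨f, a, b, c⟩ := clampL h hc hB hD0 hD
  obtain ⟨L, hL⟩ := c2_den2 (h3.of_le (by norm_num)) hs
  have := TW.comp a b hL h3
  rwa [funext fun x => c _ (hb x)] at this

def Hol (a : ℝ) {V : Type*} [NormedAddCommGroup V] (F : E3 → V) : Prop := ∃ C, 0 ≤ C ∧ (∀ x, ‖F x‖ ≤ C) ∧ ∀ x y, ‖F x - F y‖ ≤ C * ‖x - y‖ ^ a

section
variable {a : ℝ} {V : Type*} [NormedAddCommGroup V] [NormedSpace ℝ V]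
lemma Hol.add {F G : E3 → V} (hF : Hol a F) (hG : Hol a G) : Hol a fun x => F x + G x := by
  obtain ⟨C, c0, c1, c2⟩ := hF
  obtain ⟨D, d0, d1, d2⟩ := hG
  refine ⟨C + D, by positivity, fun x => (norm_add_le _ _).trans (add_le_add (c1 x) (d1 x)), fun x y => ?_⟩
  rw [add_sub_add_comm, add_mul]; exact (norm_add_le _ _).trans (add_le_add (c2 x y) (d2 x y))
lemma Hol.smul {F : E3 → ℝ} {G : E3 → V} (hF : Hol a F) (hG : Hol a G) : Hol a fun x => F x • G x := by
  obtain ⟨C, c0, c1, c2⟩ := hF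
  obtain ⟨D, d0, d1, d2⟩ := hG
  have p : 0 ≤ C * D := by positivity
  refine ⟨2 * (C * D), by positivity, fun x => ?_, fun x y => ?_⟩
  · rw [norm_smul]; linarith [mul_le_mul (c1 x) (d1 x) (norm_nonneg _) c0]
  · rw [show F x • G x - F y • G y = F x • (G x - G y) + (F x - F y) • G y by rw [smul_sub, sub_smul]; abel]
    refine (norm_add_le _ _).trans ?_
    rw [norm_smul, norm_smul]
    have := mul_le_mul (c1 x) (d2 x y) (norm_nonneg _) c0
    have := mul_le_mul (c2 x y) (d1 y) (norm_nonneg _) (by positivity)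
    linarith
lemma Hol.of (h0 : 0 ≤ a) (h1 : a ≤1) {F : E3 → V} {B L : ℝ} (hB : ∀ x, ‖F x‖ ≤ B) (hL : ∀ x y, ‖F x - F y‖ ≤ L * ‖x - y‖) : Hol a F := by
  have b0 : 0 ≤ B := (norm_nonneg _).trans (hB 0)
  refine ⟨|L| +2 * B, by positivity, fun x => by linarith [hB x, abs_nonneg L], fun x y => ?_⟩
  have n := norm_nonneg (x - y)
  have : 0 ≤ ‖x - y‖ ^ a := by positivity
  rcases le_or_gt ‖x - y‖ 1 with h | h
  · have e : ‖x - y‖ ≤ ‖x - y‖ ^ a := by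
      rcases n.eq_or_lt with h' | h'
      · rw [← h']; positivity
      · simpa using Real.rpow_le_rpow_of_exponent_ge h' h h1
    refine (hL x y).trans ?_
    nlinarith [le_abs_self L, abs_nonneg L, mlr (le_abs_self L) n]
  · have e := Real.one_le_rpow h.le h0
    refine (norm_sub_le _ _).trans ?_
    nlinarith [hB x, hB y, abs_nonneg L]
end

lemma c2_hol {a : ℝ} (h0 : 0 ≤ a) (h1 : a ≤1) {f : E3 → ℝ} {A : ℝ} (hf : ContDiff ℝ 2 f) (hA : ∀ x, A < ‖x‖ → f x =0) :
    Hol a f ∧ Hol a (fderiv ℝ f) := by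
  obtain ⟨L, hL⟩ := c2_den2 hf hA
  obtain ⟨D, hD, h'⟩ := cs_bdd (hf.continuous_fderiv (by norm_num)).norm (A := A) fun x hx => by rw [fd_supp hA x hx, norm_zero]
  exact ⟨.of h0 h1 hL.bd hL.lip, .of h0 h1 (fun x => by have := h' x; rwa [abs_norm] at this) fun x y => by simpa using hL.hol x y⟩

lemma HH_d1 {n : ℝ} (hn : 1 < n) (C s : ℝ) : HasDerivAt (fun s => HH n C (s - 1)) (HH (n - 1) (C * n) (s - 1)) s := by
  simpa using (HH_deriv hn C (s - 1)).comp_sub_const s 1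
lemma HH_neg {n : ℝ} (hn : 0 < n) (C : ℝ) {s : ℝ} (hs : s ≤0) : HH n C s =0 := by
  rw [HH, max_eq_right hs, Real.zero_rpow hn.ne', mul_zero]

lemma hol_core {n : ℝ} (hn : 1 < n) (C : ℝ) {A : ℝ} {u : E3 → ℝ} (hu : ContDiff ℝ 2 u) (hs : ∀ x, A < ‖x‖ → u x =0) :
    HolderC1 (min (n - 1) 1) (fun x => HH n C (u x - 1)) ∧ ∀ κ : E3 → ℝ, ContDiff ℝ 2 κ → (∀ x, A < ‖x‖ → κ x =0) →
      ∃ L, Den2 A L (min (n - 1) 1) (fun x => HH n C (u x - 1) * κ x) := by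
  set a := min (n - 1) 1 with ha
  have a0 : 0 < a := lt_min (by linarith) one_pos
  have a1 : a ≤1 := min_le_right _ _
  have hn' : 0 < n - 1 := by linarith
  have cH := HH_cont hn' (C * n)
  have h1 : ContDiff ℝ 1 (fun s => HH n C (s - 1)) := contDiff_one_iff_deriv.2 ⟨fun s => (HH_d1 hn C s).differentiableAt, by
    rw [funext fun s => (HH_d1 hn C s).deriv]; exact cH.comp (by fun_prop)⟩
  have u1 : ContDiff ℝ 1 u := hu.of_le (by norm_num)
  have r1 : ContDiff ℝ 1 fun x => HH n C (u x - 1) := h1.comp u1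
  have e : fderiv ℝ (fun x => HH n C (u x - 1)) = fun x => HH (n - 1) (C * n) (u x - 1) • fderiv ℝ u x := funext fun x =>
    ((HH_d1 hn C _).comp_hasFDerivAt x (u1.differentiable (by norm_num) x).hasFDerivAt).fderiv
  obtain ⟨k0, k1⟩ := c2_hol a0.le a1 hu hs
  have z : ∀ x, A < ‖x‖ → ∀ {m : ℝ} (C), 0 < m → HH m C (u x - 1) =0 := fun x hx m C hm => HH_neg hm C (by rw [hs x hx]; norm_num)
  have H1 : Hol a fun x => HH (n - 1) (C * n) (u x - 1) := by
    obtain ⟨L, hL⟩ := c2_den2 hu hs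
    obtain ⟨B, hB, hb⟩ := cs_bdd (A := A) (cH.comp (u1.continuous.sub continuous_const : Continuous fun x => u x - 1)) fun x hx => z x hx _ hn'
    obtain ⟨D, hD, hd⟩ := HH_hol hn' (C * n) L
    refine ⟨B + D * L ^ a, by have := hL.nn; positivity, fun x => (hb x).trans ?_, fun x y => ?_⟩
    · have := hL.nn; have : 0 ≤ D * L ^ a := by positivity
      linarith
    · have w : ∀ x, u x - 1 ≤ L := fun x => by linarith [(abs_le.1 (hL.bd x)).2]
      refine (hd _ _ (w x) (w y)).trans ?_
      rw [sub_sub_sub_cancel_right]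
      have := Real.rpow_le_rpow (abs_nonneg _) (hL.lip x y) a0.le
      rw [Real.mul_rpow hL.nn (norm_nonneg _)] at this
      have t : 0 ≤ ‖x - y‖ ^ a := by positivity
      nlinarith
  have H2 : Hol a (fderiv ℝ fun x => HH n C (u x - 1)) := by rw [e]; exact H1.smul k1
  refine ⟨⟨r1, by obtain ⟨c, _, _, h⟩ := H2; exact ⟨c, h⟩⟩, fun κ hκ sκ => ?_⟩
  obtain ⟨k2, k3⟩ := c2_hol a0.le a1 hκ sκ
  have κ1 : ContDiff ℝ 1 κ := hκ.of_le (by norm_num)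
  have H3 : Hol a fun x => HH n C (u x - 1) := by
    obtain ⟨L, hL⟩ := c1_den1 (A := A) r1 fun x hx => z x hx _ (by linarith)
    exact .of a0.le a1 hL.bd hL.lip
  obtain ⟨c, _, _, h⟩ := (H3.smul k3).add (k2.smul H2)
  refine hol_den2 (C := c) (r1.mul κ1) (fun x hx => by rw [sκ x hx, mul_zero]) fun x y => ?_
  have e2 := fun x => fderiv_fun_mul (r1.differentiable (by norm_num) x) (κ1.differentiable (by norm_num) x)
  rw [e2, e2]; exact h x y

lemma dd_shift (w : E3) (l : List E3) : ∀ f : E3 → ℝ, dd l (fun z => f (z + w)) = fun z => dd l f (z + w) := by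
  induction l with
  | nil => exact fun f => rfl
  | cons v l ih => exact fun f => by rw [dd, dd, ← ih]; congr 1; ext x; simp only [pd, fderiv_comp_add_right]

lemma h3_of {f : E3 → ℝ} (hf : ContDiff ℝ 3 f) {a : ℝ} (h : ∀ i j k, ∃ C, ∀ x y, |dd [ee i, ee j, ee k] f x - dd [ee i, ee j, ee k] f y| ≤ C * ‖x - y‖ ^ a) :
    HolderC3 a f := by
  choose C hC using h
  obtain ⟨D, hD, hb⟩ := iter_bd (m := 3)
  refine ⟨hf, D * ∑ i, ∑ j, ∑ k, |C i j k|, fun x y => ?_⟩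
  have hs : ContDiff ℝ 3 fun z => f (z + (y - x)) := hf.comp (contDiff_id.add contDiff_const)
  have e : iteratedFDeriv ℝ 3 (fun z => f z - f (z + (y - x))) x = iteratedFDeriv ℝ 3 f x - iteratedFDeriv ℝ 3 f y := by
    have := iteratedFDeriv_sub_apply (i := 3) (x := x) hf.contDiffAt hs.contDiffAt
    rw [iteratedFDeriv_comp_add_right, add_sub_cancel] at this
    exact this
  rw [← e, mul_assoc]
  refine hb _ _ x (hf.sub hs) fun l hl hv => ?_
  obtain ⟨u, v, w, rfl⟩ := List.length_eq_three.1 hl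
  simp only [List.mem_cons, List.not_mem_nil, or_false, forall_eq_or_imp, forall_eq] at hv
  obtain ⟨⟨i, rfl⟩, ⟨j, rfl⟩, ⟨k, rfl⟩⟩ := hv
  rw [dd_sub [ee i, ee j, ee k] (by exact_mod_cast hf) (by exact_mod_cast hs), dd_shift]
  beta_reduce; rw [add_sub_cancel]
  refine (hC i j k x y).trans (mlr ?_ (by positivity))
  have s := fun {g : Fin 3 → ℝ} (hg : ∀ i, 0 ≤ g i) (i) => Finset.single_le_sum (fun j _ => hg j) (Finset.mem_univ i)
  exact (le_abs_self _).trans ((s (g := fun k => |C i j k|) (fun _ => abs_nonneg _) k).trans ((s (g := fun j => ∑ k, |C i j k|)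
    (fun _ => by positivity) j).trans (s (g := fun i => ∑ j, ∑ k, |C i j k|) (fun _ => by positivity) i)))

section fam
variable {P : Type*} [TopologicalSpace P]
def Ps (ep : P → ℝ) (G : P → E3 → ℝ) (p : P) (x : E3) : ℝ := ep p / c0 * hp (G p) x
def Uu (om ep lam : P → ℝ) (K : ℝ → ℝ) (ρ G : P → E3 → ℝ) (p : P) (x : E3) : ℝ :=
  pot (ρ p) x + lam p + om p ^2 * (1 /2 * rr2 x) + (-ep p) * K (Ps ep G p x)

structure Fam (A B n C : ℝ) (χ : E3 → ℝ) (k K : ℝ → ℝ) (om ep lam : P → ℝ) (ρ G : P → E3 → ℝ) : Prop where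
  cχ : ContDiff ℝ 3 χ
  one : ∀ x, ‖x‖ ≤ B → χ x =1
  zer : ∀ x, A < ‖x‖ → χ x =0
  nn : ∀ x, 0 ≤ χ x
  le1 : ∀ x, χ x ≤1
  hn : 1 < n
  ck : ContDiff ℝ 2 k
  hK : ∀ s, HasDerivAt K (k s) s
  com : Continuous om
  cep : Continuous ep
  clam : Continuous lam
  dρ : ∀ p, ∃ L, Den A L (ρ p)
  dG : ∀ p, ∃ L, Den A L (G p)
  tρ : ∀ p, ∀ η > 0, ∀ᶠ p' in 𝓝 p, Den A η (fun x => ρ p' x - ρ p x)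
  tG : ∀ p, ∀ η > 0, ∀ᶠ p' in 𝓝 p, Den A η (fun x => G p' x - G p x)
  eρ : ∀ p x, ‖x‖ ≤ A → ρ p x = HH n C (Uu om ep lam K ρ G p x)
  eG : ∀ p x, G p x = ρ p x * k (Ps ep G p x)
  neg : ∀ p x, B ≤ ‖x‖ → ‖x‖ ≤ A → Uu om ep lam K ρ G p x ≤0

namespace Fam
variable {A B n C : ℝ} {χ : E3 → ℝ} {k K : ℝ → ℝ} {om ep lam : P → ℝ} {ρ G : P → E3 → ℝ}

lemma cK (h : Fam A B n C χ k K om ep lam ρ G) : ContDiff ℝ 3 K := by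
  refine (contDiff_succ_iff_deriv (n := 2)).2 ⟨fun s => (h.hK s).differentiableAt, by norm_num, ?_⟩
  rw [funext fun s => (h.hK s).deriv]; exact h.ck

lemma z (h : Fam A B n C χ k K om ep lam ρ G) (p x) (hx : B ≤ ‖x‖) : ρ p x =0 := by
  rcases le_or_gt ‖x‖ A with h' | h'
  · rw [h.eρ p x h', HH_neg (by linarith [h.hn]) C (h.neg p x hx h')]
  · obtain ⟨L, hL⟩ := h.dρ p; exact hL.supp x h'

lemma rho (h : Fam A B n C χ k K om ep lam ρ G) (p x) : ρ p x = HH n C (χ x * (Uu om ep lam K ρ G p x +1) - 1) := by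
  have n0 : 0 < n := by linarith [h.hn]
  rcases le_or_gt ‖x‖ A with h' | h'
  · rw [h.eρ p x h']
    rcases le_or_gt ‖x‖ B with hb | hb
    · rw [h.one x hb]; congr 1; ring
    · have := h.neg p x hb.le h'
      rw [HH_neg n0 C this, HH_neg n0]
      nlinarith [h.nn x, h.le1 x]
  · obtain ⟨L, hL⟩ := h.dρ p
    rw [hL.supp x h', h.zer x h', HH_neg n0]; norm_num

lemma jΨ (h : Fam A B n C χ k K om ep lam ρ G) : JC (Ps ep G) := (JC.par (h.cep.div_const c0)).mul (JC.hp h.dG h.tG)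
lemma jρ (h : Fam A B n C χ k K om ep lam ρ G) : JC ρ := by
  have hU : JC (Uu om ep lam K ρ G) := (((JC.pot h.dρ h.tρ).add (.par h.clam)).add ((JC.par (h.com.pow 2)).mul
    (.fix (contDiff_const.mul rr2_cd)))).add ((JC.par h.cep.neg).mul (h.jΨ.comp h.hK h.ck.continuous))
  have := ((JC.fix (P := P) (h.cχ.of_le (by norm_num))).mul (hU.add (.par continuous_const (a := fun _ => 1)))).comp
    (fun s => HH_d1 h.hn C s) ((HH_cont (by linarith [h.hn]) _).comp (by fun_prop))
  rwa [← funext fun p => funext (h.rho p)] at this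
lemma jG (h : Fam A B n C χ k K om ep lam ρ G) : JC G := by
  have := h.jρ.mul (h.jΨ.comp (fun s => (h.ck.differentiable (by norm_num) s).hasDerivAt) (h.ck.continuous_deriv (by norm_num)))
  rwa [← funext fun p => funext (h.eG p)] at this

lemma sρ (h : Fam A B n C χ k K om ep lam ρ G) (p x) (hx : A < ‖x‖) : ρ p x =0 := by obtain ⟨L, hL⟩ := h.dρ p; exact hL.supp x hx
lemma sG (h : Fam A B n C χ k K om ep lam ρ G) (p x) (hx : A < ‖x‖) : G p x =0 := by rw [h.eG, h.sρ p x hx, zero_mul]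

lemma gm (h : Fam A B n C χ k K om ep lam ρ G) (p) (m : ℝ → ℝ → ℝ) (x) (hm : ∀ a, m 1 a = a) : G p x = ρ p x * m (χ x) (k (Ps ep G p x)) := by
  rw [h.eG]
  rcases le_or_gt ‖x‖ B with hb | hb
  · rw [h.one x hb, hm]
  · rw [h.z p x hb.le]; simp

lemma cU (h : Fam A B n C χ k K om ep lam ρ G) (p) {j : WithTop ℕ∞} (hj' : j ≤3) (h1 : ContDiff ℝ j (pot (ρ p))) (h2 : ContDiff ℝ j (Ps ep G p)) :
    ContDiff ℝ j fun x => χ x * (Uu om ep lam K ρ G p x +1) := by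
  exact (h.cχ.of_le hj').mul ((((h1.add contDiff_const).add (contDiff_const.mul (contDiff_const.mul rr2_cd))).add
    (contDiff_const.mul ((h.cK.of_le hj').comp h2))).add contDiff_const)

lemma c2Ψ (h : Fam A B n C χ k K om ep lam ρ G) (p) : ContDiff ℝ 2 (Ps ep G p) := by
  obtain ⟨L, hL⟩ := c1_den1 (h.jG.c1 p) (h.sG p)
  obtain ⟨_, _, b⟩ := hp_b2 A [ee 0, ee 0] (by simp)
  exact contDiff_const.mul (by exact_mod_cast (b _ _ hL).1)

lemma core (h : Fam A B n C χ k K om ep lam ρ G) (p) : HolderC1 (min (n - 1) 1) (ρ p) ∧ (∃ L, Den2 A L (min (n - 1) 1) (ρ p)) ∧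
    ∀ m : E3 → ℝ, ContDiff ℝ 2 m → ∃ L, Den2 A L (min (n - 1) 1) (fun x => G p x * m x) := by
  obtain ⟨M, hM⟩ := c1_den1 (h.jρ.c1 p) (h.sρ p)
  have := hol_core h.hn C (A := A) (h.cU p (j := 2) (by norm_num) (by rw [← cv_N0]; exact_mod_cast (kN0.R2 hM).1) (by exact_mod_cast h.c2Ψ p))
    (fun x hx => by rw [h.zer x hx, zero_mul])
  simp only [← h.rho] at this
  have χ2 : ContDiff ℝ 2 χ := h.cχ.of_le (by norm_num)
  refine ⟨this.1, ?_, fun m hm => ?_⟩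
  · have := this.2 χ χ2 h.zer
    rwa [funext fun x => show ρ p x * χ x = ρ p x from ?_] at this
    rcases le_or_gt ‖x‖ B with hb | hb
    · rw [h.one x hb, mul_one]
    · rw [h.z p x hb.le, zero_mul]
  · have := this.2 (fun x => χ x * k (Ps ep G p x) * m x) ((χ2.mul (h.ck.comp (h.c2Ψ p))).mul hm) fun x hx => by rw [h.zer x hx]; ring
    convert this using 4 with L x; rw [h.gm p (fun a b => a * b) x (by simp)]; ring

lemma amin (h : Fam A B n C χ k K om ep lam ρ G) : 0 < min (n - 1) 1 := lt_min (by linarith [h.hn]) one_pos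

lemma c3g (h : Fam A B n C χ k K om ep lam ρ G) (p) {d N far} (hK : Ker d N far) (m : E3 → ℝ) (hm : ContDiff ℝ 2 m) :
    ContDiff ℝ 3 (cv (fun y => G p y * m y) N) := by
  obtain ⟨L, hL⟩ := (h.core p).2.2 m hm
  exact (hK.R3 h.amin (min_le_right _ _) hL).1

lemma c3hp (h : Fam A B n C χ k K om ep lam ρ G) (p) : ContDiff ℝ 3 (hp (G p)) := by
  obtain ⟨L, hL⟩ := h.dG p
  exact_mod_cast hp_cd hL (m := 3) (fun i => by exact_mod_cast h.c3g p (kN1 i) (fun y => y i) (by fun_prop)) (by exact_mod_cast h.c3g p kN0 rr2 rr2_cd)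

lemma tw (h : Fam A B n C χ k K om ep lam ρ G) (p) (hn2 : 1 ≤ n - 1) : TW fun y => G p y * rr2 y := by
  obtain ⟨M, hM⟩ := (h.core p).2.1
  have c3 : ContDiff ℝ 3 (Ps ep G p) := contDiff_const.mul (h.c3hp p)
  have cu := h.cU p (j := 3) le_rfl (by rw [← cv_N0]; exact_mod_cast (kN0.R3 h.amin (min_le_right _ _) hM).1) (by exact_mod_cast c3)
  have t1 := TW.comp' (A := A) (fun s => HH_d1 h.hn C s) ((HH_cont (by linarith [h.hn]) _).comp (by fun_prop)) (fun B => by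
    obtain ⟨D, h0, hD⟩ := HH_hol (β := n - 1) (by linarith) (C * n) B
    refine ⟨D, h0, fun s t hs ht => ?_⟩
    have := hD (s - 1) (t - 1) (by linarith [(abs_le.1 hs).2]) (by linarith [(abs_le.1 ht).2])
    rwa [min_eq_right hn2, Real.rpow_one, sub_sub_sub_cancel_right] at this) cu (fun x hx => by rw [h.zer x hx, zero_mul])
  have k1 : ContDiff ℝ 1 (deriv k) := by
    have := h.ck; rw [show (2 : WithTop ℕ∞) =1 +1 by norm_num] at this; exact (contDiff_succ_iff_deriv.1 this).2.2
  have t2 := TW.comp' (A := A) (u := fun x => χ x * Ps ep G p x) (fun s => (h.ck.differentiable (by norm_num) s).hasDerivAt) k1.continuous (fun B => by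
    obtain ⟨D, hD⟩ := (isCompact_closedBall (0:ℝ) B).exists_bound_of_continuousOn (k1.continuous_deriv (by norm_num)).continuousOn
    refine ⟨|D|, abs_nonneg _, fun s t hs ht => ?_⟩
    exact (convex_closedBall (0:ℝ) B).norm_image_sub_le_of_norm_deriv_le (fun z _ => k1.differentiable (by norm_num) z)
      (fun z hz => (hD z hz).trans (le_abs_self D)) (by simpa using ht) (by simpa using hs)) (h.cχ.mul c3) (fun x hx => by rw [h.zer x hx, zero_mul])
  have t3 := TW.comp' (A := A) (φ := id) (φ' := fun _ => 1) (u := fun x => χ x * rr2 x) (fun s => hasDerivAt_id s) continuous_const (fun B => ⟨0, le_rfl, fun s t _ _ => by simp⟩)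
    (h.cχ.mul rr2_cd) (fun x hx => by rw [h.zer x hx, zero_mul])
  have := (t1.mul t2).mul t3
  simp only [← h.rho] at this
  convert this using 2 with x
  rcases le_or_gt ‖x‖ B with hb | hb
  · rw [h.eG, h.one x hb]; simp
  · rw [h.eG, h.z p x hb.le]; simp

lemma h3 (h : Fam A B n C χ k K om ep lam ρ G) (p) : HolderC3 (min (n - 1) 1) (Ps ep G p) := by
  obtain ⟨L, hL⟩ := h.dG p
  have key : ∀ i j l, ∃ C, ∀ x y, |dd [ee i, ee j, ee l] (hp (G p)) x - dd [ee i, ee j, ee l] (hp (G p)) y| ≤ C * ‖x - y‖ ^ min (n - 1) 1 := fun i j l => by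
    have g : ∀ (d N far) (hK : Ker d N far) (m : E3 → ℝ), ContDiff ℝ 2 m → (1 ≤ n - 1 → (∀ M, Den2 A M 1 (fun y => G p y * m y) →
        ∃ C, ∀ i j k x y, |dd [ee i, ee j, ee k] (cv (fun y => G p y * m y) N) x - dd [ee i, ee j, ee k] (cv (fun y => G p y * m y) N) y| ≤ C * ‖x - y‖)) →
        ∃ C, ∀ x y, |dd [ee i, ee j, ee l] (cv (fun y => G p y * m y) N) x - dd [ee i, ee j, ee l] (cv (fun y => G p y * m y) N) y| ≤ C * ‖x - y‖ ^ min (n - 1) 1 := by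
      intro d N far hK m hm h1
      obtain ⟨M, hM⟩ := (h.core p).2.2 m hm
      rcases le_or_gt 1 (n - 1) with hn | hn
      · rw [min_eq_right hn] at hM ⊢
        obtain ⟨C, hC⟩ := h1 hn M hM
        exact ⟨C, fun x y => by rw [Real.rpow_one]; exact hC i j l x y⟩
      · exact hK.hold h.amin (by rwa [min_eq_left hn.le]) hM _ rfl
    obtain ⟨C0, a0⟩ := g _ _ _ (kN1 0) (fun y => y 0) (by fun_prop) fun _ M hM => R4_0 (kN1 0) hM
    obtain ⟨C1, a1⟩ := g _ _ _ (kN1 1) (fun y => y 1) (by fun_prop) fun _ M hM => R4_0 (kN1 1) hM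
    obtain ⟨C2, a2⟩ := g _ _ _ kN0 rr2 rr2_cd fun h1 M hM => R4_1 hM (h.tw p h1)
    refine ⟨C0 + C1 + C2, fun x y => ?_⟩
    have e := hp_dd hL [ee i, ee j, ee l] (fun i => by exact_mod_cast h.c3g p (kN1 i) (fun y => y i) (by fun_prop)) (by exact_mod_cast h.c3g p kN0 rr2 rr2_cd)
    rw [e, e, add_sub_add_comm, add_sub_add_comm, add_mul, add_mul]
    exact (abs_add_three _ _ _).trans (add_le_add (add_le_add (a0 x y) (a1 x y)) (a2 x y))
  refine h3_of (f := Ps ep G p) (contDiff_const.mul (h.c3hp p)) fun i j l => ?_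
  obtain ⟨D, hD⟩ := key i j l
  have e : ∀ x, dd [ee i, ee j, ee l] (Ps ep G p) x = ep p / c0 * dd [ee i, ee j, ee l] (hp (G p)) x := fun x => by
    have := congrFun (dd_lin (f := hp (G p)) (g := hp (G p)) (ep p / c0) 0 [ee i, ee j, ee l] (by exact_mod_cast h.c3hp p) (by exact_mod_cast h.c3hp p)) x
    simp only [zero_mul, add_zero] at this
    exact this
  refine ⟨|ep p / c0| * D, fun x y => ?_⟩
  rw [e, e, ← mul_sub, abs_mul, mul_assoc]
  exact mll (hD x y) (abs_nonneg _)
end Fam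
end fam

lemma SymE.ax {f} (h : SymE f) : Axisym f := ⟨fun r z => f (mk3 r 0 |z|), h⟩
lemma SymE.ev {f} (h : SymE f) : EvenZ f := fun x => by
  rw [h, h x]; congr 1
  simp only [fold, reflect3, cylRad, mk3_0, mk3_1, mk3_2, abs_neg]

lemma hor_le (x y : E3) : |x 0 * y 0 + x 1 * y 1| ≤ ‖x‖ * ‖y‖ := by
  refine abs_le_of_sq_le_sq ?_ (by positivity)
  rw [mul_pow, nsq, nsq]
  nlinarith [sq_nonneg (x 0 * y 1 - x 1 * y 0), mul_nonneg (sq_nonneg (x 2)) (sq_nonneg (y 2)),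
    mul_nonneg (sq_nonneg (x 2)) (sq_nonneg (y 0)), mul_nonneg (sq_nonneg (x 2)) (sq_nonneg (y 1)),
    mul_nonneg (sq_nonneg (x 0)) (sq_nonneg (y 2)), mul_nonneg (sq_nonneg (x 1)) (sq_nonneg (y 2))]

lemma hp_decay {A L G} (hA : 0 < A) (h : SymE G) (hG : Den A L G) : Tendsto (hp G) (cocompact E3) (𝓝 0) := by
  have t : Tendsto (fun x : E3 => (∫ y, |G y|) * (2 * A ^2) / ‖x‖) (cocompact E3) (𝓝 0) :=
    (tendsto_norm_cocompact_atTop (E := E3)).const_div_atTop _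
  refine squeeze_zero_norm' ?_ t
  filter_upwards [(tendsto_norm_cocompact_atTop (E := E3)).eventually_ge_atTop (2 * A)] with x hx
  have x0 : 0 < ‖x‖ := by linarith
  have hz : ∫ y, G y * (x 0 * y 0 + x 1 * y 1) / ‖x‖ =0 := by
    have e := integral_neg_eq_self (fun y => G y * (x 0 * y 0 + x 1 * y 1) / ‖x‖) (volume : Measure E3)
    have : ∀ y, G (-y) = G y := fun y => h.sy Sy.neg y
    simp only [this, PiLp.neg_apply] at e
    have e' : (∫ y, G y * (x 0 * -y 0 + x 1 * -y 1) / ‖x‖) = -∫ y, G y * (x 0 * y 0 + x 1 * y 1) / ‖x‖ := by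
      rw [← integral_neg]; congr 1; ext y; ring
    linarith
  obtain ⟨M, hM⟩ := hG.mulc (g := fun y => x 0 * y 0 + x 1 * y 1) (by fun_prop)
  rw [hp_eq hG, ← sub_zero (∫ y, _), ← hz, ← integral_sub (pot_int hM x) (hM.int.div_const _), mul_div_assoc, ← integral_mul_const]
  refine norm_integral_le_of_norm_le (hG.int.abs.mul_const _) (Eventually.of_forall fun y => ?_)
  rcases le_or_gt ‖y‖ A with hy | hy
  · have d : ‖x‖ /2 ≤ ‖x - y‖ := by linarith [norm_sub_norm_le x y]
    have d0 : 0 < ‖x - y‖ := by linarith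
    rw [Real.norm_eq_abs, show G y * (x 0 * y 0 + x 1 * y 1) / ‖x - y‖ - G y * (x 0 * y 0 + x 1 * y 1) / ‖x‖ =
      G y * ((x 0 * y 0 + x 1 * y 1) * (‖x‖ - ‖x - y‖) / (‖x - y‖ * ‖x‖)) by field_simp, abs_mul]
    refine mll ?_ (abs_nonneg _)
    rw [abs_div, abs_mul, abs_of_pos (mul_pos d0 x0), div_le_div_iff₀ (by positivity) x0]
    have k1 := hor_le x y
    have k2 : |‖x‖ - ‖x - y‖| ≤ A := (abs_norm_sub_norm_le _ _).trans (by simpa using hy)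
    have k3 := mul_le_mul k1 k2 (abs_nonneg _) (by positivity)
    have k4 : ‖x‖ * ‖y‖ * A ≤ ‖x‖ * A * A := by gcongr
    have k5 := mll d (by positivity : 0 ≤ A ^2 * ‖x‖)
    nlinarith
  · rw [hG.supp y hy]; simp

lemma pd_cm (i j : Fin 3) {f : E3 → ℝ} (hf : Differentiable ℝ f) : pd (ee i) (fun x => x j * f x) = fun x => x j * pd (ee i) f x + (if i = j then f x else 0) := by
  ext x
  have := pd_ee_coord j i x
  unfold pd at *
  rw [fderiv_fun_mul (by fun_prop) (hf x)]
  simp only [_root_.add_apply, _root_.smul_apply, smul_eq_mul]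
  rw [this]; by_cases h : i = j
  · simp [h]
  · simp [h, Ne.symm h]

lemma lap_cm (j : Fin 3) {f : E3 → ℝ} (hf : ContDiff ℝ 2 f) (x : E3) : lap (fun x => x j * f x) x = x j * lap f x +2 * pd (ee j) f x := by
  have k : ∀ i, dd [ee i, ee i] (fun x => x j * f x) x = x j * dd [ee i, ee i] f x + (if i = j then 2 * pd (ee j) f x else 0) := fun i => by
    have d : Differentiable ℝ (pd (ee i) f) := (cd_pd (n := 1) (by exact_mod_cast hf) (ee i)).differentiable (by norm_num)
    simp only [dd]
    rw [pd_cm i j (hf.differentiable (by norm_num))]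
    split_ifs with h
    · subst h
      have e : pd (ee i) (fun x => x i * pd (ee i) f x + f x) x = pd (ee i) (fun x => x i * pd (ee i) f x) x + pd (ee i) f x := by
        rw [pd, fderiv_fun_add (by fun_prop) (hf.differentiable (by norm_num) x)]; rfl
      rw [e, pd_cm i i d]; simp; ring
    · simp only [add_zero]; rw [pd_cm i j d]; simp [h]
  rw [lap, lap, Finset.sum_congr rfl fun i _ => k i, Finset.sum_add_distrib, Finset.mul_sum]; simp

lemma LOp_eq {ψ : E3 → ℝ} (h : ContDiff ℝ 2 ψ) {x : E3} (hx : rr2 x ≠0) :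
    LOp ψ x = (rr2 x)⁻¹ * lap ψ x - 2 * (rr2 x)⁻¹ ^2 * (x 0 * pd (ee 0) ψ x + x 1 * pd (ee 1) ψ x) := by
  have r : HasFDerivAt rr2 ((2 * x 0) • (EuclideanSpace.proj (0 : Fin 3) : E3 →L[ℝ] ℝ) + (2 * x 1) • (EuclideanSpace.proj (1 : Fin 3) : E3 →L[ℝ] ℝ)) x := by
    have a : ∀ j : Fin 3, HasFDerivAt (fun y : E3 => y j) (EuclideanSpace.proj j : E3 →L[ℝ] ℝ) x := fun j => (EuclideanSpace.proj j : E3 →L[ℝ] ℝ).hasFDerivAt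
    refine (((a 0).pow 2).add ((a 1).pow 2)).congr_fderiv ?_
    simp
  have k : ∀ i, fderiv ℝ (fun y => (((y 0 ^2 + y 1 ^2)⁻¹ : ℝ) • gradient ψ y : E3) i) x (EuclideanSpace.single i 1) =
      (rr2 x)⁻¹ * dd [ee i, ee i] ψ x - (rr2 x)⁻¹ ^2 * (2 * x 0 * (ee i) 0 +2 * x 1 * (ee i) 1) * pd (ee i) ψ x := fun i => by
    have e : (fun y => (((y 0 ^2 + y 1 ^2)⁻¹ : ℝ) • gradient ψ y : E3) i) = fun y => (rr2 y)⁻¹ * pd (ee i) ψ y := by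
      ext y
      rw [PiLp.smul_apply, smul_eq_mul, ← inner_ee (gradient ψ y) i, gradient, InnerProductSpace.toDual_symm_apply]; rfl
    have d : DifferentiableAt ℝ (pd (ee i) ψ) x := (cd_pd (n := 1) (by exact_mod_cast h) (ee i)).differentiable (by norm_num) x
    have := ((hasDerivAt_inv hx).comp_hasFDerivAt x r).mul d.hasFDerivAt
    rw [e]
    refine (congrArg (fun T : E3 →L[ℝ] ℝ => T (ee i)) this.fderiv).trans ?_
    simp [dd, pd, ← pow_two]
    ring
  rw [LOp, div3, Finset.sum_congr rfl fun i _ => k i, lap]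
  simp [Fin.sum_univ_three, ee]
  ring

lemma LOp_alg {a0 a1 : E3 → ℝ} (h0 : ContDiff ℝ 2 a0) (h1 : ContDiff ℝ 2 a1) (ht : ∀ x : E3, x 0 * a1 x = x 1 * a0 x) {S : ℝ} {x : E3}
    (l0 : lap a0 x = S * x 0) (l1 : lap a1 x = S * x 1) (hx : rr2 x ≠0) : LOp (fun x => x 0 * a0 x + x 1 * a1 x) x = S := by
  have d0 : Differentiable ℝ a0 := h0.differentiable (by norm_num)
  have d1 : Differentiable ℝ a1 := h1.differentiable (by norm_num)
  have c0 : ContDiff ℝ 2 fun x : E3 => x 0 * a0 x := by fun_prop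
  have c1 : ContDiff ℝ 2 fun x : E3 => x 1 * a1 x := by fun_prop
  have e : (fun x : E3 => x 0 * a0 x + x 1 * a1 x) = fun x => 1 * (x 0 * a0 x) +1 * (x 1 * a1 x) := by simp
  have L : lap (fun x => x 0 * a0 x + x 1 * a1 x) x = lap (fun x => x 0 * a0 x) x + lap (fun x => x 1 * a1 x) x := by
    rw [lap, lap, lap, ← Finset.sum_add_distrib]
    refine Finset.sum_congr rfl fun i _ => ?_
    rw [e, dd_lin 1 1 [ee i, ee i] (by exact_mod_cast c0) (by exact_mod_cast c1)]; ring
  have D : ∀ i, pd (ee i) (fun x => x 0 * a0 x + x 1 * a1 x) x = pd (ee i) (fun x => x 0 * a0 x) x + pd (ee i) (fun x => x 1 * a1 x) x := fun i => by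
    rw [pd, fderiv_fun_add (c0.differentiable (by norm_num) x) (c1.differentiable (by norm_num) x)]; rfl
  have T : ∀ i, pd (ee i) (fun x => x 0 * a1 x) x = pd (ee i) (fun x => x 1 * a0 x) x := fun i => by rw [funext ht]
  have T0 := T 0
  have T1 := T 1
  rw [LOp_eq (c0.add c1) hx, L, lap_cm 0 h0, lap_cm 1 h1, l0, l1, D, D]
  rw [pd_cm _ _ d0, pd_cm _ _ d1] at T0 T1 ⊢
  rw [pd_cm _ _ d0, pd_cm _ _ d1]
  simp at T0 T1 ⊢
  have k : rr2 x = x 0 ^2 + x 1 ^2 := rfl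
  field_simp
  rw [k]
  linear_combination (-2) * x 1 * T0 +2 * x 0 * T1

lemma hp_C2 (A : ℝ) : ∃ C, 0 ≤ C ∧ ∀ L f, Den1 A L f → ContDiff ℝ 2 (hp f) ∧ ∀ x, |hp f x| + ‖fderiv ℝ (hp f) x‖ + ‖iteratedFDeriv ℝ 2 (hp f) x‖ ≤ C * L := by
  obtain ⟨C, hC, h⟩ := hp_b2 A [] (by simp)
  choose D hD h' using fun i : Fin 3 => hp_b2 A [ee i] (by simp)
  choose E hE h2 using fun i j : Fin 3 => hp_b2 A [ee i, ee j] (by simp)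
  obtain ⟨F, hF, hb⟩ := iter_bd (m := 2)
  have s := fun {g : Fin 3 → ℝ} (hg : ∀ i, 0 ≤ g i) (i) => Finset.single_le_sum (fun j _ => hg j) (Finset.mem_univ i)
  have D0 : 0 ≤ ∑ i, D i := Finset.sum_nonneg fun i _ => hD i
  have E0 : ∀ i, 0 ≤ ∑ j, E i j := fun i => Finset.sum_nonneg fun j _ => hE i j
  have E1 : 0 ≤ ∑ i, ∑ j, E i j := Finset.sum_nonneg fun i _ => E0 i
  refine ⟨C +3 * ∑ i, D i + F * ∑ i, ∑ j, E i j, by positivity, fun L f hf => ?_⟩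
  have c2 : ContDiff ℝ 2 (hp f) := by exact_mod_cast (h2 0 0 L f hf).1
  refine ⟨c2, fun x => ?_⟩
  have e1 := (h L f hf).2 x
  have e2 := clm_bd (fderiv ℝ (hp f) x) (B := (∑ i, D i) * L) fun i => ((h' i L f hf).2 x).trans (mlr (s hD i) hf.nn)
  have e3 := hb (hp f) ((∑ i, ∑ j, E i j) * L) x c2 fun l hl hv => by
    obtain ⟨u, v, rfl⟩ := List.length_eq_two.1 hl
    simp only [List.mem_cons, List.not_mem_nil, or_false, forall_eq_or_imp, forall_eq] at hv
    obtain ⟨⟨i, rfl⟩, ⟨j, rfl⟩⟩ := hv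
    exact ((h2 i j L f hf).2 x).trans (mlr ((s (hE i) j).trans (s E0 i)) hf.nn)
  simp only [dd] at e1
  linarith

lemma hp_smul (c : ℝ) (g : E3 → ℝ) (x : E3) : hp (fun y => c * g y) x = c * hp g x := by
  simp only [hp, pot, mul_assoc, mul_div_assoc, integral_const_mul]; ring

namespace Fam
variable {P : Type*} [TopologicalSpace P] {A B n C : ℝ} {χ : E3 → ℝ} {k K : ℝ → ℝ} {om ep lam : P → ℝ} {ρ G : P → E3 → ℝ}

lemma tΨ (h : Fam A B n C χ k K om ep lam ρ G) (p) {η : ℝ} (hη : 0 < η) : ∀ᶠ p' in 𝓝 p, ∀ x, |Ps ep G p x - Ps ep G p' x| +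
    ‖fderiv ℝ (Ps ep G p) x - fderiv ℝ (Ps ep G p') x‖ + ‖iteratedFDeriv ℝ 2 (Ps ep G p) x - iteratedFDeriv ℝ 2 (Ps ep G p') x‖ ≤ η := by
  have j : JC fun p x => ep p / c0 * G p x := (JC.par (h.cep.div_const c0)).mul h.jG
  have hs : ∀ p x, A < ‖x‖ → ep p / c0 * G p x =0 := fun p x hx => by rw [h.sG p x hx, mul_zero]
  obtain ⟨M, hM, hm⟩ := hp_C2 A
  filter_upwards [j.den1 hs p (η := η / (M +1)) (by positivity)] with p' hp x
  obtain ⟨-, b⟩ := hm _ _ hp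
  obtain ⟨L, hL⟩ := c1_den1 (j.c1 p) (hs p)
  obtain ⟨L', hL'⟩ := c1_den1 (j.c1 p') (hs p')
  have e : (_root_.hp fun x => ep p' / c0 * G p' x - ep p / c0 * G p x) = fun x => Ps ep G p' x - Ps ep G p x := funext fun x => by
    rw [hp_sub hL'.toDen hL.toDen, hp_smul, hp_smul]; rfl
  have b := b x
  have q := h.c2Ψ p
  have q' := h.c2Ψ p'
  have e2 := iteratedFDeriv_sub_apply (i := 2) (x := x) q'.contDiffAt q.contDiffAt
  rw [e, fderiv_fun_sub (q'.differentiable (by norm_num) x) (q.differentiable (by norm_num) x)] at b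
  rw [show (fun x => Ps ep G p' x - Ps ep G p x) = Ps ep G p' - Ps ep G p from rfl, e2] at b
  rw [abs_sub_comm, norm_sub_rev, norm_sub_rev (iteratedFDeriv ℝ 2 _ _)]
  refine b.trans ?_
  rw [mul_div_assoc', div_le_iff₀ (by positivity)]; nlinarith

lemma lop (h : Fam A B n C χ k K om ep lam ρ G) (p) (hs : SymE (G p)) {x : E3} (hx : cylRad x ≠0) :
    LOp (Ps ep G p) x = ep p * ρ p x * k (Ps ep G p x) := by
  obtain ⟨L, hL⟩ := h.dG p
  have hd : ∀ i : Fin 3, ∃ L, Den1 A L fun y => G p y * y i := fun i =>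
    c1_den1 ((h.jG.c1 p).mul (by fun_prop)) fun x hx => by rw [h.sG p x hx, zero_mul]
  have hc : ∀ i : Fin 3, ContDiff ℝ 2 (pot fun y => G p y * y i) := fun i => by
    obtain ⟨L, hL⟩ := hd i
    rw [← cv_N0]; exact (kN0.R2 hL).1
  have hl : ∀ i : Fin 3, lap (fun x => ep p / c0 * pot (fun y => G p y * y i) x) x = ep p * G p x * x i := fun i => by
    obtain ⟨L, hL⟩ := hd i
    have e : (fun x => ep p / c0 * pot (fun y => G p y * y i) x) = fun x => ep p / c0 * pot (fun y => G p y * y i) x +0 * pot (fun y => G p y * y i) x := by simp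
    rw [lap, Finset.sum_congr rfl fun j _ => show _ = ep p / c0 * dd [ee j, ee j] (pot fun y => G p y * y i) x by
      rw [e, dd_lin _ _ [ee j, ee j] (by exact_mod_cast hc i) (by exact_mod_cast hc i)]; ring, ← Finset.mul_sum, ← lap, poisson hL]
    field_simp [c0_ne]
  have hr : rr2 x ≠0 := by
    rw [show rr2 x = cylRad x ^2 from (cyl_sq x).symm]; exact pow_ne_zero _ hx
  have := LOp_alg (contDiff_const.mul (hc 0)) (contDiff_const.mul (hc 1)) (fun x => by linear_combination (ep p / c0) * hp_tan hs hL x) (hl 0) (hl 1) hr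
  rw [mul_assoc, ← h.eG, ← this]
  congr 1; ext x; rw [Ps, hp]; ring
end Fam

lemma fam_ex {R n c C : ℝ} {ρ₀ : E3 → ℝ} (h : LEm R n c (HH n C) (HH (n - 1) (C * n)) ρ₀) (hR : 0 < R) (hn : 1 < n)
    (hneg : ∀ x : E3, R < ‖x‖ → pot ρ₀ x + c <0) {k K : ℝ → ℝ} (hk : ContDiff ℝ 2 k) (hK : ∀ s, HasDerivAt K (k s) s) :
    ∃ δ : ℝ, 0 < δ ∧ ∃ (om ep lam : ℝ × ℝ → ℝ) (ρ G : ℝ × ℝ → E3 → ℝ) (χ : E3 → ℝ), Fam (2 * R) (3 /2 * R) n C χ k K om ep lam ρ G ∧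
      (∀ p : ℝ × ℝ, |p.1| < δ → |p.2| < δ → om p = p.1 ∧ ep p = p.2) ∧ ∀ p, SymE (ρ p) ∧ SymE (G p) ∧ ∫ x, ρ p x = ∫ x, ρ₀ x := by
  have : Fact (0 <2 * R) := ⟨by linarith⟩
  have hc : Continuous (HH n C) := HH_cont (by linarith) C
  obtain ⟨δ, hδ, u, ψ, lam, cu, cψ, clam, u0, hs⟩ := h.sol (A := 2 * R) (by linarith) hc (fun s => (hk.differentiable (by norm_num) s).hasDerivAt)
    (hk.continuous_deriv (by norm_num)) hk.continuous hK
  have ev : ∀ᶠ p in 𝓝 (0 : ℝ × ℝ), ∀ y ∈ {y : closedBall (0:E3) (2 * R) | 3 /2 * R ≤ ‖(y:E3)‖}, u p y <0 := by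
    have kc : IsCompact {y : closedBall (0:E3) (2 * R) | 3 /2 * R ≤ ‖(y:E3)‖} :=
      (isClosed_le continuous_const (continuous_norm.comp continuous_subtype_val)).isCompact
    refine kc.eventually_forall_of_forall_eventually fun y hy => ?_
    have e : Continuous fun q : (ℝ × ℝ) × closedBall (0:E3) (2 * R) => u q.1 q.2 := continuous_eval.comp ((cu.comp continuous_fst).prodMk continuous_snd)
    refine e.continuousAt.eventually_lt (continuousAt_const (y := (0:ℝ))) ?_
    simp only [u0]
    exact hneg _ (lt_of_lt_of_le (by linarith) hy)
  obtain ⟨δ₁, hδ₁, h1⟩ := Metric.eventually_nhds_iff.1 ev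
  obtain ⟨d, hd0, hd1, hd2⟩ : ∃ d : ℝ, 0 < d ∧ d ≤ δ ∧ d < δ₁ := ⟨min δ (δ₁ /2), by positivity, min_le_left _ _, (min_le_right _ _).trans_lt (by linarith)⟩
  let cl : ℝ → ℝ := fun t => max (min t d) (-d)
  have c1 : ∀ t, |cl t| ≤ d := fun t => abs_le.2 ⟨le_max_right _ _, max_le (min_le_right _ _) (by linarith)⟩
  have c2 : ∀ t, |t| < d → cl t = t := fun t ht => by
    have := abs_lt.1 ht
    simp only [cl, min_eq_left this.2.le, max_eq_left this.1.le]
  let Q : ℝ × ℝ → ℝ × ℝ := fun p => (cl p.1, cl p.2)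
  have cQ : Continuous Q := by fun_prop
  let F := fun p => nem hc (u (Q p))
  let g := fun p => F p * nem hk.continuous (ψ (Q p))
  have cF : Continuous F := (nem_cont hc).comp (cu.comp cQ)
  have cg : Continuous g := cF.mul ((nem_cont hk.continuous).comp (cψ.comp cQ))
  have hs' := fun p => hs (Q p) ((c1 p.1).trans hd1) ((c1 p.2).trans hd1)
  have tt : ∀ f : ℝ × ℝ → C(closedBall (0:E3) (2 * R), ℝ), Continuous f → ∀ p, ∀ η > 0, ∀ᶠ p' in 𝓝 p, Den (2 * R) η (fun x => ex (f p') x - ex (f p) x) := fun f hf p η hη => by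
    filter_upwards [Metric.tendsto_nhds.1 (hf.tendsto p) η hη] with p' hp'
    rw [dist_eq_norm] at hp'
    have e := ex_den (f p' + (-1 : ℝ) • f p)
    rw [show f p' + (-1 : ℝ) • f p = f p' - f p by module, show (ex (f p' - f p)) = fun x => ex (f p') x - ex (f p) x from funext fun x => by
      rw [show f p' - f p = f p' + (-1 : ℝ) • f p by module, ex_add, ex_smul]; ring] at e
    exact ⟨e.meas, fun x => (e.bd x).trans hp'.le, e.supp⟩
  have ePs : ∀ p x, ‖x‖ ≤2 * R → Ps (fun p => cl p.2) (fun p => ex (g p)) p x = ψ (Q p) (ret x) := fun p x hx => by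
    rw [(hs' p).2.2, ret_in hx, Ps, (ex_sym (g p)).hp (ex_den _) x]
  have rr : ∀ x, rr2 (fold x) = rr2 x := fun x => by
    simp only [rr2, fold, mk3_0, mk3_1, cyl_sq]; ring
  have eU : ∀ p x, ‖x‖ ≤2 * R → Uu (fun p => cl p.1) (fun p => cl p.2) (fun p => lam (Q p)) K (fun p => ex (F p)) (fun p => ex (g p)) p x = u (Q p) (ret x) := fun p x hx => by
    rw [(hs' p).1, Uu, ePs p x hx, ret_in hx, (ex_sym (F p)).pot x, ← rr x]
    simp only [rr2, F, Q]; ring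
  let χ : ContDiffBump (0:E3) := ⟨3 /2 * R, 2 * R, by positivity, by linarith⟩
  refine ⟨d, hd0, fun p => cl p.1, fun p => cl p.2, fun p => lam (Q p), fun p => ex (F p), fun p => ex (g p), χ,
    ⟨χ.contDiff, fun x hx => χ.one_of_mem_closedBall (by simpa using hx), fun x hx => χ.zero_of_le_dist (by simpa using hx.le), fun x => χ.nonneg, fun x => χ.le_one,
      hn, hk, hK, by fun_prop, by fun_prop, clam.comp cQ, fun p => ⟨_, ex_den _⟩, fun p => ⟨_, ex_den _⟩, tt F cF, tt g cg, fun p x hx => ?_, fun p x => ?_, fun p x hx hx' => ?_⟩,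
    fun p h1 h2 => ⟨c2 _ h1, c2 _ h2⟩, fun p => ⟨ex_sym _, ex_sym _, (hs' p).2.1⟩⟩
  · rw [ex_in _ hx, eU p x hx]; rfl
  · rcases le_or_gt ‖x‖ (2 * R) with hx | hx
    · rw [ex_in _ hx, ex_in _ hx, ePs p x hx]; rfl
    · rw [ex_out _ hx, ex_out _ hx, zero_mul]
  · rw [eU p x hx']
    refine (h1 (y := Q p) ?_ _ ?_).le
    · rw [dist_zero_right]; exact (max_le (c1 p.1) (c1 p.2)).trans_lt hd2
    · rw [mem_setOf_eq, ret_in hx', fold_norm]; exact hx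
end

theorem existence_of_rotating_magnetic_stars
    (γ : ℝ) (hγ1 : 6/5 < γ) (hγ2 : γ < 2) (hγ3 : γ ≠ 4/3)
    (α : ℝ) (hα : α = min ((2 - γ)/(γ - 1)) 1)
    (hent : ℝ → ℝ) (hhent : ∀ s : ℝ, hent s = (γ/(γ - 1)) * s ^ (γ - 1))
    (k : ℝ → ℝ) (hk : ContDiff ℝ 2 k)
    (K : ℝ → ℝ) (hK : ∀ s : ℝ, K s = ∫ t in (0:ℝ)..s, k t)
    (R : ℝ) (hR : 0 < R)
    (ρ₀ : E3 → ℝ)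
    (hradial : ∃ F : ℝ → ℝ, ∀ x : E3, ρ₀ x = F ‖x‖)
    (hnonneg : ∀ x, 0 ≤ ρ₀ x)
    (hposball : ∀ x : E3, 0 < ρ₀ x ↔ ‖x‖ < R)
    (hreg1 : HolderC1 α ρ₀)
    (hreg2 : ContDiffOn ℝ 2 ρ₀ (ball (0:E3) R))
    (hLaneEmden : ∃ c : ℝ, ∀ x ∈ ball (0:E3) R, hent (ρ₀ x) - pot ρ₀ x = c) :
    ∃ ωbar : ℝ, 0 < ωbar ∧ ∃ εbar : ℝ, 0 < εbar ∧
      ∃ ρ ψ : ℝ → ℝ → E3 → ℝ,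
        (∀ ω ε : ℝ, |ω| < ωbar → |ε| < εbar →
          HolderC1 α (ρ ω ε) ∧ HolderC3 α (ψ ω ε) ∧
          (∀ x, 0 ≤ ρ ω ε x) ∧
          HasCompactSupport (ρ ω ε) ∧
          Function.support (ρ ω ε) ⊆ closedBall (0:E3) (2*R) ∧
          Axisym (ρ ω ε) ∧ EvenZ (ρ ω ε) ∧ Axisym (ψ ω ε) ∧ EvenZ (ψ ω ε) ∧
          Tendsto (ψ ω ε) (cocompact E3) (nhds 0) ∧
          (∫ x : E3, ρ ω ε x) = (∫ x : E3, ρ₀ x) ∧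
          (∃ lam : ℝ, ∀ x : E3, 0 < ρ ω ε x →
            hent (ρ ω ε x) - (1/2) * ω^2 * ((x 0)^2 + (x 1)^2)
              - pot (ρ ω ε) x + ε * K (ψ ω ε x) = lam) ∧
          (∀ x : E3, cylRad x ≠ 0 →
            LOp (ψ ω ε) x = ε * ρ ω ε x * k (ψ ω ε x))) ∧
        (∀ ω ε : ℝ, |ω| < ωbar → |ε| < εbar →
          ∀ η : ℝ, 0 < η → ∃ d : ℝ, 0 < d ∧
            ∀ ω' ε' : ℝ, |ω'| < ωbar → |ε'| < εbar →
              |ω - ω'| < d → |ε - ε'| < d →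
                (∀ x ∈ closedBall (0:E3) (2*R),
                  |ρ ω ε x - ρ ω' ε' x|
                    + ‖fderiv ℝ (ρ ω ε) x - fderiv ℝ (ρ ω' ε') x‖ ≤ η) ∧
                (∀ x : E3,
                  |ψ ω ε x - ψ ω' ε' x|
                    + ‖fderiv ℝ (ψ ω ε) x - fderiv ℝ (ψ ω' ε') x‖
                    + ‖iteratedFDeriv ℝ 2 (ψ ω ε) x - iteratedFDeriv ℝ 2 (ψ ω' ε') x‖
                      ≤ η)) := by
  have hKd : ∀ s, HasDerivAt K (k s) s := fun s => by
    rw [funext hK]; exact (hk.continuous.integral_hasStrictDerivAt 0 s).hasDerivAt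
  obtain ⟨n, C, c, hn, hC, hnγ, hinv, hLE, hneg⟩ := LE_data hγ1 hγ2 hγ3 hR hhent hradial hnonneg hposball hreg1.1 hLaneEmden
  obtain ⟨δ, hδ, om, ep, lam, ρ, G, χ, h, hp, hS⟩ := fam_ex hLE hR hn hneg hk hKd
  rw [← hnγ] at hα
  subst hα
  have R2 : 0 <2 * R := by linarith
  refine ⟨δ, hδ, δ, hδ, fun ω ε => ρ (ω, ε), fun ω ε => Ps ep G (ω, ε), fun ω ε hω hε => ?_, fun ω ε hω hε η hη => ?_⟩
  · obtain ⟨eo, ee⟩ := hp (ω, ε) hω hε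
    obtain ⟨s1, s2, hm⟩ := hS (ω, ε)
    obtain ⟨L, hL⟩ := h.dG (ω, ε)
    have s3 : SymE (Ps ep G (ω, ε)) := fun x => by rw [Ps, Ps, s2.hp hL x]
    have sup : Function.support (ρ (ω, ε)) ⊆ closedBall (0:E3) (2 * R) := fun x hx => by
      by_contra h'
      exact hx (h.sρ _ x (by simpa using h'))
    refine ⟨(h.core _).1, h.h3 _, fun x => ?_, .of_support_subset_isCompact (isCompact_closedBall _ _) sup, sup, s1.ax, s1.ev, s3.ax, s3.ev,
      ?_, hm, ⟨lam (ω, ε), fun x hx => ?_⟩, fun x hx => ?_⟩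
    · beta_reduce; rw [h.rho, HH]; positivity
    · have := (hp_decay R2 s2 hL).const_mul (ep (ω, ε) / c0)
      rw [mul_zero] at this; exact this
    · beta_reduce at hx ⊢
      have hx' : ‖x‖ ≤2 * R := by
        by_contra h'
        rw [h.sρ _ x (by simpa using h')] at hx; exact lt_irrefl _ hx
      have e := h.eρ (ω, ε) x hx'
      have hU : 0 < Uu om ep lam K ρ G (ω, ε) x := by
        by_contra h'
        rw [e, HH_neg (by linarith) C (not_lt.1 h')] at hx; exact lt_irrefl _ hx
      rw [e, hinv _ hU, Uu, eo, ee, rr2]; ring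
    · rw [h.lop _ s2 hx, ee]
  · have e := (h.tΨ (ω, ε) hη).and (h.jρ.unif (2 * R) (ω, ε) (half_pos hη))
    obtain ⟨d, hd, H⟩ := Metric.eventually_nhds_iff.1 e
    refine ⟨d, hd, fun ω' ε' _ _ h1 h2 => ?_⟩
    obtain ⟨a, b⟩ := H (y := (ω', ε')) (by
      rw [Prod.dist_eq, Real.dist_eq, Real.dist_eq, abs_sub_comm, abs_sub_comm ε']; exact max_lt h1 h2)
    refine ⟨fun x hx => ?_, a⟩
    obtain ⟨b1, b2⟩ := b x hx
    rw [abs_sub_comm, norm_sub_rev]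
    linarith
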